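/- Assume ω_1 = 0 in R. For any positive integer k there is a superalgebra homomorphism Φ_k : BC^{aff}_{r,t} → BC_{r+k,t+k} sending s_i ↦ s_{k+i}, s̄_j ↦ s̄_{k+j}, e_1 ↦ e_{k+1}, x_1 ↦ y_{k+1}, x̄_1 ↦ ȳ_{k+1}, c_l ↦ c_{k+l}, c̄_m ↦ c̄_{k+m}, ω_a ↦ ω_{a,k+1}, ω̄_a ↦ ω̄_{a,k+1}, for all admissible a, i, j, l, m. -/

import Mathlib

open Polynomial

noncomputable section

/-- Transposition `(a b)` (0-based indices) in the symmetric group on `Fin n`;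
it is `1` if an index is out of range. -/
def sw (n a b : ℕ) : Equiv.Perm (Fin n) :=
  if h : a < n ∧ b < n then Equiv.swap ⟨a, h.1⟩ ⟨b, h.2⟩ else 1

/-- The permutation word `s_{i,j}` of the paper (1-based indices):
`s_{i,j} = s_i s_{i+1,j}` for `i < j`, `s_{i,i} = 1`, `s_{i,j} = s_{i,j+1} s_j` for `i > j`. -/
def sIJ (n i j : ℕ) : Equiv.Perm (Fin n) :=
  if i < j then ((List.range' i (j - i)).map (fun k => sw n (k - 1) k)).prod
  else ((List.range' j (i - j)).reverse.map (fun k => sw n (k - 1) k)).prod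

/-- The coefficients `a_{2n+1,j}` of the paper: `acoef ω n j = a_{2n+1,j}`, defined by the
recursion `a_{1,0} = -1`, `a_{2n+1,j+1} = a_{2n-1,j}` and
`a_{2n+1,0} = ∑_{j=0}^{n-1} a_{2n-1,j} ω_{2j+1}`. -/
def acoef {A : Type} [Ring A] (ω : ℕ → A) : ℕ → ℕ → A
  | 0, _ => -1
  | n + 1, 0 => ∑ j ∈ Finset.range (n + 1), acoef ω n j * ω (2 * j + 1)
  | n + 1, j + 1 => acoef ω n j

/-- The parameters `ω̄_k` determined by the parameters `ω` as in Corollary 3.5: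
`ω̄_{2n} = 0` and `ω̄_{2n+1} = ∑_{j=0}^{n} a_{2n+1,j} ω_{2j+1}`. -/
def obar {R : Type} [CommRing R] (ω : ℕ → R) (k : ℕ) : R :=
  if k % 2 = 0 then 0
  else ∑ j ∈ Finset.range (k / 2 + 1), acoef ω (k / 2) j * ω (2 * j + 1)

/-- Data for the presentation of the walled Brauer–Clifford superalgebra `BC_{r,t}`
(Definition 2.1 together with relations (2.1)–(2.3)) on an `R`-algebra `A`.
The images of the two symmetric groups are recorded as monoid homomorphisms, so the
symmetric group relations among the `s_i` (resp. `s̄_j`) hold automatically. -/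
structure WBC (R A : Type) [CommRing R] [Ring A] [Algebra R A] (r t : ℕ) : Type where
  σ : Equiv.Perm (Fin r) →* A
  σb : Equiv.Perm (Fin t) →* A
  c : Fin r → A
  cb : Fin t → A
  e : A
  c_sq : ∀ i, c i * c i = -1
  c_anti : ∀ i j, i ≠ j → c i * c j = -(c j * c i)
  c_conj : ∀ w i, σ w * c i * σ (w⁻¹) = c (w i)
  cb_sq : ∀ i, cb i * cb i = 1
  cb_anti : ∀ i j, i ≠ j → cb i * cb j = -(cb j * cb i)
  cb_conj : ∀ w i, σb w * cb i * σb (w⁻¹) = cb (w i)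
  comm_σσb : ∀ w v, σ w * σb v = σb v * σ w
  comm_σcb : ∀ w j, σ w * cb j = cb j * σ w
  comm_σbc : ∀ v i, σb v * c i = c i * σb v
  anti_ccb : ∀ i j, c i * cb j = -(cb j * c i)
  e_c1 : ∀ (h1 : 0 < r) (h2 : 0 < t), e * c ⟨0, h1⟩ = e * cb ⟨0, h2⟩
  c1_e : ∀ (h1 : 0 < r) (h2 : 0 < t), c ⟨0, h1⟩ * e = cb ⟨0, h2⟩ * e
  e_sq : e * e = 0
  e_s_e : 1 < r → e * σ (sw r 0 1) * e = e
  e_sb_e : 1 < t → e * σb (sw t 0 1) * e = e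
  s_e_comm : ∀ i : ℕ, 0 < i → i + 1 < r → σ (sw r i (i + 1)) * e = e * σ (sw r i (i + 1))
  sb_e_comm : ∀ j : ℕ, 0 < j → j + 1 < t → σb (sw t j (j + 1)) * e = e * σb (sw t j (j + 1))
  braid1 : 1 < r → 1 < t →
    e * σ (sw r 0 1) * σb (sw t 0 1) * e * σ (sw r 0 1)
      = e * σ (sw r 0 1) * σb (sw t 0 1) * e * σb (sw t 0 1)
  braid2 : 1 < r → 1 < t →
    σ (sw r 0 1) * e * σ (sw r 0 1) * σb (sw t 0 1) * e
      = σb (sw t 0 1) * e * σ (sw r 0 1) * σb (sw t 0 1) * e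
  c_e_comm : ∀ i : Fin r, (i : ℕ) ≠ 0 → c i * e = e * c i
  cb_e_comm : ∀ j : Fin t, (j : ℕ) ≠ 0 → cb j * e = e * cb j
  e_c_e : ∀ h : 0 < r, e * c ⟨0, h⟩ * e = 0
  e_cb_e : ∀ h : 0 < t, e * cb ⟨0, h⟩ * e = 0

namespace WBC

variable {R A : Type} [CommRing R] [Ring A] [Algebra R A] {r t : ℕ}

/-- The transposition `(i,j) ∈ Σ_r` (1-based indices). -/
def tr (d : WBC R A r t) (i j : ℕ) : A := d.σ (sw r (i - 1) (j - 1))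

/-- The transposition `(ī,j̄) ∈ Σ_t` (1-based indices). -/
def trb (d : WBC R A r t) (i j : ℕ) : A := d.σb (sw t (i - 1) (j - 1))

/-- The generator `s_j = (j, j+1)` (1-based). -/
def s (d : WBC R A r t) (j : ℕ) : A := d.σ (sw r (j - 1) j)

/-- The generator `s̄_j` (1-based). -/
def sb (d : WBC R A r t) (j : ℕ) : A := d.σb (sw t (j - 1) j)

/-- The generator `c_i` (1-based). -/
def cn (d : WBC R A r t) (i : ℕ) : A := if h : i - 1 < r then d.c ⟨i - 1, h⟩ else 0

/-- The generator `c̄_i` (1-based). -/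
def cbn (d : WBC R A r t) (i : ℕ) : A := if h : i - 1 < t then d.cb ⟨i - 1, h⟩ else 0

/-- `e_{i,j} = (1̄,j̄)(1,i) e_1 (1,i)(1̄,j̄)` (1-based). -/
def E (d : WBC R A r t) (i j : ℕ) : A := d.trb 1 j * d.tr 1 i * d.e * d.tr 1 i * d.trb 1 j

/-- `ē_{i,j} = c_i e_{i,j} c_i`. -/
def Eb (d : WBC R A r t) (i j : ℕ) : A := d.cn i * d.E i j * d.cn i

/-- `L'_i = ∑_{j=1}^{i-1} (j,i)`. -/
def LL (d : WBC R A r t) (i : ℕ) : A := ∑ j ∈ Finset.Ico 1 i, d.tr j i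

/-- The Jucys–Murphy element `L_i = L'_i + c_i L'_i c_i`. -/
def L (d : WBC R A r t) (i : ℕ) : A := d.LL i + d.cn i * d.LL i * d.cn i

/-- `L̄'_i = ∑_{j=1}^{i-1} (j̄,ī)`. -/
def LLb (d : WBC R A r t) (i : ℕ) : A := ∑ j ∈ Finset.Ico 1 i, d.trb j i

/-- The Jucys–Murphy element `L̄_i = L̄'_i - c̄_i L̄'_i c̄_i`. -/
def Lb (d : WBC R A r t) (i : ℕ) : A := d.LLb i - d.cbn i * d.LLb i * d.cbn i

/-- `y_i = ∑_{j=1}^{i-1} (e_{i,j} + ē_{i,j}) - L_i`. -/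
def y (d : WBC R A r t) (i : ℕ) : A := (∑ j ∈ Finset.Ico 1 i, (d.E i j + d.Eb i j)) - d.L i

/-- `ȳ_i = ∑_{j=1}^{i-1} (e_{j,i} - ē_{j,i}) - L̄_i`. -/
def yb (d : WBC R A r t) (i : ℕ) : A := (∑ j ∈ Finset.Ico 1 i, (d.E j i - d.Eb j i)) - d.Lb i

/-- `c^α = c_1^{α_1} ⋯ c_r^{α_r}`. -/
def cpow (d : WBC R A r t) (α : Fin r → Fin 2) : A :=
  ((List.finRange r).map (fun i => d.c i ^ (α i : ℕ))).prod

/-- `c̄^β = c̄_1^{β_1} ⋯ c̄_t^{β_t}`. -/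
def cbpow (d : WBC R A r t) (β : Fin t → Fin 2) : A :=
  ((List.finRange t).map (fun j => d.cb j ^ (β j : ℕ))).prod

/-- `e^f = e_1 e_2 ⋯ e_f`. -/
def epow (d : WBC R A r t) (f : ℕ) : A :=
  ((List.range f).map (fun i => d.E (i + 1) (i + 1))).prod

/-- Generators of the subalgebra `BC_{m,m}`: the elements `e_1`, `s_1, …, s_{m-1}`,
`s̄_1, …, s̄_{m-1}`, `c_1` and `c̄_1` (interpreted as `∅` when `m = 0`). -/
def lowerGens (d : WBC R A r t) (m : ℕ) : Set A :=
  {x | (1 ≤ m ∧ x = d.e) ∨ (∃ j : ℕ, 1 ≤ j ∧ j + 1 ≤ m ∧ x = d.s j)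
    ∨ (∃ j : ℕ, 1 ≤ j ∧ j + 1 ≤ m ∧ x = d.sb j)
    ∨ (1 ≤ m ∧ x = d.cn 1) ∨ (1 ≤ m ∧ x = d.cbn 1)}

end WBC

/-- `φ` intertwines two sets of walled Brauer–Clifford data. -/
structure WBCHom {R A B : Type} [CommRing R] [Ring A] [Algebra R A] [Ring B] [Algebra R B]
    {r t : ℕ} (d : WBC R A r t) (d' : WBC R B r t) (φ : A →ₐ[R] B) : Prop where
  map_σ : ∀ w, φ (d.σ w) = d'.σ w
  map_σb : ∀ w, φ (d.σb w) = d'.σb w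
  map_c : ∀ i, φ (d.c i) = d'.c i
  map_cb : ∀ j, φ (d.cb j) = d'.cb j
  map_e : φ d.e = d'.e

/-- `A` (with the data `d`) *is* the walled Brauer–Clifford superalgebra `BC_{r,t}`:
it is initial among all algebras with such data. -/
def WBC.IsUniversal {R A : Type} [CommRing R] [Ring A] [Algebra R A] {r t : ℕ}
    (d : WBC R A r t) : Prop :=
  ∀ (B : Type) [Ring B] [Algebra R B], ∀ d' : WBC R B r t, ∃! φ : A →ₐ[R] B, WBCHom d d' φ

/-- An element of `D^f_{r,t}`: data `1 ≤ i_1 < ⋯ < i_f ≤ r` and `k ≤ j_k ≤ t`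
(all 1-based) describing `s_{f,i_f} s̄_{f,j_f} ⋯ s_{1,i_1} s̄_{1,j_1}`. -/
structure DElt (r t f : ℕ) : Type where
  a : Fin f → ℕ
  b : Fin f → ℕ
  ha_mono : StrictMono a
  ha_lb : ∀ k, 1 ≤ a k
  ha_ub : ∀ k, a k ≤ r
  hb_lb : ∀ k : Fin f, (k : ℕ) + 1 ≤ b k
  hb_ub : ∀ k, b k ≤ t

/-- The `Σ_r`-component `s_{f,i_f} ⋯ s_{1,i_1}` of the element of `D^f_{r,t}`. -/
def DElt.pr {r t f : ℕ} (x : DElt r t f) : Equiv.Perm (Fin r) :=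
  ((List.finRange f).reverse.map (fun (k : Fin f) => sIJ r ((k : ℕ) + 1) (x.a k))).prod

/-- The `Σ_t`-component `s̄_{f,j_f} ⋯ s̄_{1,j_1}` of the element of `D^f_{r,t}`. -/
def DElt.pt {r t f : ℕ} (x : DElt r t f) : Equiv.Perm (Fin t) :=
  ((List.finRange f).reverse.map (fun (k : Fin f) => sIJ t ((k : ℕ) + 1) (x.b k))).prod

/-- Index for the basis `{c^α d_1⁻¹ e^f w d_2 c̄^β}` of `BC_{r,t}`; the component
`w ∈ Σ_{r-f} × Σ_{t-f}` is a pair of permutations fixing `1, …, f` pointwise. -/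
structure BCIndex (r t : ℕ) : Type where
  α : Fin r → Fin 2
  β : Fin t → Fin 2
  f : ℕ
  hf : f ≤ min r t
  d1 : DElt r t f
  d2 : DElt r t f
  w : Equiv.Perm (Fin r)
  wb : Equiv.Perm (Fin t)
  hw : ∀ i : Fin r, (i : ℕ) < f → w i = i
  hwb : ∀ j : Fin t, (j : ℕ) < f → wb j = j

/-- The basis element `c^α d_1⁻¹ e^f w d_2 c̄^β` of Theorem 2.4. -/
def WBC.basElt {R A : Type} [CommRing R] [Ring A] [Algebra R A] {r t : ℕ}
    (d : WBC R A r t) (x : BCIndex r t) : A :=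
  d.cpow x.α * d.σ (x.d1.pr⁻¹) * d.σb (x.d1.pt⁻¹) * d.epow x.f *
    d.σ x.w * d.σb x.wb * d.σ x.d2.pr * d.σb x.d2.pt * d.cbpow x.β

/-- Data for the presentation of the affine walled Brauer–Clifford superalgebra
`BC^aff_{r,t}` (Definition 3.1) with distinguished parameter `ω_1 ∈ R`.
`om k` is `ω_k` (with `ω_1` the scalar `ω1` and `ω_{2k} = 0`), `omb k` is `ω̄_k`. -/
structure AWBC (R A : Type) [CommRing R] [Ring A] [Algebra R A] (r t : ℕ) (ω1 : R)
    extends WBC R A r t : Type where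
  x1 : A
  xb1 : A
  om : ℕ → A
  omb : ℕ → A
  om_one : om 1 = algebraMap R A ω1
  om_even : ∀ k, om (2 * k) = 0
  omb_zero : omb 0 = 0
  om_comm : ∀ k, (∀ w, om k * σ w = σ w * om k) ∧ (∀ w, om k * σb w = σb w * om k) ∧
    (∀ i, om k * c i = c i * om k) ∧ (∀ j, om k * cb j = cb j * om k) ∧
    om k * e = e * om k ∧ om k * x1 = x1 * om k ∧ om k * xb1 = xb1 * om k ∧
    (∀ l, om k * om l = om l * om k) ∧ (∀ l, om k * omb l = omb l * om k)
  omb_comm : ∀ k, (∀ w, omb k * σ w = σ w * omb k) ∧ (∀ w, omb k * σb w = σb w * omb k) ∧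
    (∀ i, omb k * c i = c i * omb k) ∧ (∀ j, omb k * cb j = cb j * omb k) ∧
    omb k * e = e * omb k ∧ omb k * x1 = x1 * omb k ∧ omb k * xb1 = xb1 * omb k ∧
    (∀ l, omb k * omb l = omb l * omb k)
  x_comm : ∀ h : 1 < r, x1 * (σ (sw r 0 1) * x1 * σ (sw r 0 1)
      - (1 - c ⟨0, by omega⟩ * c ⟨1, h⟩) * σ (sw r 0 1))
    = (σ (sw r 0 1) * x1 * σ (sw r 0 1)
      - (1 - c ⟨0, by omega⟩ * c ⟨1, h⟩) * σ (sw r 0 1)) * x1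
  x1_c1 : ∀ h : 0 < r, x1 * c ⟨0, h⟩ = -(c ⟨0, h⟩ * x1)
  x1_c : ∀ i : Fin r, (i : ℕ) ≠ 0 → x1 * c i = c i * x1
  s_x1 : ∀ i : ℕ, 0 < i → i + 1 < r → σ (sw r i (i + 1)) * x1 = x1 * σ (sw r i (i + 1))
  xb_comm : ∀ h : 1 < t, xb1 * (σb (sw t 0 1) * xb1 * σb (sw t 0 1)
      - (1 + cb ⟨0, by omega⟩ * cb ⟨1, h⟩) * σb (sw t 0 1))
    = (σb (sw t 0 1) * xb1 * σb (sw t 0 1)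
      - (1 + cb ⟨0, by omega⟩ * cb ⟨1, h⟩) * σb (sw t 0 1)) * xb1
  xb1_cb1 : ∀ h : 0 < t, xb1 * cb ⟨0, h⟩ = -(cb ⟨0, h⟩ * xb1)
  xb1_cb : ∀ j : Fin t, (j : ℕ) ≠ 0 → xb1 * cb j = cb j * xb1
  sb_xb1 : ∀ j : ℕ, 0 < j → j + 1 < t → σb (sw t j (j + 1)) * xb1 = xb1 * σb (sw t j (j + 1))
  e_xsum : e * (x1 + xb1) = 0
  xsum_e : (x1 + xb1) * e = 0
  e_sxs : 1 < r → e * (σ (sw r 0 1) * x1 * σ (sw r 0 1)) = (σ (sw r 0 1) * x1 * σ (sw r 0 1)) * e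
  x_mixed : ∀ h : 0 < r, x1 * (e + xb1 - c ⟨0, h⟩ * e * c ⟨0, h⟩)
      = (e - c ⟨0, h⟩ * e * c ⟨0, h⟩ + xb1) * x1
  e_sbxbsb : 1 < t →
    e * (σb (sw t 0 1) * xb1 * σb (sw t 0 1)) = (σb (sw t 0 1) * xb1 * σb (sw t 0 1)) * e
  e_xodd : ∀ k : ℕ, e * x1 ^ (2 * k + 1) * e = om (2 * k + 1) * e
  e_xeven : ∀ k : ℕ, 1 ≤ k → e * x1 ^ (2 * k) * e = 0
  e_xb : ∀ k : ℕ, 1 ≤ k → e * xb1 ^ k * e = omb k * e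
  x1_cb_comm : ∀ j, x1 * cb j = cb j * x1
  xb1_c_comm : ∀ i, xb1 * c i = c i * xb1
  x1_σb : ∀ w, σb w * x1 = x1 * σb w
  xb1_σ : ∀ w, σ w * xb1 = xb1 * σ w

namespace AWBC

variable {R A : Type} [CommRing R] [Ring A] [Algebra R A] {r t : ℕ} {ω1 : R}

/-- `x'_i = s_{i-1} ⋯ s_1 x_1 s_1 ⋯ s_{i-1}` (1-based). -/
def xp (d : AWBC R A r t ω1) (i : ℕ) : A :=
  ((List.range (i - 1)).reverse.map (fun k => d.toWBC.s (k + 1))).prod * d.x1 *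
    ((List.range (i - 1)).map (fun k => d.toWBC.s (k + 1))).prod

/-- `x̄'_j = s̄_{j-1} ⋯ s̄_1 x̄_1 s̄_1 ⋯ s̄_{j-1}` (1-based). -/
def xbp (d : AWBC R A r t ω1) (j : ℕ) : A :=
  ((List.range (j - 1)).reverse.map (fun k => d.toWBC.sb (k + 1))).prod * d.xb1 *
    ((List.range (j - 1)).map (fun k => d.toWBC.sb (k + 1))).prod

/-- `x_i = x'_i - L_i`. -/
def xv (d : AWBC R A r t ω1) (i : ℕ) : A := d.xp i - d.toWBC.L i

/-- `x̄_j = x̄'_j - L̄_j`. -/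
def xbv (d : AWBC R A r t ω1) (j : ℕ) : A := d.xbp j - d.toWBC.Lb j

/-- `x^α = x_1^{α_1} ⋯ x_r^{α_r}`. -/
def xpow (d : AWBC R A r t ω1) (α : Fin r → ℕ) : A :=
  ((List.finRange r).map (fun (i : Fin r) => d.xv ((i : ℕ) + 1) ^ α i)).prod

/-- `x̄^β = x̄_1^{β_1} ⋯ x̄_t^{β_t}`. -/
def xbpow (d : AWBC R A r t ω1) (β : Fin t → ℕ) : A :=
  ((List.finRange t).map (fun (j : Fin t) => d.xbv ((j : ℕ) + 1) ^ β j)).prod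

/-- `∏_{n ∈ ℤ^{>0}} ω_{2n+1}^{a_{2n+1}}`, where `g i` is the exponent of `ω_{2(i+1)+1}`. -/
def ompow (d : AWBC R A r t ω1) (g : ℕ →₀ ℕ) : A :=
  ((g.support.sort (· ≤ ·)).map (fun n => d.om (2 * n + 3) ^ g n)).prod

/-- `z_i = x'_i + y_i`. -/
def z (d : AWBC R A r t ω1) (i : ℕ) : A := d.xp i + d.toWBC.y i

/-- `z̄_j = x̄'_j + ȳ_j`. -/
def zb (d : AWBC R A r t ω1) (j : ℕ) : A := d.xbp j + d.toWBC.yb j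

/-- Generators of the subalgebra `BC_{2,m,m}`-type subalgebra:
`e_1, s_1, …, s_{m-1}, s̄_1, …, s̄_{m-1}, c_1, c̄_1, x_1, x̄_1`. -/
def lowerGensA (d : AWBC R A r t ω1) (m : ℕ) : Set A :=
  d.toWBC.lowerGens m ∪ {x | 1 ≤ m ∧ (x = d.x1 ∨ x = d.xb1)}

end AWBC

/-- `φ` intertwines two sets of affine walled Brauer–Clifford data. -/
structure AWBCHom {R A B : Type} [CommRing R] [Ring A] [Algebra R A] [Ring B] [Algebra R B]
    {r t : ℕ} {ω1 : R} (d : AWBC R A r t ω1) (d' : AWBC R B r t ω1) (φ : A →ₐ[R] B) : Prop where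
  map_σ : ∀ w, φ (d.σ w) = d'.σ w
  map_σb : ∀ w, φ (d.σb w) = d'.σb w
  map_c : ∀ i, φ (d.c i) = d'.c i
  map_cb : ∀ j, φ (d.cb j) = d'.cb j
  map_e : φ d.e = d'.e
  map_x1 : φ d.x1 = d'.x1
  map_xb1 : φ d.xb1 = d'.xb1
  map_om : ∀ k, φ (d.om k) = d'.om k
  map_omb : ∀ k, φ (d.omb k) = d'.omb k

/-- `A` (with the data `d`) is the affine walled Brauer–Clifford superalgebra
`BC^aff_{r,t}` of Definition 3.1. -/
def AWBC.IsUniversal {R A : Type} [CommRing R] [Ring A] [Algebra R A] {r t : ℕ} {ω1 : R}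
    (d : AWBC R A r t ω1) : Prop :=
  ∀ (B : Type) [Ring B] [Algebra R B], ∀ d' : AWBC R B r t ω1,
    ∃! φ : A →ₐ[R] B, AWBCHom d d' φ

/-- Assumption 3.6: the parameters `ω̄` are determined by the `ω`'s as in Corollary 3.5. -/
def AWBC.Ass36 {R A : Type} [CommRing R] [Ring A] [Algebra R A] {r t : ℕ} {ω1 : R}
    (d : AWBC R A r t ω1) : Prop :=
  (∀ n, d.omb (2 * n) = 0) ∧
  (∀ n, d.omb (2 * n + 1) = ∑ j ∈ Finset.range (n + 1), acoef d.om n j * d.om (2 * j + 1))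

/-- `A` (with the data `d`) is the affine walled Brauer–Clifford superalgebra
`BC^aff_{r,t}` subject to Assumption 3.6. -/
def AWBC.IsUniversal36 {R A : Type} [CommRing R] [Ring A] [Algebra R A] {r t : ℕ} {ω1 : R}
    (d : AWBC R A r t ω1) : Prop :=
  d.Ass36 ∧ ∀ (B : Type) [Ring B] [Algebra R B], ∀ d' : AWBC R B r t ω1,
    d'.Ass36 → ∃! φ : A →ₐ[R] B, AWBCHom d d' φ

/-- The parameters `ω_k`, `ω̄_k` are the scalars `ω k`, `obar ω k` (specialization defining
the algebra `B̃C_{r,t}` of Definition 3.13). -/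
def AWBC.IsSpec {R A : Type} [CommRing R] [Ring A] [Algebra R A] {r t : ℕ} {ω1 : R}
    (d : AWBC R A r t ω1) (ω : ℕ → R) : Prop :=
  (∀ k, d.om k = algebraMap R A (ω k)) ∧ (∀ k, 1 ≤ k → d.omb k = algebraMap R A (obar ω k))

/-- `A` (with the data `d`) is the algebra `B̃C_{r,t}` of Definition 3.13 with parameters
`ω_{2n+1} ∈ R`. -/
def AWBC.IsSpecUniversal {R A : Type} [CommRing R] [Ring A] [Algebra R A] {r t : ℕ} {ω1 : R}
    (d : AWBC R A r t ω1) (ω : ℕ → R) : Prop :=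
  d.IsSpec ω ∧ ∀ (B : Type) [Ring B] [Algebra R B], ∀ d' : AWBC R B r t ω1,
    d'.IsSpec ω → ∃! φ : A →ₐ[R] B, AWBCHom d d' φ

/-- The cyclotomic relations `f(x_1) = 0` and `g(x̄_1) = 0`. -/
def AWBC.IsCyc {R A : Type} [CommRing R] [Ring A] [Algebra R A] {r t : ℕ} {ω1 : R}
    (d : AWBC R A r t ω1) (f g : Polynomial R) : Prop :=
  Polynomial.aeval d.x1 f = 0 ∧ Polynomial.aeval d.xb1 g = 0

/-- `A` (with the data `d`) is the cyclotomic walled Brauer–Clifford superalgebra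
`BC_{ℓ,r,t}` of Definition 3.14 attached to `f`, `g` and the scalar parameters `ω`. -/
def AWBC.IsCycUniversal {R A : Type} [CommRing R] [Ring A] [Algebra R A] {r t : ℕ} {ω1 : R}
    (d : AWBC R A r t ω1) (ω : ℕ → R) (f g : Polynomial R) : Prop :=
  d.IsSpec ω ∧ d.IsCyc f g ∧ ∀ (B : Type) [Ring B] [Algebra R B], ∀ d' : AWBC R B r t ω1,
    d'.IsSpec ω → d'.IsCyc f g → ∃! φ : A →ₐ[R] B, AWBCHom d d' φ

/-- Index of a regular monomial `x^α d x̄^β ∏_{n≥1} ω_{2n+1}^{a_{2n+1}}` of `BC^aff_{r,t}`. -/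
structure ARIndex (r t : ℕ) : Type where
  α : Fin r → ℕ
  β : Fin t → ℕ
  dIdx : BCIndex r t
  g : ℕ →₀ ℕ

/-- The regular monomial `x^α d x̄^β ∏_{n≥1} ω_{2n+1}^{a_{2n+1}}` of Definition 3.11. -/
def AWBC.regElt {R A : Type} [CommRing R] [Ring A] [Algebra R A] {r t : ℕ} {ω1 : R}
    (d : AWBC R A r t ω1) (x : ARIndex r t) : A :=
  d.xpow x.α * d.toWBC.basElt x.dIdx * d.xbpow x.β * d.ompow x.g

/-- Index of a regular monomial `x^α d x̄^β` of `B̃C_{r,t}`. -/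
structure SIndex (r t : ℕ) : Type where
  α : Fin r → ℕ
  β : Fin t → ℕ
  dIdx : BCIndex r t

/-- The regular monomial `x^α d x̄^β` of `B̃C_{r,t}`. -/
def AWBC.sregElt {R A : Type} [CommRing R] [Ring A] [Algebra R A] {r t : ℕ} {ω1 : R}
    (d : AWBC R A r t ω1) (x : SIndex r t) : A :=
  d.xpow x.α * d.toWBC.basElt x.dIdx * d.xbpow x.β

/-- Index of a regular monomial `x^α d x̄^β` of the level `ℓ` algebra `BC_{ℓ,r,t}`,
with exponents in `{0, 1, …, ℓ-1}`. -/
structure CIndex (r t ℓ : ℕ) : Type where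
  α : Fin r → Fin ℓ
  β : Fin t → Fin ℓ
  dIdx : BCIndex r t

/-- The regular monomial `x^α d x̄^β` of `BC_{ℓ,r,t}`. -/
def AWBC.cregElt {R A : Type} [CommRing R] [Ring A] [Algebra R A] {r t ℓ : ℕ} {ω1 : R}
    (d : AWBC R A r t ω1) (x : CIndex r t ℓ) : A :=
  d.xpow (fun i => (x.α i : ℕ)) * d.toWBC.basElt x.dIdx * d.xbpow (fun j => (x.β j : ℕ))

/-- Admissibility (Definition 6.4): writing `f(x) = x^{k+2m} + ∑_{i=1}^{2m} a_i x^{k+2m-i}`,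
one has `ω_L = -(a_1 ω_{L-1} + ⋯ + a_{2m} ω_{L-2m})` for all `L ≥ k + 2m`. -/
def AdmissibleParam {R : Type} [CommRing R] (ω : ℕ → R) (f : Polynomial R) (k m : ℕ) : Prop :=
  ∀ L, k + 2 * m ≤ L →
    ω L = -∑ i ∈ Finset.Icc 1 (2 * m), f.coeff (k + 2 * m - i) * ω (L - i)

/-- The parameters `ω_0 = 0`, `ω_1 = -2m(2p-2m+1)`, `ω_i = p(p+1) ω_{i-2}` of (4.16). -/
def omSeq (m : ℕ) (p : ℂ) : ℕ → ℂ
  | 0 => 0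
  | 1 => -2 * (m : ℂ) * (2 * p - 2 * (m : ℂ) + 1)
  | n + 2 => p * (p + 1) * omSeq m p n

/-- Index of a monomial `d_1^{-1} c^α x'^β e^f x̄'^{β̄} c̄^{ᾱ} w d_2` of (4.20). -/
structure L2Index (r t : ℕ) : Type where
  α : Fin r → Fin 2
  βx : Fin r → Fin 2
  αb : Fin t → Fin 2
  βxb : Fin t → Fin 2
  f : ℕ
  hf : f ≤ min r t
  d1 : DElt r t f
  d2 : DElt r t f
  w : Equiv.Perm (Fin r)
  wb : Equiv.Perm (Fin t)
  hw : ∀ i : Fin r, (i : ℕ) < f → w i = i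
  hwb : ∀ j : Fin t, (j : ℕ) < f → wb j = j

/-- The monomial `d_1^{-1} c^α x'^β e^f x̄'^{β̄} c̄^{ᾱ} w d_2` of (4.20), where
`x'^β = x'_r{}^{β_r} ⋯ x'_1{}^{β_1}` and `x̄'^{β̄} = x̄'_t{}^{β̄_t} ⋯ x̄'_1{}^{β̄_1}`. -/
def AWBC.l2Elt {R A : Type} [CommRing R] [Ring A] [Algebra R A] {r t : ℕ} {ω1 : R}
    (d : AWBC R A r t ω1) (x : L2Index r t) : A :=
  d.toWBC.σ (x.d1.pr⁻¹) * d.toWBC.σb (x.d1.pt⁻¹) * d.toWBC.cpow x.α *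
    ((List.finRange r).reverse.map (fun (i : Fin r) => d.xp ((i : ℕ) + 1) ^ (x.βx i : ℕ))).prod *
    d.toWBC.epow x.f *
    ((List.finRange t).reverse.map (fun (j : Fin t) => d.xbp ((j : ℕ) + 1) ^ (x.βxb j : ℕ))).prod *
    d.toWBC.cbpow x.αb *
    d.toWBC.σ x.w * d.toWBC.σb x.wb * d.toWBC.σ x.d2.pr * d.toWBC.σb x.d2.pt

set_option linter.unusedSectionVars false
namespace SB8

section perms
variable {n : ℕ}

lemma sw_eq (n : ℕ) {a b : ℕ} (ha : a < n) (hb : b < n) :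
    sw n a b = Equiv.swap ⟨a, ha⟩ ⟨b, hb⟩ := by
  simp [sw, ha, hb]

/-- Any pair of distinct indices is the image of `(0,1)`. -/
lemma exists_perm01 [NeZero n] {i i' : Fin n} (h : i ≠ i') :
    ∃ h1 : 1 < n, ∃ u : Equiv.Perm (Fin n), u 0 = i ∧ u ⟨1, h1⟩ = i' := by
  have h1 : 1 < n := by
    by_contra hn
    have : n = 1 := by have := NeZero.pos n; omega
    subst this
    exact h (Subsingleton.elim _ _)
  refine ⟨h1, Equiv.swap (Equiv.swap 0 i ⟨1, h1⟩) i' * Equiv.swap 0 i, ?_, ?_⟩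
  · have h01 : (0 : Fin n) ≠ ⟨1, h1⟩ := by
      intro h; have := congrArg Fin.val h; simp at this
    have : Equiv.swap 0 i ⟨1, h1⟩ ≠ i := by
      intro hh
      have := (Equiv.swap 0 i).injective (hh.trans (Equiv.swap_apply_left 0 i).symm)
      exact h01 this.symm
    simp only [Equiv.Perm.mul_apply, Equiv.swap_apply_left]
    exact Equiv.swap_apply_of_ne_of_ne this.symm h
  · simp

end perms

section calcs
variable {R A : Type} [CommRing R] [Ring A] [Algebra R A] {n m : ℕ}

lemma e_comm_σ [NeZero n] (d : WBC R A n m) (w : Equiv.Perm (Fin n)) (hw : w 0 = 0) :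
    d.σ w * d.e = d.e * d.σ w := by
  obtain ⟨n, rfl⟩ : ∃ n', n = n' + 1 := ⟨n - 1, by have := NeZero.pos n; omega⟩
  let h : Equiv.Perm (Fin n) →* Equiv.Perm (Fin (n + 1)) :=
    Equiv.Perm.viaEmbeddingHom (Fin.succEmb n)
  have hs : ∀ (e : Equiv.Perm (Fin n)) x, h e (Fin.succ x) = (e x).succ := fun e x =>
    Equiv.Perm.viaEmbedding_apply e (Fin.succEmb n) x
  have h0 : ∀ (e : Equiv.Perm (Fin n)), h e 0 = 0 := fun e =>
    Equiv.Perm.viaEmbedding_apply_of_notMem e (Fin.succEmb n) 0 (by simp)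
  have key : ∀ e : Equiv.Perm (Fin n), d.σ (h e) * d.e = d.e * d.σ (h e) := by
    intro e
    rcases n with _ | n
    · have : e = 1 := Subsingleton.elim _ _
      simp [this]
    · have he : e ∈ Submonoid.closure (Set.range fun i : Fin n => Equiv.swap i.castSucc i.succ) := by
        rw [Equiv.Perm.mclosure_swap_castSucc_succ]; trivial
      induction he using Submonoid.closure_induction with
      | mem x hx =>
        obtain ⟨i, rfl⟩ := hx
        have : h (Equiv.swap i.castSucc i.succ) = sw (n + 1 + 1) (i + 1) (i + 1 + 1) := by
          rw [sw_eq _ (by omega) (by omega)]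
          ext x
          refine Fin.cases ?_ (fun x => ?_) x
          · rw [h0, Equiv.swap_apply_of_ne_of_ne] <;> simp [Fin.ext_iff]
          · rw [hs]
            simp only [Equiv.swap_apply_def, Fin.ext_iff, apply_ite Fin.val, Fin.val_succ,
              Fin.val_castSucc]
            split_ifs <;> simp_all
        rw [this]
        exact d.s_e_comm _ (by omega) (by omega)
      | one => simp
      | mul x y _ _ hx hy => rw [map_mul, map_mul, mul_assoc, hy, ← mul_assoc, hx, mul_assoc]
  have hw' : w = h (Equiv.Perm.decomposeFin w).2 := by
    have e1 : w = Equiv.Perm.decomposeFin.symm (Equiv.Perm.decomposeFin w) := by simp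
    have e2 : (Equiv.Perm.decomposeFin w).1 = 0 := by
      rw [e1, show Equiv.Perm.decomposeFin w = ((Equiv.Perm.decomposeFin w).1,
        (Equiv.Perm.decomposeFin w).2) from rfl, Equiv.Perm.decomposeFin_symm_apply_zero] at hw
      exact hw
    ext x
    refine Fin.cases ?_ (fun x => ?_) x
    · rw [h0, hw]
    · rw [hs]
      conv_lhs => rw [e1, show Equiv.Perm.decomposeFin w = ((Equiv.Perm.decomposeFin w).1,
        (Equiv.Perm.decomposeFin w).2) from rfl, Equiv.Perm.decomposeFin_symm_apply_succ, e2]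
      simp
  rw [hw']; exact key _

/-- The same for the barred group; copied through the abstract flip. -/
lemma e_comm_σb [NeZero m] (d : WBC R A n m) (w : Equiv.Perm (Fin m)) (hw : w 0 = 0) :
    d.σb w * d.e = d.e * d.σb w := by
  obtain ⟨m, rfl⟩ : ∃ n', m = n' + 1 := ⟨m - 1, by have := NeZero.pos m; omega⟩
  let h : Equiv.Perm (Fin m) →* Equiv.Perm (Fin (m + 1)) :=
    Equiv.Perm.viaEmbeddingHom (Fin.succEmb m)
  have hs : ∀ (e : Equiv.Perm (Fin m)) x, h e (Fin.succ x) = (e x).succ := fun e x =>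
    Equiv.Perm.viaEmbedding_apply e (Fin.succEmb m) x
  have h0 : ∀ (e : Equiv.Perm (Fin m)), h e 0 = 0 := fun e =>
    Equiv.Perm.viaEmbedding_apply_of_notMem e (Fin.succEmb m) 0 (by simp)
  have key : ∀ e : Equiv.Perm (Fin m), d.σb (h e) * d.e = d.e * d.σb (h e) := by
    intro e
    rcases m with _ | m
    · have : e = 1 := Subsingleton.elim _ _
      simp [this]
    · have he : e ∈ Submonoid.closure (Set.range fun i : Fin m => Equiv.swap i.castSucc i.succ) := by
        rw [Equiv.Perm.mclosure_swap_castSucc_succ]; trivial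
      induction he using Submonoid.closure_induction with
      | mem x hx =>
        obtain ⟨i, rfl⟩ := hx
        have : h (Equiv.swap i.castSucc i.succ) = sw (m + 1 + 1) (i + 1) (i + 1 + 1) := by
          rw [sw_eq _ (by omega) (by omega)]
          ext x
          refine Fin.cases ?_ (fun x => ?_) x
          · rw [h0, Equiv.swap_apply_of_ne_of_ne] <;> simp [Fin.ext_iff]
          · rw [hs]
            simp only [Equiv.swap_apply_def, Fin.ext_iff, apply_ite Fin.val, Fin.val_succ,
              Fin.val_castSucc]
            split_ifs <;> simp_all
        rw [this]
        exact d.sb_e_comm _ (by omega) (by omega)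
      | one => simp
      | mul x y _ _ hx hy => rw [map_mul, map_mul, mul_assoc, hy, ← mul_assoc, hx, mul_assoc]
  have hw' : w = h (Equiv.Perm.decomposeFin w).2 := by
    have e1 : w = Equiv.Perm.decomposeFin.symm (Equiv.Perm.decomposeFin w) := by simp
    have e2 : (Equiv.Perm.decomposeFin w).1 = 0 := by
      rw [e1, show Equiv.Perm.decomposeFin w = ((Equiv.Perm.decomposeFin w).1,
        (Equiv.Perm.decomposeFin w).2) from rfl, Equiv.Perm.decomposeFin_symm_apply_zero] at hw
      exact hw
    ext x
    refine Fin.cases ?_ (fun x => ?_) x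
    · rw [h0, hw]
    · rw [hs]
      conv_lhs => rw [e1, show Equiv.Perm.decomposeFin w = ((Equiv.Perm.decomposeFin w).1,
        (Equiv.Perm.decomposeFin w).2) from rfl, Equiv.Perm.decomposeFin_symm_apply_succ, e2]
      simp
  rw [hw']; exact key _

variable [NeZero n] [NeZero m] (d : WBC R A n m)

/-- The unit `σ u * σb v`. -/
def tau (u : Equiv.Perm (Fin n)) (v : Equiv.Perm (Fin m)) : A := d.σ u * d.σb v

/-- `e_{i,j}` for arbitrary indices. -/
def En (i : Fin n) (j : Fin m) : A :=
  d.σb (Equiv.swap 0 j) * d.σ (Equiv.swap 0 i) * d.e * d.σ (Equiv.swap 0 i) * d.σb (Equiv.swap 0 j)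

lemma tau_mul (u u' v v') : tau d u v * tau d u' v' = tau d (u * u') (v * v') := by
  simp only [tau, map_mul]
  rw [mul_assoc, ← mul_assoc (d.σb v), ← d.comm_σσb]; simp only [mul_assoc]

lemma tau_one : tau d 1 1 = 1 := by simp [tau]

lemma tau_e (u v) (hu : u 0 = 0) (hv : v 0 = 0) : tau d u v * d.e = d.e * tau d u v := by
  rw [tau, mul_assoc, e_comm_σb d v hv, ← mul_assoc, e_comm_σ d u hu, mul_assoc]

lemma En_eq (u : Equiv.Perm (Fin n)) (v : Equiv.Perm (Fin m)) :
    En d (u 0) (v 0) = tau d u v * d.e * tau d u⁻¹ v⁻¹ := by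
  have h : En d (u 0) (v 0) = tau d (Equiv.swap 0 (u 0)) (Equiv.swap 0 (v 0)) * d.e *
      tau d (Equiv.swap 0 (u 0)) (Equiv.swap 0 (v 0)) := by
    simp only [En, tau, mul_assoc]
    rw [← mul_assoc, ← d.comm_σσb, mul_assoc]
  rw [h]
  have e1 : tau d (Equiv.swap 0 (u 0)) (Equiv.swap 0 (v 0)) =
      tau d u v * tau d (u⁻¹ * Equiv.swap 0 (u 0)) (v⁻¹ * Equiv.swap 0 (v 0)) := by
    rw [tau_mul]; simp
  have e2 : tau d (Equiv.swap 0 (u 0)) (Equiv.swap 0 (v 0)) =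
      tau d (Equiv.swap 0 (u 0) * u) (Equiv.swap 0 (v 0) * v) * tau d u⁻¹ v⁻¹ := by
    rw [tau_mul]; simp [mul_assoc]
  conv_lhs => lhs; rw [e1]
  conv_lhs => rhs; rw [e2]
  rw [mul_assoc (tau d u v), tau_e _ _ _ (by simp) (by simp), ← mul_assoc, ← mul_assoc,
    mul_assoc (tau d u v * d.e), tau_mul]
  simp [mul_assoc, tau_one]

lemma En_zero : En d 0 0 = d.e := by
  have := En_eq d 1 1
  simpa [tau_one] using this

lemma σ_En (u : Equiv.Perm (Fin n)) (i j) : d.σ u * En d i j = En d (u i) j * d.σ u := by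
  have h1 := En_eq d (Equiv.swap 0 i) (Equiv.swap 0 j)
  have h2 := En_eq d (u * Equiv.swap 0 i) (Equiv.swap 0 j)
  simp only [Equiv.Perm.mul_apply, Equiv.swap_apply_left] at h1 h2
  rw [h1, h2]
  have e0 : d.σ u = tau d u 1 := by simp [tau]
  rw [e0, ← mul_assoc, ← mul_assoc, tau_mul, mul_assoc _ _ (tau d u 1), tau_mul]
  simp

lemma σb_En (v : Equiv.Perm (Fin m)) (i j) : d.σb v * En d i j = En d i (v j) * d.σb v := by
  have h1 := En_eq d (Equiv.swap 0 i) (Equiv.swap 0 j)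
  have h2 := En_eq d (Equiv.swap 0 i) (v * Equiv.swap 0 j)
  simp only [Equiv.Perm.mul_apply, Equiv.swap_apply_left] at h1 h2
  rw [h1, h2]
  have e0 : d.σb v = tau d 1 v := by simp [tau]
  rw [e0, ← mul_assoc, ← mul_assoc, tau_mul, mul_assoc _ _ (tau d 1 v), tau_mul]
  simp

lemma σ_c (u : Equiv.Perm (Fin n)) (i) : d.σ u * d.c i = d.c (u i) * d.σ u := by
  rw [← d.c_conj u i, mul_assoc, ← map_mul]; simp

lemma σb_cb (v : Equiv.Perm (Fin m)) (j) : d.σb v * d.cb j = d.cb (v j) * d.σb v := by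
  rw [← d.cb_conj v j, mul_assoc, ← map_mul]; simp

/-- Conjugation by `tau`, used to transport relations. -/
def cj (u : Equiv.Perm (Fin n)) (v : Equiv.Perm (Fin m)) (x : A) : A :=
  tau d u v * x * tau d u⁻¹ v⁻¹

lemma tau_inv_mul (u v) : tau d u⁻¹ v⁻¹ * tau d u v = 1 := by
  rw [tau_mul]; simp [tau_one]
lemma tau_mul_inv (u v) : tau d u v * tau d u⁻¹ v⁻¹ = 1 := by
  rw [tau_mul]; simp [tau_one]

lemma cj_mul (u v) (x y : A) : cj d u v (x * y) = cj d u v x * cj d u v y := by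
  simp only [cj, mul_assoc]
  rw [← mul_assoc (tau d u⁻¹ v⁻¹) (tau d u v), tau_inv_mul, one_mul]

lemma cj_add (u v) (x y : A) : cj d u v (x + y) = cj d u v x + cj d u v y := by
  simp [cj, mul_add, add_mul]
lemma cj_neg (u v) (x : A) : cj d u v (-x) = - cj d u v x := by
  simp [cj]
lemma cj_zero (u v) : cj d u v 0 = 0 := by simp [cj]

lemma cj_of (u v) (x y : A) (h : tau d u v * x = y * tau d u v) : cj d u v x = y := by
  rw [cj, h, mul_assoc, tau_mul_inv, mul_one]

lemma cj_c (u v i) : cj d u v (d.c i) = d.c (u i) := by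
  apply cj_of
  rw [tau, mul_assoc, d.comm_σbc, ← mul_assoc, σ_c, mul_assoc]
lemma cj_cb (u v i) : cj d u v (d.cb i) = d.cb (v i) := by
  apply cj_of
  rw [tau, mul_assoc, σb_cb, ← mul_assoc, d.comm_σcb, mul_assoc]
lemma cj_e (u v) : cj d u v d.e = En d (u 0) (v 0) := by
  rw [En_eq]; rfl
lemma cj_σ (u v w) : cj d u v (d.σ w) = d.σ (u * w * u⁻¹) := by
  apply cj_of
  have : ∀ w, d.σ w = tau d w 1 := by simp [tau]
  rw [this, this, tau_mul, tau_mul]; simp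
lemma cj_σb (u v w) : cj d u v (d.σb w) = d.σb (v * w * v⁻¹) := by
  apply cj_of
  have : ∀ w, d.σb w = tau d 1 w := by simp [tau]
  rw [this, this, tau_mul, tau_mul]; simp

lemma cj_swap (u v i j) : cj d u v (d.σ (Equiv.swap i j)) = d.σ (Equiv.swap (u i) (u j)) := by
  rw [cj_σ, Equiv.swap_apply_apply]
lemma cj_swapb (u v i j) : cj d u v (d.σb (Equiv.swap i j)) = d.σb (Equiv.swap (v i) (v j)) := by
  rw [cj_σb, Equiv.swap_apply_apply]

lemma fin0 {n} [NeZero n] (h : 0 < n) : (⟨0, h⟩ : Fin n) = 0 := by ext; simp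

lemma En_of (i : Fin n) (j : Fin m) : ∃ (u : Equiv.Perm (Fin n)) (v : Equiv.Perm (Fin m)), u 0 = i ∧ v 0 = j :=
  ⟨Equiv.swap 0 i, Equiv.swap 0 j, by simp, by simp⟩

lemma En_sq (i j) : En d i j * En d i j = 0 := by
  obtain ⟨u, v, rfl, rfl⟩ := En_of i j
  rw [← cj_e, ← cj_mul, d.e_sq, cj_zero]

lemma c_En (i j) : d.c i * En d i j = d.cb j * En d i j := by
  obtain ⟨u, v, rfl, rfl⟩ := En_of i j
  have := d.c1_e (NeZero.pos n) (NeZero.pos m)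
  rw [fin0, fin0] at this
  rw [← cj_e, ← cj_c d u v, ← cj_cb d u v, ← cj_mul, this, cj_mul]

lemma En_c (i j) : En d i j * d.c i = En d i j * d.cb j := by
  obtain ⟨u, v, rfl, rfl⟩ := En_of i j
  have := d.e_c1 (NeZero.pos n) (NeZero.pos m)
  rw [fin0, fin0] at this
  rw [← cj_e, ← cj_c d u v, ← cj_cb d u v, ← cj_mul, this, cj_mul]

lemma En_c_En (i j) : En d i j * d.c i * En d i j = 0 := by
  obtain ⟨u, v, rfl, rfl⟩ := En_of i j
  have := d.e_c_e (NeZero.pos n)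
  rw [fin0] at this
  rw [← cj_e, ← cj_c d u v, ← cj_mul, ← cj_mul, this, cj_zero]

lemma En_cb_En (i j) : En d i j * d.cb j * En d i j = 0 := by
  rw [← En_c, En_c_En]

lemma c_En_comm (i j i') (h : i' ≠ i) : d.c i' * En d i j = En d i j * d.c i' := by
  obtain ⟨u, v, rfl, rfl⟩ := En_of i j
  obtain ⟨a, rfl⟩ := u.surjective i'
  have := d.c_e_comm a (by intro h0; apply h; congr 1; ext; simpa using h0)
  rw [← cj_e, ← cj_c d u v, ← cj_mul, this, cj_mul]

lemma cb_En_comm (i j j') (h : j' ≠ j) : d.cb j' * En d i j = En d i j * d.cb j' := by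
  obtain ⟨u, v, rfl, rfl⟩ := En_of i j
  obtain ⟨a, rfl⟩ := v.surjective j'
  have := d.cb_e_comm a (by intro h0; apply h; congr 1; ext; simpa using h0)
  rw [← cj_e, ← cj_cb d u v, ← cj_mul, this, cj_mul]

lemma En_t_En (i i' j) (h : i ≠ i') : En d i j * d.σ (Equiv.swap i i') * En d i j = En d i j := by
  obtain ⟨h1, u, rfl, rfl⟩ := exists_perm01 h
  obtain ⟨-, v, -, rfl⟩ := En_of (0 : Fin n) j
  have := d.e_s_e h1
  rw [sw_eq _ (by omega) h1, fin0] at this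
  rw [← cj_e, ← cj_swap d u v, ← cj_mul, ← cj_mul, this]

lemma En_tb_En (i j j') (h : j ≠ j') : En d i j * d.σb (Equiv.swap j j') * En d i j = En d i j := by
  obtain ⟨h1, v, rfl, rfl⟩ := exists_perm01 h
  obtain ⟨u, -, rfl, -⟩ := En_of i (0 : Fin m)
  have := d.e_sb_e h1
  rw [sw_eq _ (by omega) h1, fin0] at this
  rw [← cj_e, ← cj_swapb d u v, ← cj_mul, ← cj_mul, this]

lemma t_sq {n m} (d : WBC R A n m) (i i') : d.σ (Equiv.swap i i') * d.σ (Equiv.swap i i') = 1 := by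
  rw [← map_mul]; simp
lemma tb_sq {n m} (d : WBC R A n m) (i i') : d.σb (Equiv.swap i i') * d.σb (Equiv.swap i i') = 1 := by
  rw [← map_mul]; simp

lemma t_En (i i' j) : d.σ (Equiv.swap i i') * En d i' j = En d i j * d.σ (Equiv.swap i i') := by
  rw [σ_En]; simp
lemma tb_En (i j j') : d.σb (Equiv.swap j j') * En d i j' = En d i j * d.σb (Equiv.swap j j') := by
  rw [σb_En]; simp

lemma En_En_l (i i' j) (h : i ≠ i') : En d i j * En d i' j = En d i j * d.σ (Equiv.swap i i') := by
  have h1 := En_t_En d i i' j h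
  have h2 := t_En d i i' j
  have h3 := t_sq d i i'
  calc En d i j * En d i' j
      = En d i j * d.σ (Equiv.swap i i') * (d.σ (Equiv.swap i i') * En d i' j) := by
        rw [mul_assoc, ← mul_assoc (d.σ _) (d.σ _), h3, one_mul]
    _ = En d i j * d.σ (Equiv.swap i i') * En d i j * d.σ (Equiv.swap i i') := by
        rw [h2, ← mul_assoc]
    _ = _ := by rw [h1]

lemma En_En_r (i j j') (h : j ≠ j') : En d i j * En d i j' = En d i j * d.σb (Equiv.swap j j') := by
  have h1 := En_tb_En d i j j' h
  have h2 := tb_En d i j j'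
  have h3 := tb_sq d j j'
  calc En d i j * En d i j'
      = En d i j * d.σb (Equiv.swap j j') * (d.σb (Equiv.swap j j') * En d i j') := by
        rw [mul_assoc, ← mul_assoc (d.σb _) (d.σb _), h3, one_mul]
    _ = En d i j * d.σb (Equiv.swap j j') * En d i j * d.σb (Equiv.swap j j') := by
        rw [h2, ← mul_assoc]
    _ = _ := by rw [h1]

lemma En_pair {i i' j j'} (hi : i ≠ i') (hj : j ≠ j') :
    En d i j * En d i' j' = En d i j * d.σ (Equiv.swap i i') * d.σb (Equiv.swap j j') * En d i j ∧
    En d i' j' * En d i j = En d i j * d.σ (Equiv.swap i i') * d.σb (Equiv.swap j j') * En d i j := by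
  obtain ⟨h1, u, rfl, rfl⟩ := exists_perm01 hi
  obtain ⟨h2, v, rfl, rfl⟩ := exists_perm01 hj
  have b1 := d.braid1 h1 h2
  have b2 := d.braid2 h1 h2
  rw [sw_eq _ (by omega) h1, sw_eq _ (by omega) h2, fin0, fin0] at b1 b2
  have hE : En d (u ⟨1, h1⟩) (v ⟨1, h2⟩) = cj d u v (d.σ (Equiv.swap 0 ⟨1, h1⟩) *
      d.σb (Equiv.swap 0 ⟨1, h2⟩) * d.e * d.σ (Equiv.swap 0 ⟨1, h1⟩) *
      d.σb (Equiv.swap 0 ⟨1, h2⟩)) := by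
    simp only [cj_mul, cj_swap, cj_swapb, cj_e]
    have e1 := t_En d (u ⟨1, h1⟩) (u 0) (v ⟨1, h2⟩)
    have e2 := tb_En d (u 0) (v ⟨1, h2⟩) (v 0)
    rw [mul_assoc (d.σ _) (d.σb _), Equiv.swap_comm (v 0), e2, ← mul_assoc,
      Equiv.swap_comm (u 0), e1]
    simp only [mul_assoc]
    rw [d.comm_σσb, ← mul_assoc (d.σb _) (d.σb _), tb_sq, one_mul, t_sq, mul_one]
  constructor
  · rw [hE, ← cj_e d u v, ← cj_swap d u v, ← cj_swapb d u v]
    simp only [← cj_mul]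
    congr 1
    simp only [← mul_assoc]
    rw [b1]
    simp only [mul_assoc]
    rw [tb_sq, mul_one]
  · rw [hE, ← cj_e d u v, ← cj_swap d u v, ← cj_swapb d u v]
    simp only [← cj_mul]
    congr 1
    simp only [mul_assoc] at b2 ⊢
    rw [← b2]
    simp only [← mul_assoc]
    rw [t_sq, one_mul]

lemma En_comm {i i' j j'} (hi : i ≠ i') (hj : j ≠ j') :
    En d i j * En d i' j' = En d i' j' * En d i j := by
  rw [(En_pair d hi hj).1, (En_pair d hi hj).2]

lemma En_cap {i i' j j'} (hi : i ≠ i') (hj : j ≠ j') :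
    En d i j * En d i' j' * (d.σ (Equiv.swap i i') * d.σb (Equiv.swap j j')) =
      En d i j * En d i' j' := by
  conv_rhs => rw [(En_pair d hi hj).1]
  simp only [mul_assoc]
  congr 1
  rw [σb_En, Equiv.swap_apply_left, ← mul_assoc (d.σ _) (En _ _ _), σ_En, Equiv.swap_apply_left,
    mul_assoc]

end calcs
end SB8

namespace SB8

/-- The relations among the `σ, σb, c, cb, E` used for computations with the sums `y`;
the sign `ε` makes the structure symmetric under exchanging the two sides of the wall. -/
structure Gen (A : Type) [Ring A] (α β : Type) [DecidableEq α] [DecidableEq β] (ε : A) where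
  σ : Equiv.Perm α →* A
  σb : Equiv.Perm β →* A
  c : α → A
  cb : β → A
  E : α → β → A
  hε : ε = 1 ∨ ε = -1
  c_sq : ∀ i, c i * c i = -ε
  cb_sq : ∀ j, cb j * cb j = ε
  c_anti : ∀ i i', i ≠ i' → c i * c i' = -(c i' * c i)
  cb_anti : ∀ i i', i ≠ i' → cb i * cb i' = -(cb i' * cb i)
  anti : ∀ i j, c i * cb j = -(cb j * c i)
  σ_c : ∀ w i, σ w * c i = c (w i) * σ w
  σb_cb : ∀ w i, σb w * cb i = cb (w i) * σb w
  σσb : ∀ w v, σ w * σb v = σb v * σ w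
  σcb : ∀ w j, σ w * cb j = cb j * σ w
  σbc : ∀ w i, σb w * c i = c i * σb w
  σ_E : ∀ w i j, σ w * E i j = E (w i) j * σ w
  σb_E : ∀ w i j, σb w * E i j = E i (w j) * σb w
  c_E : ∀ i j, c i * E i j = cb j * E i j
  E_c : ∀ i j, E i j * c i = E i j * cb j
  E_sq : ∀ i j, E i j * E i j = 0
  E_c_E : ∀ i j, E i j * c i * E i j = 0
  c_E_comm : ∀ i j i', i' ≠ i → c i' * E i j = E i j * c i'
  cb_E_comm : ∀ i j j', j' ≠ j → cb j' * E i j = E i j * cb j'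
  E_t_E : ∀ i i' j, i ≠ i' → E i j * σ (Equiv.swap i i') * E i j = E i j
  E_tb_E : ∀ i j j', j ≠ j' → E i j * σb (Equiv.swap j j') * E i j = E i j
  E_E_l : ∀ i i' j, i ≠ i' → E i j * E i' j = E i j * σ (Equiv.swap i i')
  E_E_r : ∀ i j j', j ≠ j' → E i j * E i j' = E i j * σb (Equiv.swap j j')
  E_comm : ∀ i i' j j', i ≠ i' → j ≠ j' → E i j * E i' j' = E i' j' * E i j

namespace Gen
variable {A : Type} [Ring A] {α β : Type} [DecidableEq α] [DecidableEq β] {ε : A}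

/-- Exchange of the two sides of the wall. -/
def flip (g : Gen A α β ε) : Gen A β α (-ε) where
  σ := g.σb
  σb := g.σ
  c := g.cb
  cb := g.c
  E := fun j i => g.E i j
  hε := by rcases g.hε with h | h <;> simp [h]
  c_sq := by simpa using g.cb_sq
  cb_sq := g.c_sq
  c_anti := g.cb_anti
  cb_anti := g.c_anti
  anti := fun i j => by rw [g.anti, neg_neg]
  σ_c := g.σb_cb
  σb_cb := g.σ_c
  σσb := fun w v => (g.σσb v w).symm
  σcb := g.σbc
  σbc := g.σcb
  σ_E := fun w i j => g.σb_E w j i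
  σb_E := fun w i j => g.σ_E w j i
  c_E := fun i j => (g.c_E j i).symm
  E_c := fun i j => (g.E_c j i).symm
  E_sq := fun i j => g.E_sq j i
  E_c_E := fun i j => by rw [← g.E_c, g.E_c_E]
  c_E_comm := fun i j i' h => g.cb_E_comm j i i' h
  cb_E_comm := fun i j i' h => g.c_E_comm j i i' h
  E_t_E := fun i i' j h => g.E_tb_E j i i' h
  E_tb_E := fun i j j' h => g.E_t_E j j' i h
  E_E_l := fun i i' j h => g.E_E_r j i i' h
  E_E_r := fun i j j' h => g.E_E_l j j' i h
  E_comm := fun i i' j j' h h' => g.E_comm j j' i i' h' h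

variable (g : Gen A α β ε)

/-- `X + ε c_q X c_q`. -/
def sy (q : α) (X : A) : A := X + ε * (g.c q * X * g.c q)

/-- `e_{q,j} + ε ē_{q,j}`. -/
def F (q : α) (j : β) : A := g.sy q (g.E q j)
/-- `(q,i) + ε c_q (q,i) c_q`. -/
def T (q i : α) : A := g.sy q (g.σ (Equiv.swap q i))
/-- The generalised Jucys–Murphy sums. -/
def Y (q : α) (I : Finset α) (J : Finset β) : A := ∑ j ∈ J, g.F q j - ∑ i ∈ I, g.T q i

lemma ε_comm (g : Gen A α β ε) (x : A) : ε * x = x * ε := by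
  rcases g.hε with h | h <;> simp [h]
lemma ε_sq (g : Gen A α β ε) : ε * ε = 1 := by
  rcases g.hε with h | h <;> simp [h]

lemma comm_sy {z : A} {q : α} {X : A} (h1 : Commute z X) (h2 : Commute z (g.c q)) :
    Commute z (g.sy q X) := by
  have h3 : Commute z ε := (g.ε_comm z).symm
  exact h1.add_right (h3.mul_right ((h2.mul_right h1).mul_right h2))

lemma comm_sy' {z : A} {q : α} {X : A} (h1 : Commute z X) (h2 : z * (g.c q) = -(g.c q * z)) :
    Commute z (g.sy q X) := by
  have h3 : Commute z ε := (g.ε_comm z).symm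
  refine h1.add_right (h3.mul_right ?_)
  have h4 : z * X = X * z := h1
  show z * (g.c q * X * g.c q) = g.c q * X * g.c q * z
  have h5 : g.c q * z = - (z * g.c q) := by rw [h2, neg_neg]
  calc z * (g.c q * X * g.c q) = (z * g.c q) * X * g.c q := by simp only [mul_assoc]
    _ = - (g.c q * (z * X) * g.c q) := by rw [h2]; simp only [mul_assoc, neg_mul]
    _ = - (g.c q * X * (z * g.c q)) := by rw [h4]; simp only [mul_assoc]
    _ = _ := by rw [h2]; simp only [mul_assoc, mul_neg, neg_neg]

lemma c_sy (q : α) (X : A) : g.c q * g.sy q X = -(g.sy q X * g.c q) := by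
  have h := g.c_sq q
  have e1 : g.c q * (ε * (g.c q * X * g.c q)) = -(X * g.c q) := by
    calc _ = ε * ((g.c q * g.c q) * (X * g.c q)) := by
          rw [← mul_assoc, ← g.ε_comm]; simp only [mul_assoc]
      _ = _ := by rw [h, ← mul_assoc, mul_neg, g.ε_sq]; simp
  have e2 : ε * (g.c q * X * g.c q) * g.c q = -(g.c q * X) := by
    calc _ = ε * ((g.c q * X) * (g.c q * g.c q)) := by simp only [mul_assoc]
      _ = _ := by rw [h, mul_neg, ← g.ε_comm, mul_neg, ← mul_assoc, g.ε_sq]; simp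
  rw [sy, mul_add, add_mul, e1, e2]; abel

lemma w_sy (w : Equiv.Perm α) (q : α) (X X' : A) (h : g.σ w * X = X' * g.σ w) :
    g.σ w * g.sy q X = g.sy (w q) X' * g.σ w := by
  rw [sy, sy, mul_add, add_mul, h]
  congr 1
  calc g.σ w * (ε * (g.c q * X * g.c q)) = ε * ((g.σ w * g.c q) * X * g.c q) := by
        rw [← mul_assoc, ← g.ε_comm]; simp only [mul_assoc]
    _ = ε * (g.c (w q) * (g.σ w * X) * g.c q) := by rw [g.σ_c]; simp only [mul_assoc]
    _ = ε * (g.c (w q) * X' * (g.σ w * g.c q)) := by rw [h]; simp only [mul_assoc]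
    _ = _ := by rw [g.σ_c]; simp only [mul_assoc]

lemma w_F (w : Equiv.Perm α) (q : α) (j : β) : g.σ w * g.F q j = g.F (w q) j * g.σ w :=
  g.w_sy _ _ _ _ (g.σ_E w q j)

lemma w_T (w : Equiv.Perm α) (q i : α) : g.σ w * g.T q i = g.T (w q) (w i) * g.σ w := by
  apply g.w_sy
  rw [Equiv.swap_apply_apply, ← map_mul, ← map_mul]; simp

lemma w_Y (w : Equiv.Perm α) (q : α) (I J) :
    g.σ w * g.Y q I J = g.Y (w q) (I.map w.toEmbedding) J * g.σ w := by
  rw [Y, Y, mul_sub, sub_mul, Finset.mul_sum, Finset.mul_sum, Finset.sum_mul, Finset.sum_mul,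
    Finset.sum_map]
  simp only [w_F, w_T, Equiv.coe_toEmbedding]

lemma map_eq {I : Finset α} {w : Equiv.Perm α} (h : ∀ i ∈ I, w i ∈ I) :
    I.map w.toEmbedding = I := by
  apply Finset.eq_of_subset_of_card_le
  · intro x hx
    simp only [Finset.mem_map, Equiv.coe_toEmbedding] at hx
    obtain ⟨a, ha, rfl⟩ := hx
    exact h a ha
  · simp

lemma comm_σ_Y {w : Equiv.Perm α} {q : α} {I : Finset α} (J : Finset β) (hq : w q = q)
    (h : ∀ i ∈ I, w i ∈ I) : Commute (g.σ w) (g.Y q I J) := by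
  have := g.w_Y w q I J
  rwa [hq, map_eq h] at this

lemma comm_σb_Y {v : Equiv.Perm β} (q : α) (I : Finset α) {J : Finset β}
    (h : ∀ i ∈ J, v i ∈ J) : Commute (g.σb v) (g.Y q I J) := by
  have e1 : ∀ j, g.σb v * g.F q j = g.F q (v j) * g.σb v := by
    intro j
    have hc := g.σbc v q
    rw [F, F, sy, sy, mul_add, add_mul, g.σb_E]
    congr 1
    calc g.σb v * (ε * (g.c q * g.E q j * g.c q)) = ε * ((g.σb v * g.c q) * g.E q j * g.c q) := by
          rw [← mul_assoc, ← g.ε_comm]; simp only [mul_assoc]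
      _ = ε * (g.c q * (g.σb v * g.E q j) * g.c q) := by rw [hc]; simp only [mul_assoc]
      _ = ε * (g.c q * g.E q (v j) * (g.σb v * g.c q)) := by rw [g.σb_E]; simp only [mul_assoc]
      _ = _ := by rw [hc]; simp only [mul_assoc]
  have e2 : ∀ i, g.σb v * g.T q i = g.T q i * g.σb v := fun i =>
    (g.comm_sy (z := g.σb v) (g.σσb _ _).symm (g.σbc v q))
  show g.σb v * g.Y q I J = g.Y q I J * g.σb v
  rw [Y, mul_sub, sub_mul, Finset.mul_sum, Finset.mul_sum, Finset.sum_mul, Finset.sum_mul]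
  simp only [e1, e2]
  congr 1
  conv_rhs => rw [← map_eq h, Finset.sum_map]
  rfl

lemma c_t (q i : α) : g.c q * g.σ (Equiv.swap q i) = g.σ (Equiv.swap q i) * g.c i := by
  rw [g.σ_c]; simp
lemma t_c (q i : α) : g.σ (Equiv.swap q i) * g.c q = g.c i * g.σ (Equiv.swap q i) := by
  rw [g.σ_c]; simp

lemma comm_c_T {a q i : α} (ha : a ≠ q) (hi : i ≠ q) : Commute (g.c a) (g.T q i) := by
  by_cases h : a = i
  · subst h
    have h1 := g.c_t q a
    have h2 := g.t_c q a
    have h3 := g.c_anti a q ha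
    have h4 := g.c_sq a
    have h5 : ∀ x : A, ε * (ε * x) = x := fun x => by rw [← mul_assoc, g.ε_sq, one_mul]
    show g.c a * g.T q a = g.T q a * g.c a
    have e1 : g.c a * (ε * (g.c q * g.σ (Equiv.swap q a) * g.c q)) = g.c q * g.σ (Equiv.swap q a) := by
      calc _ = ε * ((g.c a * g.c q) * (g.σ (Equiv.swap q a) * g.c q)) := by
            rw [← mul_assoc, ← g.ε_comm]; simp only [mul_assoc]
        _ = ε * (- (g.c q * (g.c a * g.c a) * g.σ (Equiv.swap q a))) := by
            rw [h2, h3]; simp only [mul_assoc, neg_mul]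
        _ = _ := by
            rw [h4, mul_neg (g.c q), ← g.ε_comm, neg_mul, neg_neg, mul_assoc, h5]
    have e2 : (ε * (g.c q * g.σ (Equiv.swap q a) * g.c q)) * g.c a = g.σ (Equiv.swap q a) * g.c q := by
      calc _ = ε * (g.σ (Equiv.swap q a) * (g.c a * (g.c q * g.c a))) := by
            rw [h1]; simp only [mul_assoc]
        _ = ε * (- (g.σ (Equiv.swap q a) * ((g.c a * g.c a) * g.c q))) := by
            rw [g.c_anti q a ha.symm]; simp only [mul_assoc, mul_neg]
        _ = _ := by
            rw [h4, neg_mul, mul_neg (g.σ _), neg_neg, g.ε_comm (g.c q), ← mul_assoc (g.σ _), ←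
              g.ε_comm (_ * _), h5]
    rw [T, sy, mul_add, add_mul, e1, e2, h1, h2]
    abel
  · refine g.comm_sy' ?_ (g.c_anti a q ha)
    show _ * _ = _ * _
    rw [g.σ_c, Equiv.swap_apply_of_ne_of_ne ha h]

lemma comm_cb_F {q : α} (b j : β) : Commute (g.cb b) (g.F q j) := by
  by_cases h : b = j
  · subst h
    have h1 := g.c_E q b
    have h2 := g.E_c q b
    have h3 := g.anti q b
    have h4 := g.c_sq q
    have h5 : ∀ x : A, ε * (ε * x) = x := fun x => by rw [← mul_assoc, g.ε_sq, one_mul]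
    show g.cb b * g.F q b = g.F q b * g.cb b
    have h3' : g.cb b * g.c q = - (g.c q * g.cb b) := by rw [h3, neg_neg]
    have e1 : g.cb b * (ε * (g.c q * g.E q b * g.c q)) = g.E q b * g.c q := by
      calc _ = ε * ((g.cb b * g.c q) * (g.E q b * g.c q)) := by
            rw [← mul_assoc, ← g.ε_comm]; simp only [mul_assoc]
        _ = ε * (- (g.c q * (g.cb b * g.E q b) * g.c q)) := by
            rw [h3']; simp only [mul_assoc, neg_mul]
        _ = ε * (- ((g.c q * g.c q) * (g.E q b * g.c q))) := by
            rw [← h1]; simp only [mul_assoc]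
        _ = _ := by rw [h4, neg_mul, neg_neg, h5]
    have e2 : (ε * (g.c q * g.E q b * g.c q)) * g.cb b = g.c q * g.E q b := by
      calc _ = ε * (g.c q * g.E q b * (g.c q * g.cb b)) := by simp only [mul_assoc]
        _ = ε * (-(g.c q * (g.E q b * g.cb b) * g.c q)) := by
            rw [h3]; simp only [mul_assoc, mul_neg]
        _ = ε * (-(g.c q * g.E q b * (g.c q * g.c q))) := by
            rw [← h2]; simp only [mul_assoc]
        _ = _ := by rw [h4, mul_neg (_ * _), neg_neg, ← g.ε_comm, h5]
    rw [F, sy, mul_add, add_mul, e1, e2, ← h1, ← h2]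
    abel
  · refine g.comm_sy' (g.cb_E_comm _ _ _ h) ?_
    rw [g.anti, neg_neg]

lemma comm_c_Y {a q : α} {I : Finset α} (J : Finset β) (ha : a ≠ q) (hq : q ∉ I) :
    Commute (g.c a) (g.Y q I J) := by
  refine Commute.sub_right (Commute.sum_right _ _ _ fun j _ => ?_)
    (Commute.sum_right _ _ _ fun i hi => ?_)
  · exact g.comm_sy' (g.c_E_comm _ _ _ ha) (g.c_anti _ _ ha)
  · exact g.comm_c_T ha (by rintro rfl; exact hq hi)

lemma comm_cb_Y (b : β) (q : α) (I : Finset α) (J : Finset β) :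
    Commute (g.cb b) (g.Y q I J) := by
  refine Commute.sub_right (Commute.sum_right _ _ _ fun j _ => g.comm_cb_F b j)
    (Commute.sum_right _ _ _ fun i hi => ?_)
  exact g.comm_sy' (g.σcb _ _).symm (by rw [g.anti, neg_neg])

lemma c_Y (q : α) (I : Finset α) (J : Finset β) : g.c q * g.Y q I J = -(g.Y q I J * g.c q) := by
  simp only [Y, mul_sub, sub_mul, Finset.mul_sum, Finset.sum_mul, F, T, c_sy,
    Finset.sum_neg_distrib]
  abel

lemma E_mul_F {a q : α} (b : β) (h : a ≠ q) : g.E a b * g.F q b = g.E a b * g.T q a := by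
  have hc := g.c_E_comm a b q h.symm
  have h1 := g.E_E_l a q b h
  rw [F, T, sy, sy, mul_add, mul_add, h1, Equiv.swap_comm]
  congr 1
  calc g.E a b * (ε * (g.c q * g.E q b * g.c q)) = ε * ((g.E a b * g.c q) * g.E q b * g.c q) := by
        rw [← mul_assoc, ← g.ε_comm]; simp only [mul_assoc]
    _ = ε * (g.c q * (g.E a b * g.E q b) * g.c q) := by rw [← hc]; simp only [mul_assoc]
    _ = ε * ((g.c q * g.E a b) * g.σ (Equiv.swap q a) * g.c q) := by
        rw [h1, Equiv.swap_comm]; simp only [mul_assoc]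
    _ = _ := by
        rw [hc]; conv_rhs => rw [← mul_assoc, ← g.ε_comm]
        simp only [mul_assoc]

lemma F_mul_E {a q : α} (b : β) (h : a ≠ q) : g.F q b * g.E a b = g.T q a * g.E a b := by
  have hc := g.c_E_comm a b q h.symm
  have h1 : g.E q b * g.E a b = g.σ (Equiv.swap q a) * g.E a b := by
    rw [g.E_E_l q a b h.symm, g.σ_E]; simp
  rw [F, T, sy, sy, add_mul, add_mul, h1]
  congr 1
  calc ε * (g.c q * g.E q b * g.c q) * g.E a b = ε * (g.c q * g.E q b * (g.c q * g.E a b)) := by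
        simp only [mul_assoc]
    _ = ε * (g.c q * (g.E q b * g.E a b) * g.c q) := by rw [hc]; simp only [mul_assoc]
    _ = ε * (g.c q * g.σ (Equiv.swap q a) * (g.E a b * g.c q)) := by
        rw [h1]; simp only [mul_assoc]
    _ = _ := by
        rw [← hc]; simp only [mul_assoc]

lemma comm_E_F {a q : α} {b j : β} (h : a ≠ q) (h' : b ≠ j) : Commute (g.E a b) (g.F q j) :=
  g.comm_sy (g.E_comm _ _ _ _ h h') (g.c_E_comm _ _ _ h.symm).symm

lemma comm_E_T {a q i : α} {b : β} (h : a ≠ q) (h' : a ≠ i) : Commute (g.E a b) (g.T q i) := by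
  refine g.comm_sy ?_ (g.c_E_comm _ _ _ h.symm).symm
  show _ * _ = _ * _
  rw [g.σ_E, Equiv.swap_apply_of_ne_of_ne h h']

lemma comm_E_Y_in {a q : α} {b : β} {I : Finset α} {J : Finset β} (hq : q ∉ I) (ha : a ∈ I)
    (hb : b ∈ J) : Commute (g.E a b) (g.Y q I J) := by
  have haq : a ≠ q := by rintro rfl; exact hq ha
  have e : g.Y q I J = (∑ j ∈ J.erase b, g.F q j - ∑ i ∈ I.erase a, g.T q i) +
      (g.F q b - g.T q a) := by
    rw [Y, ← Finset.add_sum_erase _ _ ha, ← Finset.add_sum_erase _ _ hb]; abel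
  rw [e]
  refine Commute.add_right (Commute.sub_right (Commute.sum_right _ _ _ fun j hj => ?_)
    (Commute.sum_right _ _ _ fun i hi => ?_)) ?_
  · exact g.comm_E_F haq (Finset.ne_of_mem_erase hj).symm
  · exact g.comm_E_T haq (Finset.ne_of_mem_erase hi).symm
  · show _ * _ = _ * _
    rw [mul_sub, sub_mul, g.E_mul_F b haq, g.F_mul_E b haq, sub_self, sub_self]

lemma comm_E_Y_out {a q : α} {b : β} {I : Finset α} {J : Finset β} (haq : a ≠ q) (ha : a ∉ I)
    (hb : b ∉ J) : Commute (g.E a b) (g.Y q I J) := by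
  refine (Commute.sub_right (Commute.sum_right _ _ _ fun j hj => ?_)
    (Commute.sum_right _ _ _ fun i hi => ?_))
  · exact g.comm_E_F haq (by rintro rfl; exact hb hj)
  · exact g.comm_E_T haq (by rintro rfl; exact ha hi)

lemma comm_Y {z : A} {q : α} {I : Finset α} {J : Finset β} (h1 : ∀ j ∈ J, Commute z (g.E q j))
    (h2 : ∀ i ∈ I, Commute z (g.σ (Equiv.swap q i))) (h3 : Commute z (g.c q)) :
    Commute z (g.Y q I J) :=
  Commute.sub_right (Commute.sum_right _ _ _ fun j hj => g.comm_sy (h1 j hj) h3)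
    (Commute.sum_right _ _ _ fun i hi => g.comm_sy (h2 i hi) h3)

/-- `e_{a,b} f_{a,j} = e_{a,b} t̄_{b,j}`. -/
lemma E_mul_F' {a : α} {b j : β} (h : b ≠ j) : g.E a b * g.F a j = g.E a b * g.flip.T b j := by
  have h1 := g.E_E_r a b j h
  have h2 := g.E_c a b
  have h3 := g.cb_E_comm a j b h
  have h4 : g.c a * g.cb b = -(g.cb b * g.c a) := g.anti a b
  have h5 : g.σb (Equiv.swap b j) * g.c a = g.c a * g.σb (Equiv.swap b j) := g.σbc _ _
  show g.E a b * (g.E a j + ε * (g.c a * g.E a j * g.c a)) =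
    g.E a b * (g.σb (Equiv.swap b j) + (-ε) * (g.cb b * g.σb (Equiv.swap b j) * g.cb b))
  rw [mul_add, mul_add, h1]
  congr 1
  calc _ = ε * ((g.E a b * g.c a) * g.E a j * g.c a) := by
        rw [← mul_assoc, ← g.ε_comm]; simp only [mul_assoc]
    _ = ε * (g.E a b * (g.cb b * g.E a j) * g.c a) := by rw [h2]; simp only [mul_assoc]
    _ = ε * ((g.E a b * g.E a j) * (g.cb b * g.c a)) := by rw [h3]; simp only [mul_assoc]
    _ = ε * (g.E a b * (g.σb (Equiv.swap b j) * (-(g.c a * g.cb b)))) := by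
        rw [h1, h4, neg_neg]; simp only [mul_assoc]
    _ = -(ε * (g.E a b * ((g.σb (Equiv.swap b j) * g.c a) * g.cb b))) := by
        simp only [mul_assoc, mul_neg]
    _ = -(ε * ((g.E a b * g.c a) * (g.σb (Equiv.swap b j) * g.cb b))) := by
        rw [h5]; simp only [mul_assoc]
    _ = _ := by
        rw [h2, neg_mul, mul_neg]
        conv_rhs => rw [← mul_assoc, ← g.ε_comm]
        simp only [mul_assoc]

lemma F_mul_E' {a : α} {b j : β} (h : b ≠ j) : g.F a j * g.E a b = g.flip.T b j * g.E a b := by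
  have h1 : g.E a j * g.E a b = g.σb (Equiv.swap b j) * g.E a b := by
    rw [g.E_E_r a j b h.symm, g.σb_E, Equiv.swap_apply_left, Equiv.swap_comm]
  have h2 := g.c_E a b
  have h3 := g.cb_E_comm a j b h
  have h4 : g.c a * g.cb b = -(g.cb b * g.c a) := g.anti a b
  have h5 : g.σb (Equiv.swap b j) * g.c a = g.c a * g.σb (Equiv.swap b j) := g.σbc _ _
  show (g.E a j + ε * (g.c a * g.E a j * g.c a)) * g.E a b =
    (g.σb (Equiv.swap b j) + (-ε) * (g.cb b * g.σb (Equiv.swap b j) * g.cb b)) * g.E a b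
  rw [add_mul, add_mul, h1]
  congr 1
  calc _ = ε * (g.c a * g.E a j * (g.c a * g.E a b)) := by simp only [mul_assoc]
    _ = ε * (g.c a * (g.E a j * g.cb b) * g.E a b) := by rw [h2]; simp only [mul_assoc]
    _ = ε * ((g.c a * g.cb b) * (g.E a j * g.E a b)) := by rw [← h3]; simp only [mul_assoc]
    _ = -(ε * (g.cb b * ((g.c a * g.σb (Equiv.swap b j)) * g.E a b))) := by
        rw [h1, h4]; simp only [mul_assoc, neg_mul, mul_neg]
    _ = -(ε * (g.cb b * (g.σb (Equiv.swap b j) * (g.c a * g.E a b)))) := by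
        rw [← h5]; simp only [mul_assoc]
    _ = _ := by
        rw [h2]
        simp only [mul_assoc, neg_mul]

lemma flip_flip_T (q i : α) : g.flip.flip.T q i = g.T q i := by
  simp [T, sy, flip]
lemma flip_flip_F (q j) : g.flip.flip.F q j = g.F q j := by
  simp [F, sy, flip]

lemma E_Ysum {a : α} {b : β} {I : Finset α} {J : Finset β} (ha : a ∉ I) (hb : b ∉ J) :
    g.E a b * (g.Y a I J + g.flip.Y b J I) = 0 := by
  have e1 : ∀ j ∈ J, g.E a b * g.F a j = g.E a b * g.flip.T b j := fun j hj =>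
    g.E_mul_F' (by rintro rfl; exact hb hj)
  have e2 : ∀ i ∈ I, g.E a b * g.flip.F b i = g.E a b * g.T a i := fun i hi => by
    have := g.flip.E_mul_F' (a := b) (b := a) (j := i) (by rintro rfl; exact ha hi)
    rwa [flip_flip_T] at this
  rw [Y, Y]
  simp only [mul_add, mul_sub, Finset.mul_sum]
  rw [Finset.sum_congr rfl e1, Finset.sum_congr rfl e2]
  abel

lemma Ysum_E {a : α} {b : β} {I : Finset α} {J : Finset β} (ha : a ∉ I) (hb : b ∉ J) :
    (g.Y a I J + g.flip.Y b J I) * g.E a b = 0 := by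
  have e1 : ∀ j ∈ J, g.F a j * g.E a b = g.flip.T b j * g.E a b := fun j hj =>
    g.F_mul_E' (by rintro rfl; exact hb hj)
  have e2 : ∀ i ∈ I, g.flip.F b i * g.E a b = g.T a i * g.E a b := fun i hi => by
    have := g.flip.F_mul_E' (a := b) (b := a) (j := i) (by rintro rfl; exact ha hi)
    rwa [flip_flip_T] at this
  rw [Y, Y]
  simp only [add_mul, sub_mul, Finset.sum_mul]
  rw [Finset.sum_congr rfl e1, Finset.sum_congr rfl e2]
  abel

lemma E_T_E {a i : α} (b : β) (h : i ≠ a) : g.E a b * g.T a i * g.E a b = 2 * g.E a b := by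
  have h0 := g.E_t_E a i b h.symm
  have h1 := g.c_E_comm a b i h
  have h2 : g.E a b * g.c a * g.σ (Equiv.swap a i) * g.E a b = g.c i * g.E a b := by
    calc _ = g.E a b * (g.cb b * g.σ (Equiv.swap a i)) * g.E a b := by
          rw [g.E_c]; simp only [mul_assoc]
      _ = g.E a b * g.σ (Equiv.swap a i) * (g.cb b * g.E a b) := by
          rw [← g.σcb]; simp only [mul_assoc]
      _ = g.E a b * (g.σ (Equiv.swap a i) * g.c a) * g.E a b := by
          rw [← g.c_E]; simp only [mul_assoc]
      _ = (g.E a b * g.c i) * g.σ (Equiv.swap a i) * g.E a b := by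
          rw [g.t_c]; simp only [mul_assoc]
      _ = g.c i * (g.E a b * g.σ (Equiv.swap a i) * g.E a b) := by
          rw [← h1]; simp only [mul_assoc]
      _ = _ := by rw [h0]
  rw [T, sy, mul_add, add_mul, h0, two_mul]
  congr 1
  calc _ = ε * (g.E a b * g.c a * (g.σ (Equiv.swap a i) * g.c a) * g.E a b) := by
        rw [← mul_assoc (g.E a b), ← g.ε_comm]; simp only [mul_assoc]
    _ = ε * (g.E a b * (g.c a * g.c i) * g.σ (Equiv.swap a i) * g.E a b) := by
        rw [g.t_c]; simp only [mul_assoc]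
    _ = ε * (-((g.E a b * g.c i) * g.c a * g.σ (Equiv.swap a i) * g.E a b)) := by
        rw [g.c_anti a i h.symm]; simp only [mul_assoc, neg_mul, mul_neg]
    _ = ε * (-(g.c i * (g.E a b * g.c a * g.σ (Equiv.swap a i) * g.E a b))) := by
        rw [← h1]; simp only [mul_assoc]
    _ = _ := by
        rw [h2, ← mul_assoc (g.c i), g.c_sq, neg_mul, neg_neg, ← mul_assoc, g.ε_sq, one_mul]

lemma E_Y_E {a : α} {b : β} {I : Finset α} {J : Finset β} (ha : a ∉ I) (hb : b ∉ J)
    (hc : I.card = J.card) : g.E a b * g.Y a I J * g.E a b = 0 := by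
  have e1 : ∀ j ∈ J, g.E a b * g.F a j * g.E a b = 2 * g.E a b := fun j hj => by
    have hj : j ≠ b := by rintro rfl; exact hb hj
    rw [g.E_mul_F' hj.symm]
    exact g.flip.E_T_E a hj
  have e2 : ∀ i ∈ I, g.E a b * g.T a i * g.E a b = 2 * g.E a b := fun i hi =>
    g.E_T_E b (by rintro rfl; exact ha hi)
  rw [Y]
  simp only [sub_mul, mul_sub, Finset.sum_mul, Finset.mul_sum]
  rw [Finset.sum_congr rfl e1, Finset.sum_congr rfl e2]
  simp [hc]

/-- `y_q` with `p` added to its index set commutes with `y_p`. -/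
lemma comm_Y_Y {p q : α} {I : Finset α} {J : Finset β} (hq : q ∉ I) (hpq : p ≠ q) :
    Commute (g.Y q (insert p I) J) (g.Y p I J) := by
  have hq' : q ∉ insert p I := by simp [hq, hpq.symm]
  refine g.comm_Y (fun j hj => ?_) (fun i hi => ?_) ?_
  · exact (g.comm_E_Y_in hq' (Finset.mem_insert_self _ _) hj).symm
  · refine (g.comm_σ_Y _ ?_ ?_).symm
    · exact Equiv.swap_apply_of_ne_of_ne hpq.symm (by rintro rfl; exact hq hi)
    · intro x hx
      rw [Equiv.swap_apply_def]
      split_ifs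
      · exact Finset.mem_insert_of_mem hi
      · exact Finset.mem_insert_self _ _
      · exact hx
  · exact (g.comm_c_Y _ hpq hq').symm

/-- the mixed relation -/
lemma comm_Y_Yb {p : α} {q : β} {I : Finset α} {J : Finset β} (hq : q ∉ J) :
    Commute (g.Y p I J) (g.flip.Y q J (insert p I)) := by
  refine (g.comm_Y (fun j hj => ?_) (fun i hi => ?_) ?_).symm
  · exact (g.flip.comm_E_Y_in hq hj (Finset.mem_insert_self _ _)).symm
  · refine (g.flip.comm_σb_Y q J (v := Equiv.swap p i) ?_).symm
    intro x hx
    rw [Equiv.swap_apply_def]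
    split_ifs
    · exact Finset.mem_insert_of_mem hi
    · exact Finset.mem_insert_self _ _
    · exact hx
  · exact (g.flip.comm_cb_Y p q J _).symm

end Gen

/-- The data attached to a `WBC`. -/
def gen {R A : Type} [CommRing R] [Ring A] [Algebra R A] {n m : ℕ} [NeZero n] [NeZero m]
    (d : WBC R A n m) : Gen A (Fin n) (Fin m) 1 where
  σ := d.σ
  σb := d.σb
  c := d.c
  cb := d.cb
  E := En d
  hε := Or.inl rfl
  c_sq := d.c_sq
  cb_sq := d.cb_sq
  c_anti := d.c_anti
  cb_anti := d.cb_anti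
  anti := d.anti_ccb
  σ_c := σ_c d
  σb_cb := σb_cb d
  σσb := d.comm_σσb
  σcb := d.comm_σcb
  σbc := d.comm_σbc
  σ_E := σ_En d
  σb_E := σb_En d
  c_E := c_En d
  E_c := En_c d
  E_sq := En_sq d
  E_c_E := En_c_En d
  c_E_comm := c_En_comm d
  cb_E_comm := cb_En_comm d
  E_t_E := En_t_En d
  E_tb_E := En_tb_En d
  E_E_l := En_En_l d
  E_E_r := En_En_r d
  E_comm := fun _ _ _ _ h h' => En_comm d h h'

end SB8

namespace SB8

/-- The rank one relations. -/
structure Core {A : Type} [Ring A] (e x xb c cb : A) : Prop where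
  two : ∀ z : A, z = -z → z = 0
  ee : e * e = 0
  ec : e * c = e * cb
  ce : c * e = cb * e
  ece : e * c * e = 0
  cc : c * c = -1
  cbcb : cb * cb = 1
  ccb : c * cb = -(cb * c)
  xc : x * c = -(c * x)
  xcb : x * cb = cb * x
  xbc : xb * c = c * xb
  xbcb : xb * cb = -(cb * xb)
  ex : e * (x + xb) = 0
  xe : (x + xb) * e = 0
  mixed : x * (e + xb - c * e * c) = (e - c * e * c + xb) * x

namespace Core
variable {A : Type} [Ring A] {e x xb c cb : A}

lemma x2c (h : Core e x xb c cb) (a : ℕ) : Commute (x ^ (2 * a)) c := by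
  rw [pow_mul]
  apply Commute.pow_left
  show x ^ 2 * c = c * x ^ 2
  rw [sq, mul_assoc, h.xc, mul_neg, ← mul_assoc, h.xc, neg_mul, neg_neg, mul_assoc]

lemma x1c (h : Core e x xb c cb) (a : ℕ) : x ^ (2 * a + 1) * c = -(c * x ^ (2 * a + 1)) := by
  rw [pow_succ, mul_assoc, h.xc, mul_neg, ← mul_assoc, h.x2c a, mul_assoc]

lemma xcb' (h : Core e x xb c cb) (a : ℕ) : x ^ a * cb = cb * x ^ a := (Commute.pow_left (show Commute x cb from h.xcb) a)

lemma xb2cb (h : Core e x xb c cb) (a : ℕ) : Commute (xb ^ (2 * a)) cb := by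
  rw [pow_mul]
  apply Commute.pow_left
  show xb ^ 2 * cb = cb * xb ^ 2
  rw [sq, mul_assoc, h.xbcb, mul_neg, ← mul_assoc, h.xbcb, neg_mul, neg_neg, mul_assoc]

lemma even_aux (h : Core e x xb c cb) (z : A) (h1 : Commute z c) (h2 : Commute z cb) : e * z * e = 0 := by
  apply h.two
  have e1 : e * c * z * (c * e) = -(e * z * e) := by
    rw [mul_assoc e c z, ← h1.eq]
    calc _ = e * z * (c * c) * e := by simp only [mul_assoc]
      _ = _ := by rw [h.cc]; simp
  have e2 : e * c * z * (c * e) = e * z * e := by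
    rw [h.ec, h.ce, mul_assoc e cb z, ← h2.eq]
    calc _ = e * z * (cb * cb) * e := by simp only [mul_assoc]
      _ = _ := by rw [h.cbcb]; simp
  rw [← e1, e2]

lemma even (h : Core e x xb c cb) (a : ℕ) : e * x ^ (2 * a) * e = 0 := h.even_aux _ (h.x2c a) (h.xcb' _)
lemma evenb (h : Core e x xb c cb) (a : ℕ) : e * xb ^ (2 * a) * e = 0 :=
  h.even_aux _ (Commute.pow_left (show Commute xb c from h.xbc) _) (h.xb2cb a)

lemma exb (h : Core e x xb c cb) : e * xb = -(e * x) := by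
  have := h.ex; rw [mul_add] at this; exact (neg_eq_of_add_eq_zero_right this).symm
lemma xbe (h : Core e x xb c cb) : xb * e = -(x * e) := by
  have := h.xe; rw [add_mul] at this; exact (neg_eq_of_add_eq_zero_right this).symm

lemma xxb (h : Core e x xb c cb) : x * xb = xb * x + (e * x - c * e * c * x - x * e + x * (c * e * c)) := by
  have := h.mixed
  simp only [mul_sub, mul_add, sub_mul, add_mul] at this
  have h' : x * xb = (x * e + x * xb - x * (c * e * c)) - x * e + x * (c * e * c) := by abel
  rw [h', this]; abel

lemma ecodd (h : Core e x xb c cb) (a : ℕ) : e * c * x ^ (2 * a + 1) * e = 0 := by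
  apply h.two
  conv_lhs => rw [h.ec, mul_assoc e cb, ← h.xcb', ← mul_assoc, mul_assoc _ cb, ← h.ce, ← mul_assoc,
    mul_assoc e, h.x1c]
  simp [mul_assoc]

lemma ecx (h : Core e x xb c cb) : e * c * x = e * c * xb := by
  rw [mul_assoc, mul_assoc, ← h.xbc, ← mul_assoc e xb, h.exb, ← neg_eq_iff_eq_neg.mpr h.xc]
  simp [mul_assoc]

lemma ecall (h : Core e x xb c cb) (a : ℕ) : e * c * x ^ a * e = 0 := by
  induction a using Nat.strong_induction_on with
  | _ a ih =>
  rcases Nat.even_or_odd' a with ⟨n, rfl | rfl⟩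
  · rcases n with _ | n
    · simpa using h.ece
    · have z1 : ∀ i < 2 * (n + 1), ∀ w, e * (c * (x ^ i * (e * w))) = 0 := fun i hi w => by
        have := congrArg (· * w) (ih i hi)
        simpa [mul_assoc] using this
      have key : ∀ j i, i + j = 2 * n + 1 →
          e * c * x ^ i * xb * x ^ j * e = e * c * x ^ (2 * n + 1) * xb * e := by
        intro j
        induction j with
        | zero => intro i hi; simp at hi; simp [hi]
        | succ j ihj =>
          intro i hi
          rw [← ihj (i + 1) (by omega)]
          have hx : xb * x = x * xb - (e * x - c * e * c * x - x * e + x * (c * e * c)) := by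
            rw [h.xxb]; abel
          have e0 : e * c * x ^ i * xb * x ^ (j + 1) * e = e * c * x ^ i * (xb * x) * x ^ j * e := by
            rw [pow_succ' x j]; simp only [mul_assoc]
          rw [e0, hx]
          have t1 : e * (c * (x ^ j * e)) = 0 := by
            have := z1 j (by omega) 1; simpa using this
          have t2 : e * (c * (x * (x ^ j * e))) = 0 := by
            have := z1 (j + 1) (by omega) 1; rw [pow_succ'] at this; simpa [mul_assoc] using this
          have t3 := z1 i (by omega)
          have t4 : ∀ w, e * (c * (x ^ i * (x * (e * w)))) = 0 := fun w => by
            have := z1 (i + 1) (by omega) w; rw [pow_succ] at this; simpa [mul_assoc] using this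
          simp only [mul_sub, mul_add, sub_mul, add_mul, mul_assoc, t1, t2, t3, t4, mul_zero,
            pow_succ x i]
          simp
      have := key (2 * n + 1) 0 (by omega)
      apply h.two
      have e1 : e * c * x ^ (2 * (n + 1)) * e = e * c * x ^ 0 * xb * x ^ (2 * n + 1) * e := by
        rw [pow_zero, mul_one, ← h.ecx, mul_assoc (e * c) x, ← pow_succ']; rfl
      conv_lhs => rw [e1, this, mul_assoc _ xb e, h.xbe]
      rw [mul_neg, ← mul_assoc, mul_assoc _ _ x, ← pow_succ]; rfl
  · exact h.ecodd n

lemma exce (h : Core e x xb c cb) (a : ℕ) : e * x ^ a * c * e = 0 := by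
  rcases Nat.even_or_odd' a with ⟨n, rfl | rfl⟩
  · rw [mul_assoc e, (h.x2c n).eq, ← mul_assoc, h.ecall]
  · rw [mul_assoc e, h.x1c, mul_neg, ← mul_assoc, neg_mul, h.ecall, neg_zero]


lemma expow (h : Core e x xb c cb) {Om : ℕ → A}
    (hO : ∀ a, e * x ^ a * e = Om a * e) (a : ℕ) : e * x ^ a * xb = -(e * x ^ (a + 1)) - Om a * e := by
  induction a with
  | zero =>
    have := hO 0
    rw [pow_zero, mul_one, h.ee] at this
    rw [← this]; simp [h.exb]
  | succ a ih =>
    have t1 : ∀ w, e * (x ^ a * (c * (e * w))) = 0 := fun w => by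
      have := congrArg (· * w) (h.exce a); simpa [mul_assoc] using this
    have t2 : ∀ w, e * (x ^ a * (x * (c * (e * w)))) = 0 := fun w => by
      have := congrArg (· * w) (h.exce (a + 1)); simpa [mul_assoc, pow_succ] using this
    have t3 : ∀ w, e * (x ^ a * (e * w)) = Om a * (e * w) := fun w => by
      have := congrArg (· * w) (hO a); simpa [mul_assoc] using this
    have t4 : e * (x ^ a * (x * e)) = Om (a + 1) * e := by
      have := hO (a + 1); simpa [mul_assoc, pow_succ] using this
    have e0 : e * x ^ (a + 1) * xb = (e * x ^ a * xb) * x + e * x ^ a * (e * x - c * e * c * x - x * e + x * (c * e * c)) := by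
      rw [pow_succ, mul_assoc e, mul_assoc (x ^ a), h.xxb]
      simp only [mul_add, mul_assoc]
    rw [e0, ih]
    simp only [mul_sub, mul_add, sub_mul, neg_mul, mul_assoc, t1, t2, t3, t4, pow_succ]
    abel

lemma odd_expand (h : Core e x xb c cb) {Om : ℕ → A}
    (hO : ∀ a, e * x ^ a * e = Om a * e) (n : ℕ) : e * xb ^ (2 * n + 1) =
    ∑ j ∈ Finset.range (n + 1), acoef Om n j * (e * x ^ (2 * j + 1)) := by
  induction n with
  | zero => simp [acoef, h.exb]
  | succ n ih =>
    have hz : ∀ j, Om (2 * j + 2) * e = 0 := fun j => by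
      rw [← hO, show 2 * j + 2 = 2 * (j + 1) by ring, h.even]
    have key : ∀ j, e * x ^ (2 * j + 1) * xb * xb = e * x ^ (2 * (j + 1) + 1) +
        Om (2 * j + 1) * (e * x) := by
      intro j
      rw [h.expow hO, sub_mul, neg_mul, h.expow hO, mul_assoc _ e xb, h.exb, hz]
      simp only [mul_neg, sub_zero, neg_neg, sub_neg_eq_add]; rfl
    rw [show 2 * (n + 1) + 1 = 2 * n + 1 + 1 + 1 by ring, pow_succ, pow_succ, ← mul_assoc,
      ← mul_assoc, ih, Finset.sum_mul, Finset.sum_mul, Finset.sum_range_succ' _ (n + 1)]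
    simp only [acoef, mul_assoc (acoef Om n _), key, mul_add, Finset.sum_add_distrib, Finset.sum_mul]
    simp [mul_assoc]

lemma odd_final (h : Core e x xb c cb) {Om : ℕ → A}
    (hO : ∀ a, e * x ^ a * e = Om a * e) (n : ℕ) : e * xb ^ (2 * n + 1) * e =
    (∑ j ∈ Finset.range (n + 1), acoef Om n j * Om (2 * j + 1)) * e := by
  rw [h.odd_expand hO, Finset.sum_mul, Finset.sum_mul]
  simp only [mul_assoc (acoef Om n _), hO]

end Core

lemma acoef_mem {R A : Type} [CommRing R] [Ring A] [Algebra R A] (S : Subalgebra R A) (Om : ℕ → A)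
    (hO : ∀ a, Om a ∈ S) (n j : ℕ) : acoef Om n j ∈ S := by
  induction n generalizing j with
  | zero => simpa [acoef] using S.neg_mem S.one_mem
  | succ n ih =>
    rcases j with _ | j
    · rw [acoef]; exact S.sum_mem fun j _ => S.mul_mem (ih j) (hO _)
    · rw [acoef]; exact ih j

end SB8

namespace SB8

section clifford
variable (R : Type) [CommRing R] (J : Type) [Fintype J] [DecidableEq J]

/-- The quadratic form `-∑ x_s²`. -/
def Qf : QuadraticForm R (J → R) := QuadraticMap.weightedSumSquares R (fun _ => (-1 : R))

/-- The Clifford algebra. -/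
abbrev Cl : Type := CliffordAlgebra (Qf R J)

variable {J}
/-- The Clifford generators. -/
def cc (s : J) : Cl R J := CliffordAlgebra.ι (Qf R J) (Pi.single s 1)

variable {R}

lemma Qf_apply (v : J → R) : Qf R J v = ∑ i, (-1 : R) • (v i * v i) :=
  QuadraticMap.weightedSumSquares_apply _ _

lemma cc_sq (s : J) : cc R s * cc R s = -1 := by
  rw [cc, CliffordAlgebra.ι_sq_scalar, Qf_apply, Finset.sum_eq_single s]
  · simp
  · intro b _ hb; simp [hb]
  · simp

lemma cc_anti {s u : J} (h : s ≠ u) : cc R s * cc R u = -(cc R u * cc R s) := by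
  rw [eq_neg_iff_add_eq_zero, cc, cc]
  apply CliffordAlgebra.ι_mul_ι_add_swap_of_isOrtho
  rw [QuadraticMap.isOrtho_def, Qf]
  simp only [QuadraticMap.weightedSumSquares_apply, ← Finset.sum_add_distrib]
  apply Finset.sum_congr rfl
  intro i _
  by_cases h1 : i = s
  · subst h1; simp [h]
  · simp [h1]

/-- Lift out of the Clifford algebra, from images of the generators. -/
lemma cl_hom_ext {B : Type} [Ring B] [Algebra R B] {f g : Cl R J →ₐ[R] B}
    (h : ∀ s, f (cc R s) = g (cc R s)) : f = g := by
  apply CliffordAlgebra.hom_ext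
  apply LinearMap.pi_ext'
  intro s
  ext
  exact h s

lemma cc_adjoin : Algebra.adjoin R (Set.range (cc R : J → Cl R J)) = ⊤ := by
  rw [eq_top_iff, ← CliffordAlgebra.adjoin_range_ι]
  apply Algebra.adjoin_le
  rintro _ ⟨v, rfl⟩
  have : v = ∑ s, v s • Pi.single s (1 : R) := by
    conv_lhs => rw [← Finset.univ_sum_single v]
    refine Finset.sum_congr rfl fun s _ => ?_
    rw [← Pi.single_smul]; simp
  rw [this, map_sum]
  refine Subalgebra.sum_mem _ fun s _ => ?_
  rw [map_smul]
  exact Subalgebra.smul_mem _ (Algebra.subset_adjoin (Set.mem_range_self (f := cc R) s)) _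

/-- Lifting. -/
def clLift {B : Type} [Ring B] [Algebra R B] (f : J → B) (h1 : ∀ s, f s * f s = -1)
    (h2 : ∀ s u, s ≠ u → f s * f u = -(f u * f s)) : Cl R J →ₐ[R] B :=
  CliffordAlgebra.lift (Qf R J) ⟨Fintype.linearCombination R f, by
    intro v
    rw [Fintype.linearCombination_apply, Qf, QuadraticMap.weightedSumSquares_apply, Finset.sum_mul_sum]
    simp only [smul_mul_smul_comm]
    have key : ∀ T : Finset J, ∑ i ∈ T, ∑ j ∈ T, (v i * v j) • (f i * f j) =
        algebraMap R B (∑ i ∈ T, (-1 : R) • (v i * v i)) := by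
      intro T
      induction T using Finset.induction_on with
      | empty => simp
      | insert a T ha ih =>
        rw [Finset.sum_insert ha, Finset.sum_insert ha, Finset.sum_insert ha]
        simp only [Finset.sum_insert ha, Finset.sum_add_distrib]
        rw [ih, h1 a]
        have : ∑ j ∈ T, (v a * v j) • (f a * f j) + ∑ i ∈ T, (v i * v a) • (f i * f a) = 0 := by
          rw [← Finset.sum_add_distrib]
          apply Finset.sum_eq_zero
          intro i hi
          rw [h2 a i (by rintro rfl; exact ha hi), mul_comm (v i), smul_neg, neg_add_cancel]
        rw [map_add, add_assoc, ← add_assoc (∑ j ∈ T, _), this, zero_add]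
        congr 1
        simp [Algebra.smul_def]
    exact key Finset.univ⟩

lemma clLift_cc {B : Type} [Ring B] [Algebra R B] (f : J → B) (h1 h2) (s : J) :
    clLift (R := R) f h1 h2 (cc R s) = f s := by
  simp [clLift, cc, Fintype.linearCombination_apply_single]

/-- Action of permutations. -/
def act (π : Equiv.Perm J) : Cl R J →ₐ[R] Cl R J :=
  clLift (fun s => cc R (π s)) (fun _ => cc_sq _) (fun _ _ h => cc_anti (fun h' => h (π.injective h')))

@[simp] lemma act_cc (π : Equiv.Perm J) (s) : act π (cc R s) = cc R (π s) := clLift_cc _ _ _ _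

lemma act_mul (π π' : Equiv.Perm J) (X : Cl R J) : act (π * π') X = act π (act π' X) := by
  have : act (R := R) (π * π') = (act π).comp (act π') := cl_hom_ext (by simp)
  rw [this]; rfl
lemma act_one (X : Cl R J) : act 1 X = X := by
  have : act (R := R) (1 : Equiv.Perm J) = AlgHom.id R _ := cl_hom_ext (by simp)
  rw [this]; rfl

/-- Parity automorphism. -/
def par : Cl R J →ₐ[R] Cl R J := CliffordAlgebra.involute

@[simp] lemma par_cc (s : J) : par (cc R s) = -cc R s := CliffordAlgebra.involute_ι _
@[simp] lemma par_par (X : Cl R J) : par (par X) = X := CliffordAlgebra.involute_involute X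

lemma act_par (π : Equiv.Perm J) (X : Cl R J) : act π (par X) = par (act π X) := by
  have : (act (R := R) π).comp par = par.comp (act π) := cl_hom_ext (by simp)
  exact DFunLike.congr_fun this X

/-- Contraction. -/
def con (p : J) : Cl R J →ₗ[R] Cl R J :=
  par.toLinearMap ∘ₗ (CliffordAlgebra.contractLeft (LinearMap.proj p : (J → R) →ₗ[R] R))

lemma con_cc_mul (p s : J) (X : Cl R J) :
    con p (cc R s * X) = (if s = p then par X else 0) + cc R s * con p X := by
  simp only [con, cc, LinearMap.comp_apply, CliffordAlgebra.contractLeft_ι_mul]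
  simp only [LinearMap.proj_apply, AlgHom.toLinearMap_apply, map_sub, map_smul, map_mul]
  rw [show par (CliffordAlgebra.ι (Qf R J) (Pi.single s 1)) = -(CliffordAlgebra.ι (Qf R J) (Pi.single s 1))
    from CliffordAlgebra.involute_ι _]
  by_cases h : s = p
  · subst h; simp
  · simp [h, Ne.symm h]

lemma con_one (p : J) : con p (1 : Cl R J) = 0 := by
  simp [con]

/-- Subalgebra generated by the `cc s`, `s ∉ T`. -/
def FF (R : Type) [CommRing R] {J : Type} [Fintype J] [DecidableEq J] (T : Set J) :
    Subalgebra R (Cl R J) := Algebra.adjoin R (cc R '' Tᶜ)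

lemma cc_mem {T : Set J} {s : J} (h : s ∉ T) : cc R s ∈ FF R T := Algebra.subset_adjoin ⟨s, h, rfl⟩

lemma FF_mono {T T' : Set J} (h : T ⊆ T') : FF R T' ≤ FF R T :=
  Algebra.adjoin_mono (Set.image_mono (Set.compl_subset_compl.mpr h))

lemma FF_empty (X : Cl R J) : X ∈ FF R (∅ : Set J) := by
  rw [FF, Set.compl_empty, Set.image_univ, cc_adjoin]; trivial

lemma par_mem {T : Set J} {X : Cl R J} (h : X ∈ FF R T) : par X ∈ FF R T := by
  have : FF R T ≤ (FF R T).comap par := by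
    apply Algebra.adjoin_le
    rintro _ ⟨s, hs, rfl⟩
    show par (cc R s) ∈ FF R T
    rw [par_cc]; exact neg_mem (cc_mem hs)
  exact this h

lemma act_mem {T : Set J} (π : Equiv.Perm J) {T' : Set J} (hT : ∀ s, s ∉ T → π s ∉ T') {X : Cl R J}
    (h : X ∈ FF R T) : act π X ∈ FF R T' := by
  have : FF R T ≤ (FF R T').comap (act π) := by
    apply Algebra.adjoin_le
    rintro _ ⟨s, hs, rfl⟩
    show act π (cc R s) ∈ FF R T'
    rw [act_cc]; exact cc_mem (hT s hs)
  exact this h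

lemma act_fix {T : Set J} (π : Equiv.Perm J) (hT : ∀ s, s ∉ T → π s = s) {X : Cl R J}
    (h : X ∈ FF R T) : act π X = X := by
  have : FF R T ≤ AlgHom.equalizer (act π) (AlgHom.id R _) := by
    apply Algebra.adjoin_le
    rintro _ ⟨s, hs, rfl⟩
    show act π (cc R s) = cc R s
    rw [act_cc, hT s hs]
  exact this h

lemma cc_mul_F {T : Set J} {p : J} (hp : p ∈ T) {X : Cl R J} (h : X ∈ FF R T) :
    cc R p * X = par X * cc R p := by
  induction h using Algebra.adjoin_induction with
  | mem x hx =>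
    obtain ⟨s, hs, rfl⟩ := hx
    rw [par_cc, cc_anti (by rintro rfl; exact hs hp), neg_mul]
  | algebraMap r => rw [AlgHom.commutes, Algebra.commutes]
  | add x y _ _ hx hy => rw [mul_add, map_add, add_mul, hx, hy]
  | mul x y _ _ hx hy => rw [← mul_assoc, hx, mul_assoc, hy, map_mul, mul_assoc]

lemma con_F_mul {T : Set J} {p : J} (hp : p ∈ T) {X : Cl R J} (h : X ∈ FF R T) (Z : Cl R J) :
    con p (X * Z) = X * con p Z := by
  induction h using Algebra.adjoin_induction generalizing Z with
  | mem x hx =>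
    obtain ⟨s, hs, rfl⟩ := hx
    have : s ≠ p := by rintro rfl; exact hs hp
    rw [con_cc_mul, if_neg this, zero_add]
  | algebraMap r => rw [← Algebra.smul_def, ← Algebra.smul_def, map_smul]
  | add x y _ _ hx hy => rw [add_mul, map_add, add_mul, hx, hy]
  | mul x y _ _ hx hy => rw [mul_assoc, hx, hy, mul_assoc]

lemma decomp (T : Set J) (p : J) {X : Cl R J} (h : X ∈ FF R T) :
    ∃ x ∈ FF R (insert p T), ∃ y ∈ FF R (insert p T), X = x + y * cc R p := by
  have key : ∀ Z : Cl R J, (∃ x ∈ FF R (insert p T), ∃ y ∈ FF R (insert p T), Z = x + y * cc R p) →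
      ∃ x ∈ FF R (insert p T), ∃ y ∈ FF R (insert p T), X * Z = x + y * cc R p := by
    induction h using Algebra.adjoin_induction with
    | mem c hc =>
      rintro _ ⟨x, hx, y, hy, rfl⟩
      obtain ⟨s, hs, rfl⟩ := hc
      by_cases hsp : s = p
      · subst hsp
        refine ⟨-par y, neg_mem (par_mem hy), par x, par_mem hx, ?_⟩
        rw [mul_add, ← mul_assoc, cc_mul_F (Set.mem_insert _ _) hx, cc_mul_F (Set.mem_insert _ _) hy,
          mul_assoc (par y), cc_sq]; simp [add_comm]
      · have hs' : cc R s ∈ FF R (insert p T) := cc_mem (by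
          rintro (h | h); exacts [hsp h, hs h])
        exact ⟨_, mul_mem hs' hx, _, mul_mem hs' hy, by rw [mul_add, mul_assoc]⟩
    | algebraMap r =>
      rintro _ ⟨x, hx, y, hy, rfl⟩
      exact ⟨_, mul_mem (Subalgebra.algebraMap_mem _ r) hx, _,
        mul_mem (Subalgebra.algebraMap_mem _ r) hy, by rw [mul_add, mul_assoc]⟩
    | add a b _ _ ha hb =>
      intro Z hZ
      obtain ⟨x, hx, y, hy, h1⟩ := ha Z hZ
      obtain ⟨x', hx', y', hy', h2⟩ := hb Z hZ
      exact ⟨_, add_mem hx hx', _, add_mem hy hy', by rw [add_mul, h1, h2, add_mul]; abel⟩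
    | mul a b _ _ ha hb =>
      intro Z hZ
      rw [mul_assoc]; exact ha _ (hb Z hZ)
  have := key 1 ⟨1, one_mem _, 0, zero_mem _, by simp⟩
  rwa [mul_one] at this

/-- Substitution of `cc a` for `cc p` in the normal form `x + y cc p`. -/
def th (p a : J) : Cl R J →ₗ[R] Cl R J :=
  LinearMap.id + (LinearMap.mulRight R (cc R a - cc R p)) ∘ₗ con p

lemma th_apply (p a : J) (X : Cl R J) : th p a X = X + con p X * (cc R a - cc R p) := rfl

lemma th_F {T : Set J} {p : J} (a : J) (hp : p ∈ T) {X : Cl R J} (h : X ∈ FF R T) :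
    th p a X = X := by
  have := con_F_mul hp h 1
  rw [mul_one, con_one, mul_zero] at this
  rw [th_apply, this, zero_mul, add_zero]

lemma th_F_cc {T : Set J} {p : J} (a : J) (hp : p ∈ T) {X : Cl R J} (h : X ∈ FF R T) :
    th p a (X * cc R p) = X * cc R a := by
  have := con_F_mul hp h (cc R p)
  have h2 := con_cc_mul (R := R) p p 1
  rw [mul_one, con_one] at h2
  simp only [if_true, map_one, mul_zero, add_zero] at h2
  rw [th_apply, this, h2, mul_one, mul_sub]; abel

lemma th_decomp {T : Set J} {p : J} (a : J) (hp : p ∈ T) {x y : Cl R J} (hx : x ∈ FF R T)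
    (hy : y ∈ FF R T) : th p a (x + y * cc R p) = x + y * cc R a := by
  rw [map_add, th_F a hp hx, th_F_cc a hp hy]

lemma th_mem {T : Set J} {p a : J} (ha : a ∉ insert p T) {X : Cl R J} (h : X ∈ FF R T) :
    th p a X ∈ FF R (insert p T) := by
  obtain ⟨x, hx, y, hy, rfl⟩ := decomp T p h
  rw [th_decomp a (Set.mem_insert _ _) hx hy]
  exact add_mem hx (mul_mem hy (cc_mem ha))

/-- Decomposition in the full Clifford algebra. -/
lemma decomp1 (p : J) (X : Cl R J) : ∃ x ∈ FF R {p}, ∃ y ∈ FF R {p}, X = x + y * cc R p := by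
  have := decomp ∅ p (FF_empty X)
  simpa using this

lemma decomp2 (p p' : J) (X : Cl R J) : ∃ x ∈ FF R {p, p'}, ∃ y ∈ FF R {p, p'}, ∃ z ∈ FF R {p, p'},
    ∃ u ∈ FF R {p, p'}, X = x + y * cc R p + (z + u * cc R p) * cc R p' := by
  obtain ⟨a, ha, b, hb, rfl⟩ := decomp1 p' X
  obtain ⟨x, hx, y, hy, rfl⟩ := decomp _ p ha
  obtain ⟨z, hz, u, hu, rfl⟩ := decomp _ p hb
  exact ⟨x, hx, y, hy, z, hz, u, hu, rfl⟩

lemma th_mem1 {p a : J} (ha : a ≠ p) (X : Cl R J) : th p a X ∈ FF R {p} := by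
  have := th_mem (T := ∅) (p := p) (a := a) (by simpa using ha) (FF_empty X)
  simpa using this

lemma th_cc_mul {p s : J} (a : J) (h : s ≠ p) (X : Cl R J) : th p a (cc R s * X) = cc R s * th p a X := by
  rw [th_apply, th_apply, con_cc_mul, if_neg h, zero_add, mul_add, mul_assoc]

lemma par_th (p a : J) (X : Cl R J) : par (th p a X) = th p a (par X) := by
  obtain ⟨x, hx, y, hy, rfl⟩ := decomp1 p X
  have : par (x + y * cc R p) = par x + (-par y) * cc R p := by simp
  rw [th_decomp a (Set.mem_singleton p) hx hy, this, th_decomp a (Set.mem_singleton p) (par_mem hx)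
    (neg_mem (par_mem hy))]
  simp

lemma th_mul_cc {p a b : J} (ha : a ≠ p) (hb : b ≠ a) (X : Cl R J) :
    th p a (X * cc R b) = th p a X * cc R (Equiv.swap p a b) := by
  obtain ⟨x, hx, y, hy, rfl⟩ := decomp1 p X
  rw [th_decomp a (Set.mem_singleton p) hx hy]
  by_cases hbp : b = p
  · subst hbp
    have : (x + y * cc R b) * cc R b = -y + x * cc R b := by
      rw [add_mul, mul_assoc, cc_sq]; simp [add_comm]
    rw [this, th_decomp a (Set.mem_singleton _) (neg_mem hy) hx, Equiv.swap_apply_left,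
      add_mul, mul_assoc, cc_sq]; simp [add_comm]
  · have hb' : cc R b ∈ FF R {p} := cc_mem (by simpa using hbp)
    have : (x + y * cc R p) * cc R b = x * cc R b + (-(y * cc R b)) * cc R p := by
      rw [add_mul, mul_assoc, cc_anti (Ne.symm hbp)]; simp [mul_assoc]
    rw [this, th_decomp a (Set.mem_singleton _) (mul_mem hx hb') (neg_mem (mul_mem hy hb')),
      Equiv.swap_apply_of_ne_of_ne hbp hb, add_mul, mul_assoc y, cc_anti (Ne.symm hb)]
    simp [mul_assoc]

lemma th_e_c {p a : J} (ha : a ≠ p) (X : Cl R J) :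
    th p a (cc R p * X) = th p a (par X * cc R a) := by
  obtain ⟨x, hx, y, hy, rfl⟩ := decomp1 p X
  have hp := Set.mem_singleton p
  have ha' : cc R a ∈ FF R {p} := cc_mem (by simpa using ha)
  have e1 : cc R p * (x + y * cc R p) = -par y + par x * cc R p := by
    rw [mul_add, ← mul_assoc, cc_mul_F hp hx, cc_mul_F hp hy, mul_assoc, cc_sq]; simp [add_comm]
  have e2 : par (x + y * cc R p) * cc R a = par x * cc R a + (par y * cc R a) * cc R p := by
    rw [map_add, map_mul, par_cc, add_mul, mul_assoc, neg_mul, cc_anti (Ne.symm ha)]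
    simp [mul_assoc]
  rw [e1, e2, th_decomp a hp (neg_mem (par_mem hy)) (par_mem hx),
    th_decomp a hp (mul_mem (par_mem hx) ha') (mul_mem (par_mem hy) ha'), mul_assoc, cc_sq]
  simp [add_comm]

lemma act_th (π : Equiv.Perm J) (p a : J) (X : Cl R J) :
    act π (th p a X) = th (π p) (π a) (act π X) := by
  obtain ⟨x, hx, y, hy, rfl⟩ := decomp1 p X
  have hm : ∀ z ∈ FF R {p}, act π z ∈ FF R {π p} := fun z hz => act_mem π (by simp) hz
  rw [th_decomp a (Set.mem_singleton p) hx hy]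
  simp only [map_add (act π), map_mul, act_cc]
  rw [th_decomp _ (Set.mem_singleton _) (hm _ hx) (hm _ hy)]

lemma th_act {p a : J} (ha : a ≠ p) {Y : Cl R J} (h : Y ∈ FF R {p}) :
    th p a (act (Equiv.swap p a) Y) = Y := by
  obtain ⟨x, hx, y, hy, rfl⟩ := decomp _ a h
  have hf : ∀ z ∈ FF R (insert a {p}), act (Equiv.swap p a) z = z := fun z hz =>
    act_fix _ (fun s hs => by
      simp only [Set.mem_insert_iff, Set.mem_singleton_iff, not_or] at hs
      exact Equiv.swap_apply_of_ne_of_ne hs.2 hs.1) hz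
  simp only [map_add (act _), map_mul, act_cc, hf _ hx, hf _ hy, Equiv.swap_apply_right]
  rw [th_decomp (T := insert a {p}) a (by simp) hx hy]

end clifford
end SB8

namespace SB8

section module
variable (R : Type) [CommRing R] (J : Type) [Fintype J] [DecidableEq J]

/-- The module on which the walled Brauer–Clifford algebra acts. -/
abbrev Mo : Type := Equiv.Perm J →₀ Cl R J

variable {R J}

/-- Operators defined on the pieces. -/
def op (f : Equiv.Perm J → Equiv.Perm J) (g : Equiv.Perm J → Cl R J →ₗ[R] Cl R J) :
    Module.End R (Mo R J) :=
  Finsupp.lsum R (fun w => (Finsupp.lsingle (f w)).comp (g w))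

lemma op_single (f : Equiv.Perm J → Equiv.Perm J) (g : Equiv.Perm J → Cl R J →ₗ[R] Cl R J)
    (w : Equiv.Perm J) (X : Cl R J) :
    op f g (Finsupp.single w X) = Finsupp.single (f w) (g w X) := by
  simp [op]

lemma end_ext {f g : Module.End R (Mo R J)}
    (h : ∀ w X, f (Finsupp.single w X) = g (Finsupp.single w X)) : f = g :=
  Finsupp.lhom_ext h

/-- Left multiplication by a permutation. -/
def Lp (π : Equiv.Perm J) : Module.End R (Mo R J) := op (fun w => π * w) (fun _ => (act π).toLinearMap)
/-- Right multiplication by a permutation. -/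
def Rp (τ : Equiv.Perm J) : Module.End R (Mo R J) := op (fun w => w * τ⁻¹) (fun _ => LinearMap.id)
/-- Left Clifford multiplication. -/
def Lc (s : J) : Module.End R (Mo R J) := op (fun w => w) (fun _ => LinearMap.mulLeft R (cc R s))
/-- Right Clifford multiplication. -/
def Rc (s : J) : Module.End R (Mo R J) :=
  op (fun w => w) (fun w => (LinearMap.mulRight R (cc R (w s))) ∘ₗ par.toLinearMap)
/-- The contraction operator. -/
def ee (p q : J) : Module.End R (Mo R J) :=
  op (fun w => Equiv.swap p (w q) * w) (fun w => if w q = p then 0 else th p (w q))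

variable (w π τ : Equiv.Perm J) (X : Cl R J)
@[simp] lemma Lp_s : Lp π (Finsupp.single w X) = Finsupp.single (π * w) (act π X) := op_single _ _ _ _
@[simp] lemma Rp_s : Rp τ (Finsupp.single w X) = Finsupp.single (w * τ⁻¹) X := op_single _ _ _ _
@[simp] lemma Lc_s (s : J) : Lc s (Finsupp.single w X) = Finsupp.single w (cc R s * X) :=
  op_single _ _ _ _
@[simp] lemma Rc_s (s : J) : Rc s (Finsupp.single w X) = Finsupp.single w (par X * cc R (w s)) :=
  op_single _ _ _ _
lemma ee_0 {p q : J} {w : Equiv.Perm J} (h : w q = p) : ee p q (Finsupp.single w X) = 0 := by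
  rw [ee, op_single, if_pos h]; simp
lemma ee_1 {p q : J} {w : Equiv.Perm J} (h : w q ≠ p) : ee p q (Finsupp.single w X) =
    Finsupp.single (Equiv.swap p (w q) * w) (th p (w q) X) := by
  rw [ee, op_single, if_neg h]

lemma Lp_mul (π π' : Equiv.Perm J) : (Lp (π * π') : Module.End R (Mo R J)) = Lp π * Lp π' :=
  end_ext fun w X => by simp [-Finsupp.single_mul, act_mul, mul_assoc]
lemma Lp_one : (Lp 1 : Module.End R (Mo R J)) = 1 := end_ext fun w X => by simp [-Finsupp.single_mul, act_one]
lemma Rp_mul (π π' : Equiv.Perm J) : (Rp (π * π') : Module.End R (Mo R J)) = Rp π * Rp π' :=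
  end_ext fun w X => by simp [-Finsupp.single_mul, mul_assoc]
lemma Rp_one : (Rp 1 : Module.End R (Mo R J)) = 1 := end_ext fun w X => by simp [-Finsupp.single_mul]

lemma Lc_sq (s : J) : (Lc s * Lc s : Module.End R (Mo R J)) = -1 :=
  end_ext fun w X => by simp [-Finsupp.single_mul, ← mul_assoc, cc_sq]
lemma Lc_anti {s u : J} (h : s ≠ u) : (Lc s * Lc u : Module.End R (Mo R J)) = -(Lc u * Lc s) :=
  end_ext fun w X => by simp [-Finsupp.single_mul, ← mul_assoc, cc_anti h]
lemma Rc_sq (s : J) : (Rc s * Rc s : Module.End R (Mo R J)) = 1 :=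
  end_ext fun w X => by simp [-Finsupp.single_mul, mul_assoc, cc_sq]
lemma Rc_anti {s u : J} (h : s ≠ u) : (Rc s * Rc u : Module.End R (Mo R J)) = -(Rc u * Rc s) :=
  end_ext fun w X => by
    have : w u ≠ w s := fun h' => h (w.injective h').symm
    simp [-Finsupp.single_mul, mul_assoc, cc_anti this]
lemma Lp_Lc (s : J) : (Lp π * Lc s * Lp π⁻¹ : Module.End R (Mo R J)) = Lc (π s) :=
  end_ext fun w X => by simp [-Finsupp.single_mul, ← act_mul, act_one]
lemma Rp_Rc (s : J) : (Rp π * Rc s * Rp π⁻¹ : Module.End R (Mo R J)) = Rc (π s) :=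
  end_ext fun w X => by simp [-Finsupp.single_mul]
lemma Lp_Rp : (Lp π * Rp τ : Module.End R (Mo R J)) = Rp τ * Lp π :=
  end_ext fun w X => by simp [-Finsupp.single_mul, mul_assoc]
lemma Lp_Rc (s : J) : (Lp π * Rc s : Module.End R (Mo R J)) = Rc s * Lp π :=
  end_ext fun w X => by simp [-Finsupp.single_mul, act_par]
lemma Rp_Lc (s : J) : (Rp π * Lc s : Module.End R (Mo R J)) = Lc s * Rp π :=
  end_ext fun w X => by simp [-Finsupp.single_mul]
lemma Lc_Rc (s u : J) : (Lc s * Rc u : Module.End R (Mo R J)) = -(Rc u * Lc s) :=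
  end_ext fun w X => by simp [-Finsupp.single_mul, mul_assoc]

variable (p q : J)
lemma ee_Lc : (ee p q * Lc p : Module.End R (Mo R J)) = ee p q * Rc q :=
  end_ext fun w X => by
    by_cases h : w q = p
    · simp [-Finsupp.single_mul, ee_0 _ h]
    · simp [-Finsupp.single_mul, ee_1 _ h, th_e_c h]
lemma Lc_ee : (Lc p * ee p q : Module.End R (Mo R J)) = Rc q * ee p q :=
  end_ext fun w X => by
    by_cases h : w q = p
    · simp [-Finsupp.single_mul, ee_0 _ h]
    · simp [-Finsupp.single_mul, ee_1 _ h, cc_mul_F (Set.mem_singleton p) (th_mem1 h X)]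
lemma ee_ee : (ee p q * ee p q : Module.End R (Mo R J)) = 0 :=
  end_ext fun w X => by
    by_cases h : w q = p
    · simp [-Finsupp.single_mul, ee_0 _ h]
    · simp [-Finsupp.single_mul, ee_1 _ h]
      rw [ee_0]; simp
lemma ee_Lc_ee : (ee p q * Lc p * ee p q : Module.End R (Mo R J)) = 0 :=
  end_ext fun w X => by
    by_cases h : w q = p
    · simp [-Finsupp.single_mul, ee_0 _ h]
    · simp [-Finsupp.single_mul, ee_1 _ h]
      rw [ee_0]; simp
lemma ee_Lp_ee {p1 : J} (h1 : p1 ≠ p) :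
    (ee p q * Lp (Equiv.swap p p1) * ee p q : Module.End R (Mo R J)) = ee p q :=
  end_ext fun w X => by
    by_cases h : w q = p
    · simp [-Finsupp.single_mul, ee_0 _ h]
    · have : (Equiv.swap p p1 * (Equiv.swap p (w q) * w)) q = p1 := by simp
      simp only [Module.End.mul_apply, ee_1 _ h, Lp_s]
      rw [ee_1 _ (by rw [this]; exact h1), this, th_act h1 (th_mem1 h X)]
      simp [-Finsupp.single_mul, ← mul_assoc]
lemma ee_Rp_ee {q1 : J} (h1 : q1 ≠ q) :
    (ee p q * Rp (Equiv.swap q q1) * ee p q : Module.End R (Mo R J)) = ee p q :=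
  end_ext fun w X => by
    by_cases h : w q = p
    · simp [-Finsupp.single_mul, ee_0 _ h]
    · simp only [Module.End.mul_apply, ee_1 _ h, Rp_s]
      set w' := Equiv.swap p (w q) * w with hw'
      have h2 : w' q = p := by simp [-Finsupp.single_mul, hw']
      have h3 : (w' * (Equiv.swap q q1)⁻¹) q = w' q1 := by simp
      have h4 : w' q1 ≠ p := by rw [← h2]; exact fun h => h1 (w'.injective h)
      rw [ee_1 _ (by rw [h3]; exact h4), h3, th_F _ (Set.mem_singleton p) (th_mem1 h X)]
      congr 1
      rw [Equiv.swap_inv, Equiv.mul_swap_eq_swap_mul, h2, ← mul_assoc]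
      simp
lemma Lp_ee : (Lp π * ee p q : Module.End R (Mo R J)) = ee (π p) q * Lp π :=
  end_ext fun w X => by
    by_cases h : w q = p
    · simp [-Finsupp.single_mul, ee_0 _ h, ee_0 (p := π p) (q := q) (w := π * w) _ (by simp [-Finsupp.single_mul, h])]
    · have h' : (π * w) q ≠ π p := by simpa using h
      simp only [Module.End.mul_apply, ee_1 _ h, Lp_s, ee_1 _ h', act_th]
      simp only [Equiv.Perm.coe_mul, Function.comp]
      congr 1
      rw [← mul_assoc, ← mul_assoc, Equiv.mul_swap_eq_swap_mul]
lemma Rp_ee : (Rp π * ee p q : Module.End R (Mo R J)) = ee p (π q) * Rp π :=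
  end_ext fun w X => by
    have h0 : (w * π⁻¹) (π q) = w q := by simp
    by_cases h : w q = p
    · rw [← h0] at h
      simp [-Finsupp.single_mul, ee_0 _ h, ee_0 (p := p) (q := q) (w := w) _ (by rw [← h0]; exact h)]
    · have h' : (w * π⁻¹) (π q) ≠ p := by rw [h0]; exact h
      simp only [Module.End.mul_apply, ee_1 _ h, Rp_s, ee_1 _ h', h0, mul_assoc]
lemma Lc_ee_comm {s : J} (hs : s ≠ p) : (Lc s * ee p q : Module.End R (Mo R J)) = ee p q * Lc s :=
  end_ext fun w X => by
    by_cases h : w q = p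
    · simp [-Finsupp.single_mul, ee_0 _ h]
    · simp [-Finsupp.single_mul, ee_1 _ h, th_cc_mul _ hs]
lemma Rc_ee_comm {s : J} (hs : s ≠ q) : (Rc s * ee p q : Module.End R (Mo R J)) = ee p q * Rc s :=
  end_ext fun w X => by
    by_cases h : w q = p
    · simp [-Finsupp.single_mul, ee_0 _ h]
    · have h2 : w s ≠ w q := fun h => hs (w.injective h)
      simp [-Finsupp.single_mul, ee_1 _ h, par_th, th_mul_cc h h2]

/-! Two contractions -/
lemma th2a {p p1 a b : J} (hp : p ≠ p1) (hb : b ≠ p) (hb1 : b ≠ p1) {x y z u : Cl R J} (hx : x ∈ FF R {p, p1})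
    (hy : y ∈ FF R {p, p1}) (hz : z ∈ FF R {p, p1}) (hu : u ∈ FF R {p, p1}) :
    th p a (th p1 b (x + y * cc R p + (z + u * cc R p) * cc R p1)) =
    x + z * cc R b + y * cc R a - u * cc R b * cc R a := by
  have m1 : ∀ {v : Cl R J}, v ∈ FF R {p, p1} → v ∈ FF R {p1} := fun h => FF_mono (by simp) h
  have m2 : ∀ {v : Cl R J}, v ∈ FF R {p, p1} → v ∈ FF R {p} := fun h => FF_mono (by simp) h
  have cp : cc R p ∈ FF R {p1} := cc_mem (by simpa using hp)
  have cb : cc R b ∈ FF R {p} := cc_mem (by simpa using hb)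
  rw [th_decomp b (Set.mem_singleton p1) (add_mem (m1 hx) (mul_mem (m1 hy) cp))
    (add_mem (m1 hz) (mul_mem (m1 hu) cp))]
  have : x + y * cc R p + (z + u * cc R p) * cc R b =
      (x + z * cc R b) + (y - u * cc R b) * cc R p := by
    rw [add_mul, mul_assoc u, cc_anti hb.symm, sub_mul]
    simp only [mul_neg, mul_assoc]; abel
  rw [this, th_decomp a (Set.mem_singleton p) (add_mem (m2 hx) (mul_mem (m2 hz) cb))
    (sub_mem (m2 hy) (mul_mem (m2 hu) cb))]
  rw [sub_mul]; abel

lemma th2b {p p1 a : J} (hp : p ≠ p1) {x y z u : Cl R J} (hx : x ∈ FF R {p, p1})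
    (hy : y ∈ FF R {p, p1}) (hz : z ∈ FF R {p, p1}) (hu : u ∈ FF R {p, p1}) :
    th p a (th p1 p (x + y * cc R p + (z + u * cc R p) * cc R p1)) =
    x - u + (y + z) * cc R a := by
  have m1 : ∀ {v : Cl R J}, v ∈ FF R {p, p1} → v ∈ FF R {p1} := fun h => FF_mono (by simp) h
  have m2 : ∀ {v : Cl R J}, v ∈ FF R {p, p1} → v ∈ FF R {p} := fun h => FF_mono (by simp) h
  have cp : cc R p ∈ FF R {p1} := cc_mem (by simpa using hp)
  rw [th_decomp p (Set.mem_singleton p1) (add_mem (m1 hx) (mul_mem (m1 hy) cp))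
    (add_mem (m1 hz) (mul_mem (m1 hu) cp))]
  have : x + y * cc R p + (z + u * cc R p) * cc R p =
      (x - u) + (y + z) * cc R p := by
    rw [add_mul, mul_assoc u, cc_sq, add_mul]; simp only [mul_neg, mul_one]; abel
  rw [this, th_decomp a (Set.mem_singleton p) (sub_mem (m2 hx) (m2 hu)) (add_mem (m2 hy) (m2 hz))]

lemma act2 {p p1 : J} (hp : p ≠ p1) {x y z u : Cl R J} (hx : x ∈ FF R {p, p1})
    (hy : y ∈ FF R {p, p1}) (hz : z ∈ FF R {p, p1}) (hu : u ∈ FF R {p, p1}) :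
    act (Equiv.swap p p1) (x + y * cc R p + (z + u * cc R p) * cc R p1) =
     x + z * cc R p + (y + (-u) * cc R p) * cc R p1 := by
  have hf : ∀ z ∈ FF R {p, p1}, act (Equiv.swap p p1) z = z := fun z hz =>
    act_fix _ (fun s hs => by
      simp only [Set.mem_insert_iff, Set.mem_singleton_iff, not_or] at hs
      exact Equiv.swap_apply_of_ne_of_ne hs.1 hs.2) hz
  simp only [map_add (act _), map_mul, act_cc, hf _ hx, hf _ hy, hf _ hz, hf _ hu,
    Equiv.swap_apply_right, Equiv.swap_apply_left]
  rw [add_mul, mul_assoc u, cc_anti hp.symm, add_mul]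
  simp only [mul_neg, neg_mul, mul_assoc]; abel

lemma ee2 {p1 q1 : J} (hq : q ≠ q1) (h1 : w q1 ≠ p1) (h2 : Equiv.swap p1 (w q1) (w q) ≠ p) :
    (ee p q * ee p1 q1 : Module.End R (Mo R J)) (Finsupp.single w X) =
    Finsupp.single (Equiv.swap p (Equiv.swap p1 (w q1) (w q)) * Equiv.swap p1 (w q1) * w)
      (th p (Equiv.swap p1 (w q1) (w q)) (th p1 (w q1) X)) := by
  rw [Module.End.mul_apply, ee_1 _ h1, ee_1 _ (by simpa using h2)]
  simp [mul_assoc]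

lemma ee2_0 {p1 q1 : J} (h : w q1 = p1 ∨ Equiv.swap p1 (w q1) (w q) = p) :
    (ee p q * ee p1 q1 : Module.End R (Mo R J)) (Finsupp.single w X) = 0 := by
  rw [Module.End.mul_apply]
  by_cases h1 : w q1 = p1
  · rw [ee_0 _ h1, map_zero]
  · rw [ee_1 _ h1, ee_0 _ (by simpa using h.resolve_left h1)]

lemma br2 {p1 q1 : J} (hp : p ≠ p1) (hq : q ≠ q1) :
    (Lp (Equiv.swap p p1) * (ee p q * ee p1 q1) : Module.End R (Mo R J)) =
      Rp (Equiv.swap q q1) * (ee p q * ee p1 q1) :=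
  end_ext fun w X => by
    rw [Module.End.mul_apply (Lp _), Module.End.mul_apply (Rp _)]
    by_cases h1 : w q1 = p1
    · rw [ee2_0 _ _ _ _ (Or.inl h1)]; simp
    by_cases h2 : Equiv.swap p1 (w q1) (w q) = p
    · rw [ee2_0 _ _ _ _ (Or.inr h2)]; simp
    rw [ee2 _ _ _ _ hq h1 h2, Lp_s, Rp_s]
    have h3 : w q ≠ w q1 := fun h => hq (w.injective h)
    have h4 : Equiv.swap p1 (w q1) (w q) ≠ p1 := by
      intro h
      rw [Equiv.swap_apply_eq_iff, Equiv.swap_apply_left] at h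
      exact h3 h
    set a := Equiv.swap p1 (w q1) (w q) with ha
    have hZ : th p a (th p1 (w q1) X) ∈ FF R {p, p1} :=
      th_mem (by simp [h2, h4]) (th_mem1 h1 X)
    rw [act_fix _ _ hZ]
    · congr 1
      have g1 : (Equiv.swap p a * Equiv.swap p1 (w q1) * w) q = p := by simp [← ha]
      have g2 : (Equiv.swap p a * Equiv.swap p1 (w q1) * w) q1 = p1 := by
        simp [Equiv.swap_apply_of_ne_of_ne hp.symm h4.symm]
      rw [Equiv.swap_inv, Equiv.mul_swap_eq_swap_mul _ q q1, g1, g2]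
    · intro s hs
      simp only [Set.mem_insert_iff, Set.mem_singleton_iff, not_or] at hs
      exact Equiv.swap_apply_of_ne_of_ne hs.1 hs.2

lemma perm1 {b p1 b1 : J} (hp : b ≠ p1) (c2 : b1 ≠ b) (c4 : b1 ≠ p1) :
    Equiv.swap b b1 * Equiv.swap p1 b * Equiv.swap b b1 =
      Equiv.swap b b1 * Equiv.swap p1 b1 * Equiv.swap b p1 := by
  ext s
  simp only [Equiv.Perm.coe_mul, Function.comp, Equiv.swap_apply_def]
  grind

lemma perm2 {p b b1 : J} (hp : p ≠ b1) (c2 : b ≠ p) (c4 : b ≠ b1) :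
    Equiv.swap p b * Equiv.swap b1 b * Equiv.swap b b1 =
      Equiv.swap p b * Equiv.swap b1 p * Equiv.swap p b1 := by
  rw [Equiv.swap_comm b b1, Equiv.swap_comm p b1]; simp [mul_assoc]

lemma perm3 {p p1 b b1 : J} (hp : p ≠ p1) (h1 : b ≠ p) (h2 : b ≠ p1) (h3 : b1 ≠ p) (h4 : b1 ≠ p1)
    (h5 : b ≠ b1) :
    Equiv.swap p b1 * Equiv.swap p1 b * Equiv.swap b b1 =
      Equiv.swap p b * Equiv.swap p1 b1 * Equiv.swap p p1 := by
  ext s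
  simp only [Equiv.Perm.coe_mul, Function.comp, Equiv.swap_apply_def]
  grind

lemma br1 {p1 q1 : J} (hp : p ≠ p1) (hq : q ≠ q1) :
    (ee p q * ee p1 q1 * Rp (Equiv.swap q q1) : Module.End R (Mo R J)) =
      ee p q * ee p1 q1 * Lp (Equiv.swap p p1) :=
  end_ext fun w X => by
    rw [Module.End.mul_apply (ee p q * ee p1 q1), Module.End.mul_apply (ee p q * ee p1 q1), Rp_s, Lp_s]
    have h3 : w q ≠ w q1 := fun h => hq (w.injective h)
    have e1 : (w * (Equiv.swap q q1)⁻¹) q = w q1 := by simp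
    have e2 : (w * (Equiv.swap q q1)⁻¹) q1 = w q := by simp
    have e3 : (Equiv.swap p p1 * w) q = Equiv.swap p p1 (w q) := by simp
    have e4 : (Equiv.swap p p1 * w) q1 = Equiv.swap p p1 (w q1) := by simp
    have e5 : w * (Equiv.swap q q1)⁻¹ = Equiv.swap (w q) (w q1) * w := by
      rw [Equiv.swap_inv, Equiv.mul_swap_eq_swap_mul]
    have hz : ∀ b b1 : J, b ≠ b1 → ((b = p1 ∨ Equiv.swap p1 b b1 = p) ↔ (b = p1 ∨ b1 = p ∨ (b = p ∧ b1 = p1))) := by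
      intro b b1 hb
      simp only [Equiv.swap_apply_def]; split_ifs <;> grind
    have hz' : ∀ b b1 : J, b ≠ b1 → ((Equiv.swap p p1 b1 = p1 ∨
        Equiv.swap p1 (Equiv.swap p p1 b1) (Equiv.swap p p1 b) = p) ↔ (b = p1 ∨ b1 = p ∨ (b = p ∧ b1 = p1))) := by
      intro b b1 hb
      simp only [Equiv.swap_apply_def]; split_ifs <;> grind
    by_cases hc : w q = p1 ∨ w q1 = p ∨ (w q = p ∧ w q1 = p1)
    · rw [ee2_0 _ _ _ _ (by rw [e1, e2, hz _ _ h3]; exact hc),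
        ee2_0 _ _ _ _ (by rw [e3, e4, hz' _ _ h3]; exact hc)]
    have f1 := hc
    have f2 := hc
    rw [← hz _ _ h3, not_or] at f1
    rw [← hz' _ _ h3, not_or] at f2
    rw [ee2 _ _ _ _ hq (by rw [e2]; exact f1.1) (by rw [e1, e2]; exact f1.2),
      ee2 _ _ _ _ hq (by rw [e4]; exact f2.1) (by rw [e3, e4]; exact f2.2), e1, e2, e3, e4, e5]
    rw [← mul_assoc, ← mul_assoc]
    clear e1 e2 e3 e4 e5 hz hz' f1 f2
    generalize w q = b at *
    generalize w q1 = b1 at *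
    simp only [not_or, not_and] at hc
    obtain ⟨c1, c2, c3⟩ := hc
    obtain ⟨x, hx, y, hy, z, hz, u, hu, rfl⟩ := decomp2 p p1 X
    rw [act2 hp hx hy hz hu]
    have hu' := neg_mem hu
    by_cases hbp : b = p
    · subst hbp
      have c4 := c3 rfl
      have a1 : Equiv.swap p1 b b1 = b1 := Equiv.swap_apply_of_ne_of_ne c4 c2
      have a2 : Equiv.swap b p1 b1 = b1 := Equiv.swap_apply_of_ne_of_ne c2 c4
      rw [a1, a2, Equiv.swap_apply_left, Equiv.swap_apply_left]
      rw [th2b hp hx hy hz hu, th2a hp c2 c4 hx hz hy hu']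
      congr 1
      · congr 1
        exact perm1 hp c2 c4
      · rw [mul_assoc (-u), cc_sq, add_mul]; simp only [mul_neg, mul_one]; abel
    · by_cases hb1 : b1 = p1
      · subst hb1
        have a2 : Equiv.swap p b1 b = b := Equiv.swap_apply_of_ne_of_ne hbp c1
        have a3 : Equiv.swap b1 p b = b := Equiv.swap_apply_of_ne_of_ne c1 hbp
        rw [a2, Equiv.swap_apply_right, a3, Equiv.swap_apply_left]
        rw [th2b hp hx hz hy hu', th2a hp hbp c1 hx hy hz hu]
        congr 1
        · congr 1
          exact perm2 hp hbp c1
        · rw [mul_assoc u, cc_sq, add_mul]; simp only [mul_neg, mul_one]; abel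
      · have a1 : Equiv.swap p1 b b1 = b1 := Equiv.swap_apply_of_ne_of_ne hb1 (Ne.symm h3)
        have a2 : Equiv.swap p p1 b1 = b1 := Equiv.swap_apply_of_ne_of_ne c2 hb1
        have a3 : Equiv.swap p p1 b = b := Equiv.swap_apply_of_ne_of_ne hbp c1
        have a4 : Equiv.swap p1 b1 b = b := Equiv.swap_apply_of_ne_of_ne c1 h3
        rw [a1, a2, a3, a4]
        rw [th2a hp hbp c1 hx hy hz hu, th2a hp c2 hb1 hx hz hy hu']
        congr 1
        · congr 1
          exact perm3 hp hbp c1 c2 hb1 h3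
        · rw [mul_assoc u, mul_assoc (-u), cc_anti h3]; simp only [mul_neg, neg_mul, neg_neg]; abel

end module

section rep
variable (R : Type) [CommRing R] (n m : ℕ) [NeZero n] [NeZero m]

/-- Left embedding of permutations. -/
def inlP (u : Equiv.Perm (Fin n)) : Equiv.Perm (Fin n ⊕ Fin m) := Equiv.Perm.sumCongrHom _ _ (u, 1)
/-- Right embedding of permutations. -/
def inrP (u : Equiv.Perm (Fin m)) : Equiv.Perm (Fin n ⊕ Fin m) := Equiv.Perm.sumCongrHom _ _ (1, u)

variable {n m}
@[simp] lemma inlP_l (u : Equiv.Perm (Fin n)) (i : Fin n) : inlP n m u (Sum.inl i) = Sum.inl (u i) := rfl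
@[simp] lemma inlP_r (u : Equiv.Perm (Fin n)) (i : Fin m) : inlP n m u (Sum.inr i) = Sum.inr i := rfl
@[simp] lemma inrP_r (u : Equiv.Perm (Fin m)) (i : Fin m) : inrP n m u (Sum.inr i) = Sum.inr (u i) := rfl
@[simp] lemma inrP_l (u : Equiv.Perm (Fin m)) (i : Fin n) : inrP n m u (Sum.inl i) = Sum.inl i := rfl
lemma inlP_mul (u v) : inlP n m (u * v) = inlP n m u * inlP n m v := by
  ext s; rcases s <;> simp
lemma inrP_mul (u v) : inrP n m (u * v) = inrP n m u * inrP n m v := by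
  ext s; rcases s <;> simp
lemma inlP_one : inlP n m 1 = 1 := by ext s; rcases s <;> simp
lemma inrP_one : inrP n m 1 = 1 := by ext s; rcases s <;> simp
lemma inlP_inv (u) : inlP n m u⁻¹ = (inlP n m u)⁻¹ := by
  rw [eq_inv_iff_mul_eq_one, ← inlP_mul]; simp [inlP_one]
lemma inrP_inv (u) : inrP n m u⁻¹ = (inrP n m u)⁻¹ := by
  rw [eq_inv_iff_mul_eq_one, ← inrP_mul]; simp [inrP_one]
lemma inlP_swap (a b) : inlP n m (Equiv.swap a b) = Equiv.swap (Sum.inl a) (Sum.inl b) := by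
  ext s; rcases s with s | s
  · simp only [inlP_l, Equiv.swap_apply_def, Sum.inl.injEq]; split_ifs <;> rfl
  · simp [Equiv.swap_apply_of_ne_of_ne]
lemma inrP_swap (a b) : inrP n m (Equiv.swap a b) = Equiv.swap (Sum.inr a) (Sum.inr b) := by
  ext s; rcases s with s | s
  · simp [Equiv.swap_apply_of_ne_of_ne]
  · simp only [inrP_r, Equiv.swap_apply_def, Sum.inr.injEq]; split_ifs <;> rfl

/-- Endomorphisms of the module. -/
abbrev EM (R : Type) [CommRing R] (n m : ℕ) : Type := Module.End R (Mo R (Fin n ⊕ Fin m))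

lemma conj_br1 {A : Type} [Ring A] {e f s t : A} (ss : s * s = 1) (tt : t * t = 1) (st : s * t = t * s)
    (hs : s * t * e = f * (s * t)) (h : e * f * t = e * f * s) :
    e * s * t * e * s = e * s * t * e * t := by
  have a1 : e * s * t * e = e * f * (s * t) := by
    rw [mul_assoc e s t, mul_assoc e (s * t) e, hs, mul_assoc]
  rw [a1]
  have a2 : s * t * s = t := by rw [st, mul_assoc, ss, mul_one]
  have a3 : s * t * t = s := by rw [mul_assoc, tt, mul_one]
  rw [mul_assoc, mul_assoc (e * f), a2, a3, h]

lemma conj_br2 {A : Type} [Ring A] {e f s t : A}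
    (hs : s * t * e = f * (s * t)) (h : s * (e * f) = t * (e * f)) :
    s * e * s * t * e = t * e * s * t * e := by
  rw [mul_assoc (s * e) s t, mul_assoc (s * e), hs, mul_assoc (t * e) s t, mul_assoc (t * e), hs,
    ← mul_assoc, mul_assoc s, h]
  simp only [mul_assoc]

/-- The representation. -/
def repWBC : WBC R (EM R n m) n m where
  σ := { toFun := fun u => Lp (inlP n m u), map_one' := by rw [inlP_one, Lp_one],
         map_mul' := fun u v => by rw [inlP_mul, Lp_mul] }
  σb := { toFun := fun u => Rp (inrP n m u), map_one' := by rw [inrP_one, Rp_one],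
          map_mul' := fun u v => by rw [inrP_mul, Rp_mul] }
  c := fun i => Lc (Sum.inl i)
  cb := fun j => Rc (Sum.inr j)
  e := ee (Sum.inl 0) (Sum.inr 0)
  c_sq := fun _ => Lc_sq _
  c_anti := fun i j h => Lc_anti (by simpa using h)
  c_conj := fun w i => by simpa [inlP_inv] using Lp_Lc (inlP n m w) (Sum.inl i)
  cb_sq := fun _ => Rc_sq _
  cb_anti := fun i j h => Rc_anti (by simpa using h)
  cb_conj := fun w i => by simpa [inrP_inv] using Rp_Rc (inrP n m w) (Sum.inr i)
  comm_σσb := fun _ _ => Lp_Rp _ _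
  comm_σcb := fun _ _ => Lp_Rc _ _
  comm_σbc := fun _ _ => Rp_Lc _ _
  anti_ccb := fun _ _ => Lc_Rc _ _
  e_c1 := fun _ _ => ee_Lc _ _
  c1_e := fun _ _ => Lc_ee _ _
  e_sq := ee_ee _ _
  e_s_e := fun h => by
    simp only [MonoidHom.coe_mk, OneHom.coe_mk]
    rw [sw_eq n (by omega) h, inlP_swap]
    exact ee_Lp_ee _ _ (by simp [Fin.ext_iff])
  e_sb_e := fun h => by
    simp only [MonoidHom.coe_mk, OneHom.coe_mk]
    rw [sw_eq m (by omega) h, inrP_swap]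
    exact ee_Rp_ee _ _ (by simp [Fin.ext_iff])
  s_e_comm := fun i h1 h2 => by
    simp only [MonoidHom.coe_mk, OneHom.coe_mk]
    rw [sw_eq n (by omega) h2, inlP_swap, Lp_ee, Equiv.swap_apply_of_ne_of_ne] <;>
      simp [Fin.ext_iff]; omega
  sb_e_comm := fun i h1 h2 => by
    simp only [MonoidHom.coe_mk, OneHom.coe_mk]
    rw [sw_eq m (by omega) h2, inrP_swap, Rp_ee, Equiv.swap_apply_of_ne_of_ne] <;>
      simp [Fin.ext_iff]; omega
  braid1 := fun h1 h2 => by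
    simp only [MonoidHom.coe_mk, OneHom.coe_mk]
    rw [sw_eq n (by omega) h1, inlP_swap, sw_eq m (by omega) h2, inrP_swap]
    refine conj_br1 (f := ee (Sum.inl ⟨1, h1⟩) (Sum.inr ⟨1, h2⟩)) ?_ ?_ (Lp_Rp _ _) ?_ ?_
    · rw [← Lp_mul]; simp [Lp_one]
    · rw [← Rp_mul]; simp [Rp_one]
    · rw [mul_assoc, Rp_ee, ← mul_assoc, Lp_ee, mul_assoc]
      congr 2
    · exact br1 _ _ (by simp [Fin.ext_iff]) (by simp [Fin.ext_iff])
  braid2 := fun h1 h2 => by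
    simp only [MonoidHom.coe_mk, OneHom.coe_mk]
    rw [sw_eq n (by omega) h1, inlP_swap, sw_eq m (by omega) h2, inrP_swap]
    refine conj_br2 (f := ee (Sum.inl ⟨1, h1⟩) (Sum.inr ⟨1, h2⟩)) ?_ ?_
    · rw [mul_assoc, Rp_ee, ← mul_assoc, Lp_ee, mul_assoc]
      congr 2
    · exact br2 _ _ (by simp [Fin.ext_iff]) (by simp [Fin.ext_iff])
  c_e_comm := fun i h => Lc_ee_comm _ _ (by
    simp only [ne_eq, Sum.inl.injEq]; rintro rfl; exact h rfl)
  cb_e_comm := fun i h => Rc_ee_comm _ _ (by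
    simp only [ne_eq, Sum.inr.injEq]; rintro rfl; exact h rfl)
  e_c_e := fun _ => ee_Lc_ee _ _
  e_cb_e := fun _ => by
    have := ee_Lc_ee (R := R) (Sum.inl (0 : Fin n)) (Sum.inr (0 : Fin m))
    rw [ee_Lc] at this; exact this

end rep
end SB8

namespace SB8

section reps
variable {R A : Type} [CommRing R] [Ring A] [Algebra R A] {n m : ℕ} [NeZero n] [NeZero m]

/-- Product of contractions along a list. -/
def EL (d : WBC R A n m) (l : List (Fin n × Fin m)) : A := (l.map (fun p => En d p.1 p.2)).prod

/-- Lists of pairs which are partial matchings. -/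
def Mt (l : List (Fin n × Fin m)) : Prop := l.Pairwise (fun a b => a.1 ≠ b.1 ∧ a.2 ≠ b.2)

lemma EL_perm (d : WBC R A n m) {l l' : List (Fin n × Fin m)} (h : Mt l) (p : l.Perm l') :
    EL d l = EL d l' := by
  apply List.Perm.prod_eq' (p.map _)
  rw [List.pairwise_map]
  exact h.imp (fun hab => En_comm d hab.1 hab.2)

lemma EL_cons (d : WBC R A n m) (a : Fin n × Fin m) (l) : EL d (a :: l) = En d a.1 a.2 * EL d l := by
  simp [EL]

lemma EL_append (d : WBC R A n m) (l l' : List (Fin n × Fin m)) :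
    EL d (l ++ l') = EL d l * EL d l' := by
  simp [EL]

lemma EL_front (d : WBC R A n m) {l : List (Fin n × Fin m)} (h : Mt l) {a} (ha : a ∈ l) :
    EL d l = En d a.1 a.2 * EL d (l.erase a) := by
  rw [← EL_cons]; exact EL_perm d h (List.perm_cons_erase ha)

lemma EL_back (d : WBC R A n m) {l : List (Fin n × Fin m)} (h : Mt l) {a b} (ha : a ∈ l) (hb : b ∈ l)
    (hab : a ≠ b) : ∃ X, EL d l = X * (En d a.1 a.2 * En d b.1 b.2) := by
  have hb' : b ∈ l.erase a := (List.mem_erase_of_ne (Ne.symm hab)).mpr hb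
  have p : l.Perm (((l.erase a).erase b) ++ [a, b]) := by
    refine (List.perm_cons_erase ha).trans (((List.perm_cons_erase hb').cons a).trans ?_)
    exact (List.perm_append_comm (l₁ := [a, b]))
  refine ⟨EL d ((l.erase a).erase b), ?_⟩
  rw [EL_perm d h p, EL_append, EL_cons, EL_cons]; simp [EL]

lemma EL_σ (d : WBC R A n m) (u : Equiv.Perm (Fin n)) (l : List (Fin n × Fin m)) :
    d.σ u * EL d l = EL d (l.map (fun p => (u p.1, p.2))) * d.σ u := by
  induction l with
  | nil => simp [EL]
  | cons a l ih =>
    rw [List.map_cons, EL_cons, EL_cons, ← mul_assoc, σ_En, mul_assoc, ih, mul_assoc]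

lemma EL_σb (d : WBC R A n m) (u : Equiv.Perm (Fin m)) (l : List (Fin n × Fin m)) :
    d.σb u * EL d l = EL d (l.map (fun p => (p.1, u p.2))) * d.σb u := by
  induction l with
  | nil => simp [EL]
  | cons a l ih =>
    rw [List.map_cons, EL_cons, EL_cons, ← mul_assoc, σb_En, mul_assoc, ih, mul_assoc]

lemma EL_cb (d : WBC R A n m) (j : Fin m) (l : List (Fin n × Fin m)) (h : ∀ p ∈ l, j ≠ p.2) :
    d.cb j * EL d l = EL d l * d.cb j := by
  induction l with
  | nil => simp [EL]
  | cons a l ih =>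
    rw [EL_cons, ← mul_assoc, cb_En_comm d _ _ _ (h a (by simp)), mul_assoc,
      ih (fun p hp => h p (by simp [hp])), mul_assoc]

lemma Mt_inj {l : List (Fin n × Fin m)} (h : Mt l) {a b} (ha : a ∈ l) (hb : b ∈ l)
    (hab : a.1 = b.1 ∨ a.2 = b.2) : a = b := by
  by_contra hne
  haveI : Std.Symm (fun a b : Fin n × Fin m => a.1 ≠ b.1 ∧ a.2 ≠ b.2) :=
    ⟨fun x y hxy => ⟨hxy.1.symm, hxy.2.symm⟩⟩
  have := List.Pairwise.forall (R := fun a b : Fin n × Fin m => a.1 ≠ b.1 ∧ a.2 ≠ b.2) h ha hb hne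
  rcases hab with h1 | h1
  · exact this.1 h1
  · exact this.2 h1

lemma cap_abs (d : WBC R A n m) {l : List (Fin n × Fin m)} (h : Mt l) (N : ℕ) :
    ∀ (x : Equiv.Perm (Fin n)) (y : Equiv.Perm (Fin m)), x.support.card ≤ N →
    (∀ i, (∀ j, (i, j) ∉ l) → x i = i) → (∀ j, (∀ i, (i, j) ∉ l) → y j = j) →
    (∀ i j, (i, j) ∈ l → (x i, y j) ∈ l) → EL d l * d.σ x * d.σb y = EL d l := by
  induction N with
  | zero =>
    intro x y hx h1 h2 h3
    have hx1 : x = 1 := by simpa using hx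
    subst hx1
    have : y = 1 := by
      ext1 j
      by_cases hj : ∀ i, (i, j) ∉ l
      · exact h2 j hj
      · push Not at hj
        obtain ⟨i, hi⟩ := hj
        have := Mt_inj h hi (h3 i j hi) (Or.inl rfl)
        exact (congrArg Prod.snd this).symm
    subst this
    simp
  | succ N ih =>
    intro x y hx h1 h2 h3
    by_cases hx0 : ∀ i, x i = i
    · have : x = 1 := by ext1 i; exact hx0 i
      exact ih x y (by simp [this]) h1 h2 h3
    push Not at hx0
    obtain ⟨i, hi⟩ := hx0
    have hj : ∃ j, (i, j) ∈ l := by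
      by_contra hj; push Not at hj; exact hi (h1 i hj)
    obtain ⟨j, hj⟩ := hj
    have hj' := h3 i j hj
    have hne : ((i, j) : Fin n × Fin m) ≠ (x i, y j) := fun h => hi (congrArg Prod.fst h).symm
    have hyj : y j ≠ j := by
      intro hy
      exact hne (Mt_inj h hj hj' (Or.inr hy.symm))
    obtain ⟨X, hX⟩ := EL_back d h hj hj' hne
    have key : EL d l * (d.σ (Equiv.swap i (x i)) * d.σb (Equiv.swap j (y j))) = EL d l := by
      rw [hX, mul_assoc, En_cap d hi.symm hyj.symm]
    have hlt := Equiv.Perm.card_support_swap_mul hi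
    have := ih (Equiv.swap i (x i) * x) (Equiv.swap j (y j) * y) (by omega) ?_ ?_ ?_
    · have e2 := d.comm_σσb x (Equiv.swap j (y j))
      calc EL d l * d.σ x * d.σb y
          = EL d l * (d.σ (Equiv.swap i (x i)) * d.σb (Equiv.swap j (y j))) * d.σ x * d.σb y := by
            rw [key]
        _ = EL d l * d.σ (Equiv.swap i (x i)) * (d.σb (Equiv.swap j (y j)) * d.σ x) * d.σb y := by
            simp only [mul_assoc]
        _ = EL d l * d.σ (Equiv.swap i (x i) * x) * d.σb (Equiv.swap j (y j) * y) := by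
            rw [← e2, map_mul, map_mul]; simp only [mul_assoc]
        _ = EL d l := this
    · intro a ha
      have : x a = a := h1 a ha
      have a1 : a ≠ i := by rintro rfl; exact ha _ hj
      have a2 : a ≠ x i := by rintro rfl; exact ha _ hj'
      simp [this, Equiv.swap_apply_of_ne_of_ne a1 a2]
    · intro a ha
      have : y a = a := h2 a ha
      have a1 : a ≠ j := by rintro rfl; exact ha _ hj
      have a2 : a ≠ y j := by rintro rfl; exact ha _ hj'
      simp [this, Equiv.swap_apply_of_ne_of_ne a1 a2]
    · intro a b hab
      have hab' := h3 a b hab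
      simp only [Equiv.Perm.coe_mul, Function.comp]
      by_cases ha : x a = i
      · have e : (x a, y b) = (i, j) := Mt_inj h hab' hj (Or.inl ha)
        have e2 : y b = j := congrArg Prod.snd e
        rw [ha, e2, Equiv.swap_apply_left, Equiv.swap_apply_left]
        exact hj'
      · have hb : y b ≠ j := fun hb => ha (congrArg Prod.fst (Mt_inj h hab' hj (Or.inr hb)))
        by_cases ha2 : x a = x i
        · have e : (x a, y b) = (x i, y j) := Mt_inj h hab' hj' (Or.inl ha2)
          have e2 : y b = y j := congrArg Prod.snd e
          rw [ha2, e2, Equiv.swap_apply_right, Equiv.swap_apply_right]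
          exact hj
        · have hb2 : y b ≠ y j := fun hb => ha2 (congrArg Prod.fst (Mt_inj h hab' hj' (Or.inr hb)))
          rw [Equiv.swap_apply_of_ne_of_ne ha ha2, Equiv.swap_apply_of_ne_of_ne hb hb2]
          exact hab'

/-- Compatibility of a permutation with diagram data. -/
structure RepD (w : Equiv.Perm (Fin n ⊕ Fin m)) (l : List (Fin n × Fin m))
    (u : Equiv.Perm (Fin n)) (v : Equiv.Perm (Fin m)) : Prop where
  nd : l.Nodup
  mem : ∀ i j, (i, j) ∈ l ↔ w (Sum.inr j) = Sum.inl i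
  C1 : ∀ a i, w (Sum.inl a) = Sum.inl i → u a = i
  C2 : ∀ b b', w (Sum.inr b) = Sum.inr b' → v b' = b
  C3 : ∀ a b', w (Sum.inl a) = Sum.inr b' → w (Sum.inr (v b')) = Sum.inl (u a)

lemma RepD.mt {w : Equiv.Perm (Fin n ⊕ Fin m)} {l u v} (h : RepD w l u v) : Mt l := by
  refine h.nd.imp_of_mem ?_
  rintro ⟨i, j⟩ ⟨i', j'⟩ ha hb hne
  rw [h.mem] at ha hb
  constructor
  · rintro (rfl : i = i')
    apply hne
    have := w.injective (ha.trans hb.symm)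
    simpa using this
  · rintro (rfl : j = j')
    apply hne
    rw [ha] at hb
    simpa using hb

/-- `b` is the diagram of `w`. -/
def Rep (d : WBC R A n m) (w : Equiv.Perm (Fin n ⊕ Fin m)) (b : A) : Prop :=
  ∃ l u v, RepD w l u v ∧ b = EL d l * d.σ u * d.σb v

lemma Rep.unique {d : WBC R A n m} {w : Equiv.Perm (Fin n ⊕ Fin m)} {b b' : A}
    (h : Rep d w b) (h' : Rep d w b') : b = b' := by
  obtain ⟨l, u, v, h, rfl⟩ := h
  obtain ⟨l', u', v', h', rfl⟩ := h'
  have p : l.Perm l' := (List.perm_ext_iff_of_nodup h.nd h'.nd).mpr (by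
    rintro ⟨i, j⟩; rw [h.mem, h'.mem])
  rw [← EL_perm d h.mt p]
  have key := cap_abs d h.mt _ (u * u'⁻¹) (v * v'⁻¹) le_rfl ?_ ?_ ?_
  · conv_rhs => rw [← key]
    simp only [mul_assoc, ← map_mul]
    rw [← mul_assoc (d.σb _), ← d.comm_σσb, mul_assoc, ← map_mul, ← mul_assoc (d.σ _), ← map_mul]
    simp [mul_assoc]
  · intro i hi
    obtain ⟨s, hs⟩ := w.surjective (Sum.inl i)
    rcases s with a | b
    · have h1 := h.C1 a i hs
      have h2 := h'.C1 a i hs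
      rw [← h2] at h1 ⊢
      simpa using h1
    · exact absurd ((h.mem i b).mpr hs) (hi b)
  · intro j hj
    rcases hs : w (Sum.inr j) with i | b
    · exact absurd ((h.mem i j).mpr hs) (hj i)
    · have h1 := h.C2 j b hs
      have h2 := h'.C2 j b hs
      rw [← h2] at h1 ⊢
      simpa using h1
  · intro i j hij
    rw [h.mem] at hij
    rw [h.mem]
    rcases hs : w (Sum.inl (u'⁻¹ i)) with i2 | b
    · have := h'.C1 _ _ hs
      have this : i = i2 := by simpa using this
      subst this
      have := w.injective (hij.trans hs.symm)
      simp at this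
    · have h1 := h.C3 _ _ hs
      have h2 := h'.C3 _ _ hs
      have h2 : w (Sum.inr (v' b)) = Sum.inl i := by simpa using h2
      have h3 := w.injective (hij.trans h2.symm)
      have h4 : j = v' b := by simpa using h3
      subst h4
      simpa using h1

lemma Rep.one (d : WBC R A n m) : Rep d 1 1 :=
  ⟨[], 1, 1, ⟨by simp, by simp, by simp, by simp, by simp⟩, by simp [EL]⟩

lemma Rep.σ {d : WBC R A n m} {w : Equiv.Perm (Fin n ⊕ Fin m)} {b : A} (h : Rep d w b)
    (x : Equiv.Perm (Fin n)) : Rep d (inlP n m x * w) (d.σ x * b) := by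
  obtain ⟨l, u, v, h, rfl⟩ := h
  have hl : ∀ s i, inlP n m x s = Sum.inl i ↔ s = Sum.inl (x⁻¹ i) := by
    intro s i
    rcases s with s | s
    · simp only [inlP_l, Sum.inl.injEq]
      exact Equiv.Perm.eq_inv_iff_eq.symm
    · simp
  have hr : ∀ s j, inlP n m x s = Sum.inr j ↔ s = Sum.inr j := by
    intro s i
    rcases s with s | s <;> simp
  refine ⟨l.map (fun p => (x p.1, p.2)), x * u, v, ⟨?_, ?_, ?_, ?_, ?_⟩, ?_⟩
  · exact h.nd.map (by rintro ⟨a, b⟩ ⟨a', b'⟩; simp)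
  · intro i j
    rw [Equiv.Perm.mul_apply, hl, ← h.mem, List.mem_map]
    constructor
    · rintro ⟨⟨a, b⟩, hab, he⟩
      simp only [Prod.mk.injEq] at he
      obtain ⟨rfl, rfl⟩ := he
      simpa using hab
    · intro h; exact ⟨_, h, by simp⟩
  · intro a i ha
    rw [Equiv.Perm.mul_apply, hl] at ha
    rw [Equiv.Perm.mul_apply, h.C1 _ _ ha]; simp
  · intro b b' hb
    rw [Equiv.Perm.mul_apply, hr] at hb
    exact h.C2 _ _ hb
  · intro a b' hb
    rw [Equiv.Perm.mul_apply, hr] at hb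
    rw [Equiv.Perm.mul_apply, h.C3 _ _ hb]; simp
  · rw [map_mul, ← mul_assoc, ← mul_assoc, ← mul_assoc, EL_σ]

lemma Rep.σb {d : WBC R A n m} {w : Equiv.Perm (Fin n ⊕ Fin m)} {b : A} (h : Rep d w b)
    (x : Equiv.Perm (Fin m)) : Rep d (w * (inrP n m x)⁻¹) (d.σb x * b) := by
  obtain ⟨l, u, v, h, rfl⟩ := h
  rw [← inrP_inv]
  refine ⟨l.map (fun p => (p.1, x p.2)), u, x * v, ⟨?_, ?_, ?_, ?_, ?_⟩, ?_⟩
  · exact h.nd.map (by rintro ⟨a, b⟩ ⟨a', b'⟩; simp)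
  · intro i j
    rw [Equiv.Perm.mul_apply, inrP_r, ← h.mem, List.mem_map]
    constructor
    · rintro ⟨⟨a, b⟩, hab, he⟩
      simp only [Prod.mk.injEq] at he
      obtain ⟨rfl, rfl⟩ := he
      simpa using hab
    · intro h; exact ⟨_, h, by simp⟩
  · intro a i ha
    exact h.C1 _ _ ha
  · intro b b' hb
    rw [Equiv.Perm.mul_apply, inrP_r] at hb
    rw [Equiv.Perm.mul_apply, h.C2 _ _ hb]; simp
  · intro a b' hb
    have := h.C3 _ _ (by simpa using hb)
    simpa using this
  · rw [map_mul, ← mul_assoc, ← mul_assoc, ← mul_assoc, EL_σb, mul_assoc _ (d.σb x),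
      ← d.comm_σσb]
    simp only [mul_assoc]

lemma Rep.E0 {d : WBC R A n m} {w : Equiv.Perm (Fin n ⊕ Fin m)} {b : A} (h : Rep d w b)
    {i j} (hij : w (Sum.inr j) = Sum.inl i) : ∃ X, b = En d i j * X := by
  obtain ⟨l, u, v, h, rfl⟩ := h
  rw [EL_front d h.mt ((h.mem i j).mpr hij)]
  exact ⟨_, by simp only [mul_assoc]; rfl⟩

lemma Rep.E {d : WBC R A n m} {w : Equiv.Perm (Fin n ⊕ Fin m)} {b : A} (h : Rep d w b)
    {i j} (hij : w (Sum.inr j) ≠ Sum.inl i) :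
    Rep d (Equiv.swap (Sum.inl i) (w (Sum.inr j)) * w) (En d i j * b) := by
  rcases hj : w (Sum.inr j) with i2 | b'
  · have hne : i ≠ i2 := by rintro rfl; exact hij hj
    have h1 := h.σ (Equiv.swap i i2)
    rw [inlP_swap] at h1
    convert h1 using 1
    obtain ⟨X, rfl⟩ := h.E0 hj
    rw [← mul_assoc, ← mul_assoc, En_En_l d _ _ _ hne, t_En]
  · obtain ⟨s, hs⟩ := w.surjective (Sum.inl i)
    rcases s with a | j2
    · obtain ⟨l, u, v, h, rfl⟩ := h
      have hv : v b' = j := h.C2 _ _ hj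
      have hu : u a = i := h.C1 _ _ hs
      have L1 : ∀ s, (Equiv.swap (Sum.inl i) (Sum.inr b') * w) s =
          if s = Sum.inl a then Sum.inr b' else if s = Sum.inr j then Sum.inl i else w s := by
        intro s
        rw [Equiv.Perm.mul_apply, Equiv.swap_apply_def, ← hs, ← hj]
        simp only [EmbeddingLike.apply_eq_iff_eq]
      refine ⟨(i, j) :: l, u, v, ⟨?_, ?_, ?_, ?_, ?_⟩, ?_⟩
      · rw [List.nodup_cons]
        refine ⟨fun hm => ?_, h.nd⟩
        rw [h.mem, hj] at hm; simp at hm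
      · intro i' j'
        rw [L1]
        by_cases hjj : j' = j
        · subst hjj
          simp only [List.mem_cons, h.mem, hj, Prod.mk.injEq]
          simp [eq_comm]
        · simp [hjj, h.mem]
      · intro a' i'
        rw [L1]
        by_cases haa : a' = a
        · subst haa; simp
        · simpa [haa] using h.C1 a' i'
      · intro b1 b2
        rw [L1]
        by_cases hb : b1 = j
        · subst hb; simp
        · simpa [hb] using h.C2 b1 b2
      · intro a' b2
        rw [L1, L1]
        by_cases haa : a' = a
        · subst haa
          simp only [if_true, Sum.inr.injEq]
          rintro rfl
          simp [hv, hu]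
        · simp only [Sum.inl.injEq, haa, if_false, reduceCtorEq, Sum.inr.injEq]
          intro h1
          have h2 := h.C3 a' b2 h1
          rw [if_neg]
          · exact h2
          · intro h3
            rw [h3, hj] at h2; simp at h2
      · rw [EL_cons]; simp only [mul_assoc]
    · have hne : j ≠ j2 := by rintro rfl; exact hij hs
      have h1 := h.σb (Equiv.swap j j2)
      rw [inrP_swap, Equiv.swap_inv, Equiv.mul_swap_eq_swap_mul, hs, hj, Equiv.swap_comm] at h1
      convert h1 using 1
      obtain ⟨X, rfl⟩ := h.E0 hs
      rw [← mul_assoc, ← mul_assoc, En_En_r d _ _ _ hne, tb_En]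

lemma Rep.cb {d : WBC R A n m} {w : Equiv.Perm (Fin n ⊕ Fin m)} {b : A} (h : Rep d w b) (j : Fin m) :
    d.cb j * b = Sum.elim (fun i => d.c i * b) (fun j' => b * d.cb j') (w (Sum.inr j)) := by
  rcases hj : w (Sum.inr j) with i | b'
  · obtain ⟨X, rfl⟩ := h.E0 hj
    rw [Sum.elim_inl, ← mul_assoc, ← mul_assoc, c_En]
  · obtain ⟨l, u, v, h, rfl⟩ := h
    have hv : v b' = j := h.C2 _ _ hj
    subst hv
    rw [Sum.elim_inr, ← mul_assoc, ← mul_assoc, EL_cb, mul_assoc _ (d.cb _), ← d.comm_σcb,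
      mul_assoc (EL d l * d.σ u), σb_cb]
    · simp only [mul_assoc]
    · rintro ⟨i, j'⟩ hp rfl
      rw [h.mem, hj] at hp; simp at hp

end reps
end SB8

namespace SB8

section parity
variable {R A : Type} [CommRing R] [Ring A] [Algebra R A] {n m : ℕ}

/-- The data with the odd generators negated. -/
def negW (d : WBC R A n m) : WBC R A n m where
  σ := d.σ
  σb := d.σb
  c i := -d.c i
  cb j := -d.cb j
  e := d.e
  c_sq i := by simpa using d.c_sq i
  c_anti i j h := by simpa using d.c_anti i j h
  c_conj w i := by simpa using d.c_conj w i
  cb_sq i := by simpa using d.cb_sq i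
  cb_anti i j h := by simpa using d.cb_anti i j h
  cb_conj w i := by simpa using d.cb_conj w i
  comm_σσb := d.comm_σσb
  comm_σcb w i := by simpa using d.comm_σcb w i
  comm_σbc w i := by simpa using d.comm_σbc w i
  anti_ccb w i := by simpa using d.anti_ccb w i
  e_c1 h h' := by simpa using d.e_c1 h h'
  c1_e h h' := by simpa using d.c1_e h h'
  e_sq := d.e_sq
  e_s_e := d.e_s_e
  e_sb_e := d.e_sb_e
  s_e_comm := d.s_e_comm
  sb_e_comm := d.sb_e_comm
  braid1 := d.braid1
  braid2 := d.braid2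
  c_e_comm i h := by simpa using d.c_e_comm i h
  cb_e_comm i h := by simpa using d.cb_e_comm i h
  e_c_e h := by simpa using d.e_c_e h
  e_cb_e h := by simpa using d.e_cb_e h

/-- `α` is a parity automorphism. -/
structure IsPar (d : WBC R A n m) (α : A →ₐ[R] A) : Prop where
  hom : WBCHom d (negW d) α
  inv : ∀ b, α (α b) = b

lemma exists_par {d : WBC R A n m} (hu : d.IsUniversal) : ∃ α, IsPar d α := by
  obtain ⟨α, hα, -⟩ := hu A (negW d)
  refine ⟨α, hα, ?_⟩
  obtain ⟨β, -, hβ⟩ := hu A d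
  have h1 := hβ (AlgHom.id R A) ⟨fun _ => rfl, fun _ => rfl, fun _ => rfl, fun _ => rfl, rfl⟩
  have h2 := hβ (α.comp α) ⟨fun w => by simp [hα.map_σ, negW], fun w => by simp [hα.map_σb, negW],
    fun w => by simp [hα.map_c, negW], fun w => by simp [hα.map_cb, negW],
    by simp [hα.map_e, negW]⟩
  intro b
  exact congrArg (fun f : A →ₐ[R] A => f b) (h2.trans h1.symm)

variable {d : WBC R A n m} {α : A →ₐ[R] A} (hα : IsPar d α)
lemma IsPar.σ (hα : IsPar d α) (w) : α (d.σ w) = d.σ w := hα.hom.map_σ w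
lemma IsPar.σb (hα : IsPar d α) (w) : α (d.σb w) = d.σb w := hα.hom.map_σb w
lemma IsPar.c (hα : IsPar d α) (w) : α (d.c w) = -d.c w := hα.hom.map_c w
lemma IsPar.cb (hα : IsPar d α) (w) : α (d.cb w) = -d.cb w := hα.hom.map_cb w
lemma IsPar.e (hα : IsPar d α) : α d.e = d.e := hα.hom.map_e

variable [NeZero n] [NeZero m]
lemma IsPar.En (hα : IsPar d α) (i j) : α (En d i j) = En d i j := by
  obtain ⟨u, v, rfl, rfl⟩ := En_of i j
  rw [En_eq]; simp [tau, hα.σ, hα.σb, hα.e]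

lemma IsPar.rep (hα : IsPar d α) {w b} (h : Rep d w b) : α b = b := by
  obtain ⟨l, u, v, -, rfl⟩ := h
  rw [map_mul, map_mul, hα.σ, hα.σb, EL, map_list_prod, List.map_map]
  have : (α ∘ fun p : Fin n × Fin m => SB8.En d p.1 p.2) = fun p => SB8.En d p.1 p.2 := by
    funext p; exact hα.En _ _
  rw [this]

/-- The Clifford generators acting on the algebra. -/
def lamf (d : WBC R A n m) (α : A →ₐ[R] A) : Fin n ⊕ Fin m → Module.End R A
  | Sum.inl i => LinearMap.mulLeft R (d.c i)
  | Sum.inr j => (LinearMap.mulRight R (d.cb j)) ∘ₗ α.toLinearMap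

@[simp] lemma lamf_l (i b) : lamf d α (Sum.inl i) b = d.c i * b := rfl
@[simp] lemma lamf_r (i b) : lamf d α (Sum.inr i) b = α b * d.cb i := rfl

/-- The Clifford algebra acting on the algebra. -/
def lam (hα : IsPar d α) : Cl R (Fin n ⊕ Fin m) →ₐ[R] Module.End R A :=
  clLift (lamf d α)
    (by
      intro s; ext b
      rcases s with i | j
      · simp [← mul_assoc, d.c_sq]
      · simp [hα.cb, hα.inv, mul_assoc, d.cb_sq])
    (by
      intro s u hsu; ext b
      rcases s with i | i <;> rcases u with j | j
      · have : i ≠ j := by rintro rfl; exact hsu rfl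
        simp [← mul_assoc, d.c_anti i j this]
      · simp [hα.c, mul_assoc]
      · simp [hα.c, mul_assoc]
      · have : j ≠ i := by rintro rfl; exact hsu rfl
        simp [hα.cb, mul_assoc, d.cb_anti j i this])

lemma lam_cc (hα : IsPar d α) (s) : lam hα (cc R s) = lamf d α s := clLift_cc _ _ _ _

lemma lam_int (hα : IsPar d α) (T : Module.End R A)
    (ψ : Cl R (Fin n ⊕ Fin m) →ₐ[R] Cl R (Fin n ⊕ Fin m)) (W : Set (Fin n ⊕ Fin m))
    (h : ∀ s ∉ W, T * lamf d α s = lam hα (ψ (cc R s)) * T) (X) (hX : X ∈ FF R W) :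
    T * lam hα X = lam hα (ψ X) * T := by
  refine Algebra.adjoin_induction (p := fun X _ => T * lam hα X = lam hα (ψ X) * T) ?_ ?_ ?_ ?_ hX
  · rintro _ ⟨s, hs, rfl⟩
    rw [lam_cc]; exact h s hs
  · intro r
    simp only [AlgHom.commutes]
    exact (Algebra.commutes r T).symm
  · intro x y _ _ hx hy
    simp only [map_add, mul_add, add_mul, hx, hy]
  · intro x y _ _ hx hy
    simp only [map_mul]
    rw [← mul_assoc, hx, mul_assoc, hy, mul_assoc]

lemma FF0 (X : Cl R (Fin n ⊕ Fin m)) : X ∈ FF R (∅ : Set (Fin n ⊕ Fin m)) := by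
  have := @cc_adjoin R _ (Fin n ⊕ Fin m) _ _
  rw [FF, Set.compl_empty, Set.image_univ, this]; trivial

lemma lam_σ (hα : IsPar d α) (u X b) : d.σ u * lam hα X b = lam hα (act (inlP n m u) X) (d.σ u * b) := by
  have := lam_int hα (LinearMap.mulLeft R (d.σ u)) (act (inlP n m u)) ∅ (by
    intro s _; ext b
    rw [act_cc, lam_cc]
    rcases s with i | j
    · simp [← mul_assoc, σ_c]
    · simp [hα.σ, mul_assoc]) X (FF0 X)
  exact congrArg (fun f : Module.End R A => f b) this

lemma lam_σb (hα : IsPar d α) (u X b) : d.σb u * lam hα X b = lam hα X (d.σb u * b) := by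
  have := lam_int hα (LinearMap.mulLeft R (d.σb u)) (AlgHom.id R _) ∅ (by
    intro s _; ext b
    rw [AlgHom.id_apply, lam_cc]
    rcases s with i | j
    · simp [← mul_assoc, d.comm_σbc]
    · simp [hα.σb, mul_assoc]) X (FF0 X)
  exact congrArg (fun f : Module.End R A => f b) this

lemma lam_cb (hα : IsPar d α) (j X b) : d.cb j * lam hα X b = lam hα (par X) (d.cb j * b) := by
  have := lam_int hα (LinearMap.mulLeft R (d.cb j)) par ∅ (by
    intro s _; ext b
    rw [par_cc, map_neg, lam_cc]
    rcases s with i | j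
    · simp [← mul_assoc, d.anti_ccb]
    · simp [hα.cb, mul_assoc]) X (FF0 X)
  exact congrArg (fun f : Module.End R A => f b) this

lemma lam_e (hα : IsPar d α) (X b) (hX : X ∈ FF R {(Sum.inl 0 : Fin n ⊕ Fin m)}) :
    d.e * lam hα X b = lam hα X (d.e * b) := by
  have := lam_int hα (LinearMap.mulLeft R d.e) (AlgHom.id R _) {Sum.inl 0} (by
    intro s hs; ext b
    rw [AlgHom.id_apply, lam_cc]
    rcases s with i | j
    · have : (i : ℕ) ≠ 0 := by
        intro h; apply hs; simp only [Set.mem_singleton_iff, Sum.inl.injEq]; exact Fin.ext (by simpa using h)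
      simp [← mul_assoc, d.c_e_comm i this]
    · simp [hα.e, mul_assoc]) X hX
  exact congrArg (fun f : Module.End R A => f b) this

/-- The span of the pairs (formal diagram, diagram). -/
def Gam (hα : IsPar d α) : Submodule R (Mo R (Fin n ⊕ Fin m) × A) :=
  Submodule.span R {p | ∃ w b X, Rep d w b ∧ p = (Finsupp.single w X, lam hα X b)}

lemma Gam_mk (hα : IsPar d α) {w b} (h : Rep d w b) (X) :
    (Finsupp.single w X, lam hα X b) ∈ Gam hα := Submodule.subset_span ⟨w, b, X, h, rfl⟩

open Classical in
/-- Evaluation of formal diagrams. -/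
def gev (hα : IsPar d α) : Mo R (Fin n ⊕ Fin m) →ₗ[R] A :=
  Finsupp.lsum R (fun w => (LinearMap.applyₗ (if h : ∃ b, Rep d w b then h.choose else 0)) ∘ₗ
    (lam hα).toLinearMap)

lemma Gam_eq (hα : IsPar d α) {p} (hp : p ∈ Gam hα) : p.2 = gev hα p.1 := by
  refine Submodule.span_induction (p := fun p _ => p.2 = gev hα p.1) ?_ ?_ ?_ ?_ hp
  · rintro _ ⟨w, b, X, h, rfl⟩
    have hex : ∃ b, Rep d w b := ⟨b, h⟩
    have : hex.choose = b := hex.choose_spec.unique h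
    simp only [gev, Finsupp.lsum_single, LinearMap.comp_apply, LinearMap.applyₗ_apply_apply,
      dif_pos hex, this]
    rfl
  · simp
  · intro x y _ _ hx hy
    simp [hx, hy]
  · intro a x _ hx
    simp [hx]

/-- Stability of the span. -/
def Stab (hα : IsPar d α) (z : A) (T : EM R n m) : Prop :=
  ∀ w b X, Rep d w b → (T (Finsupp.single w X), z * lam hα X b) ∈ Gam hα

lemma Stab.all {hα : IsPar d α} {z : A} {T : EM R n m} (h : Stab hα z T) {p} (hp : p ∈ Gam hα) :
    (T p.1, z * p.2) ∈ Gam hα := by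
  refine Submodule.span_induction (p := fun p _ => (T p.1, z * p.2) ∈ Gam hα) ?_ ?_ ?_ ?_ hp
  · rintro _ ⟨w, b, X, hw, rfl⟩
    exact h w b X hw
  · simp only [Prod.fst_zero, Prod.snd_zero, map_zero, mul_zero]; exact zero_mem (Gam hα)
  · intro x y _ _ hx hy
    simpa [mul_add] using add_mem hx hy
  · intro a x _ hx
    simpa using Submodule.smul_mem _ a hx

lemma stab_σ (hα : IsPar d α) (u) : Stab hα (d.σ u) (Lp (inlP n m u)) := by
  intro w b X h
  rw [Lp_s, lam_σ]
  exact Gam_mk hα (h.σ u) _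

lemma stab_σb (hα : IsPar d α) (u) : Stab hα (d.σb u) (Rp (inrP n m u)) := by
  intro w b X h
  rw [Rp_s, lam_σb]
  exact Gam_mk hα (h.σb u) _

lemma stab_c (hα : IsPar d α) (i) : Stab hα (d.c i) (Lc (Sum.inl i)) := by
  intro w b X h
  have : d.c i * lam hα X b = lam hα (cc R (Sum.inl i) * X) b := by
    rw [map_mul, lam_cc]; rfl
  rw [Lc_s, this]
  exact Gam_mk hα h _

lemma lam_w (hα : IsPar d α) {w b} (h : Rep d w b) (j) :
    d.cb j * b = lam hα (cc R (w (Sum.inr j))) b := by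
  rw [h.cb j, lam_cc]
  rcases w (Sum.inr j) with i | j'
  · rfl
  · simp [hα.rep h]

lemma stab_cb (hα : IsPar d α) (j) : Stab hα (d.cb j) (Rc (Sum.inr j)) := by
  intro w b X h
  rw [Rc_s, lam_cb, lam_w hα h, ← Module.End.mul_apply, ← map_mul]
  exact Gam_mk hα h _

lemma e_c0 (d : WBC R A n m) : d.e * d.c 0 = d.e * d.cb 0 := d.e_c1 (NeZero.pos n) (NeZero.pos m)

lemma stab_e (hα : IsPar d α) : Stab hα d.e (ee (Sum.inl 0) (Sum.inr 0)) := by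
  intro w b X h
  obtain ⟨x, hx, y, hy, rfl⟩ := decomp1 (Sum.inl 0 : Fin n ⊕ Fin m) X
  have e1 : d.e * lam hα (x + y * cc R (Sum.inl 0)) b =
      lam hα x (d.e * b) + lam hα y (d.e * (d.c 0 * b)) := by
    rw [map_add, map_mul, LinearMap.add_apply, mul_add, lam_e hα x b hx, Module.End.mul_apply,
      lam_e hα y _ hy, lam_cc]; rfl
  rw [e1]
  by_cases hw : w (Sum.inr 0) = Sum.inl 0
  · rw [ee_0 _ hw]
    obtain ⟨X, rfl⟩ := h.E0 hw
    have h1 := En_sq d 0 0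
    have h2 := En_c_En d 0 0
    rw [En_zero] at *
    rw [← mul_assoc, h1, ← mul_assoc, ← mul_assoc, h2]
    simp only [zero_mul, map_zero, add_zero]; exact zero_mem (Gam hα)
  · rw [ee_1 _ hw, th_decomp (T := {Sum.inl 0}) _ (by simp) hx hy]
    have h3 := h.E hw
    rw [En_zero] at h3
    convert Gam_mk hα h3 _ using 2
    rw [← mul_assoc, e_c0, mul_assoc, lam_w hα h, lam_e hα _ _ (cc_mem (by simpa using hw)),
      map_add, map_mul (lam hα)]
    rfl

end parity
end SB8

namespace SB8

section low
variable {R A : Type} [CommRing R] [Ring A] [Algebra R A] {n m : ℕ} [NeZero n] [NeZero m]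

/-- Indices below `k`. -/
def below (n k : ℕ) : Finset (Fin n) := Finset.univ.filter (fun i => i.val < k)

@[simp] lemma mem_below {n k : ℕ} (i : Fin n) : i ∈ below n k ↔ i.val < k := by simp [below]

/-- A generating set of the lower subalgebra. -/
def lowSet (d : WBC R A n m) (k : ℕ) : Set A :=
  {x | x = d.e ∨ (∃ u : Equiv.Perm (Fin n), (∀ i : Fin n, k ≤ i.val → u i = i) ∧ x = d.σ u) ∨
    (∃ v : Equiv.Perm (Fin m), (∀ i : Fin m, k ≤ i.val → v i = i) ∧ x = d.σb v) ∨
    x = d.c 0 ∨ x = d.cb 0}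

/-- The lower subalgebra. -/
def Alow (d : WBC R A n m) (k : ℕ) : Subalgebra R A := Algebra.adjoin R (lowSet d k)

lemma sw_fix {n a b : ℕ} (i : Fin n) (ha : i.val ≠ a) (hb : i.val ≠ b) : sw n a b i = i := by
  unfold sw
  split_ifs with h
  · exact Equiv.swap_apply_of_ne_of_ne (fun h => ha (congrArg Fin.val h))
      (fun h => hb (congrArg Fin.val h))
  · rfl

lemma cn_eq (d : WBC R A n m) (i : Fin n) (l : ℕ) (h : l = i.val + 1) : d.cn l = d.c i := by
  subst h
  unfold WBC.cn
  rw [dif_pos (by simp)]; congr 1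

lemma cbn_eq (d : WBC R A n m) (i : Fin m) (l : ℕ) (h : l = i.val + 1) : d.cbn l = d.cb i := by
  subst h
  unfold WBC.cbn
  rw [dif_pos (by simp)]; congr 1

lemma lowerGens_sub (d : WBC R A n m) (k : ℕ) : Algebra.adjoin R (d.lowerGens k) ≤ Alow d k := by
  apply Algebra.adjoin_mono
  rintro x (⟨-, rfl⟩ | ⟨j, h1, h2, rfl⟩ | ⟨j, h1, h2, rfl⟩ | ⟨-, rfl⟩ | ⟨-, rfl⟩)
  · exact Or.inl rfl
  · exact Or.inr (Or.inl ⟨_, fun i hi => sw_fix i (by omega) (by omega), rfl⟩)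
  · exact Or.inr (Or.inr (Or.inl ⟨_, fun i hi => sw_fix i (by omega) (by omega), rfl⟩))
  · exact Or.inr (Or.inr (Or.inr (Or.inl (cn_eq d 0 1 (by simp)))))
  · exact Or.inr (Or.inr (Or.inr (Or.inr (cbn_eq d 0 1 (by simp)))))

/-- Induction principle for the lower algebra. -/
lemma low_ind (d : WBC R A n m) (k : ℕ) {P : A → Prop} (he : P d.e)
    (hσ : ∀ u : Equiv.Perm (Fin n), (∀ i : Fin n, k ≤ i.val → u i = i) → P (d.σ u))
    (hσb : ∀ v : Equiv.Perm (Fin m), (∀ i : Fin m, k ≤ i.val → v i = i) → P (d.σb v))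
    (hc : P (d.c 0)) (hcb : P (d.cb 0)) (hr : ∀ r : R, P (algebraMap R A r))
    (hadd : ∀ x y, P x → P y → P (x + y)) (hmul : ∀ x y, P x → P y → P (x * y)) {Z : A}
    (hZ : Z ∈ Alow d k) : P Z := by
  refine Algebra.adjoin_induction (p := fun Z _ => P Z) ?_ hr (fun x y _ _ => hadd x y)
    (fun x y _ _ => hmul x y) hZ
  rintro x (rfl | ⟨u, hu, rfl⟩ | ⟨u, hu, rfl⟩ | rfl | rfl)
  · exact he
  · exact hσ u hu
  · exact hσb u hu
  · exact hc
  · exact hcb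

lemma low_comm (d : WBC R A n m) (k : ℕ) {z : A} (he : Commute d.e z)
    (hσ : ∀ u : Equiv.Perm (Fin n), (∀ i : Fin n, k ≤ i.val → u i = i) → Commute (d.σ u) z)
    (hσb : ∀ v : Equiv.Perm (Fin m), (∀ i : Fin m, k ≤ i.val → v i = i) → Commute (d.σb v) z)
    (hc : Commute (d.c 0) z) (hcb : Commute (d.cb 0) z) {Z : A} (hZ : Z ∈ Alow d k) : Commute Z z :=
  low_ind d k (P := fun Z => Commute Z z) he hσ hσb hc hcb (fun r => Algebra.commutes r z)
    (fun _ _ => Commute.add_left) (fun _ _ => Commute.mul_left) hZ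

lemma rep_En (i : Fin n) (j : Fin m) :
    En (repWBC R (n := n) (m := m)) i j = ee (Sum.inl i) (Sum.inr j) := by
  obtain ⟨u, v, rfl, rfl⟩ := En_of i j
  rw [En_eq]
  change Lp (inlP n m u) * Rp (inrP n m v) * ee (Sum.inl 0) (Sum.inr 0) *
    (Lp (inlP n m u⁻¹) * Rp (inrP n m v⁻¹)) = _
  rw [mul_assoc (Lp _) (Rp _) (ee _ _), Rp_ee, ← mul_assoc (Lp _) (ee _ _), Lp_ee, inlP_l, inrP_r, mul_assoc, mul_assoc]
  rw [← mul_assoc (Rp _), ← Lp_Rp, mul_assoc, ← Rp_mul, ← mul_assoc (Lp _), ← Lp_mul, ← inlP_mul, ← inrP_mul]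
  simp [inlP_one, inrP_one, Lp_one, Rp_one]

lemma hom_En {d : WBC R A n m} {B : Type} [Ring B] [Algebra R B] {d' : WBC R B n m} {φ : A →ₐ[R] B}
    (h : WBCHom d d' φ) (i j) : φ (En d i j) = En d' i j := by
  obtain ⟨u, v, rfl, rfl⟩ := En_of i j
  rw [En_eq, En_eq]; simp [tau, h.map_σ, h.map_σb, h.map_e]

lemma low_unique {d : WBC R A n m} (hu : d.IsUniversal) {k : ℕ} (hk : 1 ≤ k) {p : Fin n} {q : Fin m}
    (hp : p.val = k) (hq : q.val = k) {Z : A} (hZ : Z ∈ Alow d k) (h0 : Z * En d p q = 0) : Z = 0 := by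
  obtain ⟨α, hα⟩ := exists_par hu
  obtain ⟨ρ, hρ, -⟩ := hu (EM R n m) (repWBC R)
  let τ : Equiv.Perm (Fin n ⊕ Fin m) := Equiv.swap (Sum.inl p) (Sum.inr q)
  have hq0 : q ≠ 0 := by rintro rfl; simp at hq; omega
  have fixr : ∀ j, j ≠ q → τ (Sum.inr j) = Sum.inr j := fun j hj =>
    Equiv.swap_apply_of_ne_of_ne (by simp) (by simpa using hj)
  have key : Stab hα Z (ρ Z) ∧ Commute (ρ Z) (Rp τ) := by
    refine low_ind d k (P := fun Z => Stab hα Z (ρ Z) ∧ Commute (ρ Z) (Rp τ)) ?_ ?_ ?_ ?_ ?_ ?_ ?_ ?_ hZ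
    · rw [hρ.map_e]
      refine ⟨stab_e hα, ?_⟩
      have := Rp_ee (R := R) τ (Sum.inl 0 : Fin n ⊕ Fin m) (Sum.inr 0)
      rw [fixr 0 hq0.symm] at this
      exact this.symm
    · intro u _
      rw [hρ.map_σ]
      exact ⟨stab_σ hα u, Lp_Rp _ _⟩
    · intro v hv
      rw [hρ.map_σb]
      refine ⟨stab_σb hα v, ?_⟩
      change Rp _ * Rp _ = Rp _ * Rp _
      rw [← Rp_mul, ← Rp_mul]
      congr 1
      rw [Equiv.mul_swap_eq_swap_mul, inrP_l, inrP_r, hv q hq.ge]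
    · rw [hρ.map_c]
      exact ⟨stab_c hα 0, (Rp_Lc _ _).symm⟩
    · rw [hρ.map_cb]
      refine ⟨stab_cb hα 0, ?_⟩
      have := Rp_Rc (R := R) τ (Sum.inr 0 : Fin n ⊕ Fin m)
      rw [fixr 0 hq0.symm] at this
      change Rc _ * Rp _ = Rp _ * Rc _
      conv_lhs => rw [← this]
      rw [mul_assoc, ← Rp_mul]; simp [Rp_one]
    · intro r
      rw [AlgHom.commutes]
      refine ⟨?_, Algebra.commutes r _⟩
      intro w b X h
      have := (Gam hα).smul_mem r (Gam_mk hα h X)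
      rw [← Algebra.smul_def]
      exact this
    · rintro x y ⟨hx, hx'⟩ ⟨hy, hy'⟩
      rw [map_add]
      refine ⟨fun w b X h => ?_, hx'.add_left hy'⟩
      have := add_mem (hx w b X h) (hy w b X h)
      rw [add_mul]; exact this
    · rintro x y ⟨hx, hx'⟩ ⟨hy, hy'⟩
      rw [map_mul]
      refine ⟨fun w b X h => ?_, hx'.mul_left hy'⟩
      have := hx.all (hy w b X h)
      rw [mul_assoc]; exact this
  obtain ⟨h1, h2⟩ := key
  have h3 := Gam_eq hα (h1 1 1 1 (Rep.one d))
  simp only [map_one, Module.End.one_apply, mul_one] at h3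
  have h4 : ρ Z * ee (Sum.inl p) (Sum.inr q) = 0 := by
    rw [← rep_En, ← hom_En hρ, ← map_mul, h0, map_zero]
  have h5 := congrArg (fun f : EM R n m => f (Finsupp.single 1 1)) h4
  simp only [Module.End.mul_apply, LinearMap.zero_apply] at h5
  rw [ee_1 _ (by simp), th_F (T := {Sum.inl p}) _ (by simp) (one_mem _)] at h5
  have h6 : (Finsupp.single (Equiv.swap (Sum.inl p) ((1 : Equiv.Perm (Fin n ⊕ Fin m)) (Sum.inr q)) * 1) 1 :
      Mo R (Fin n ⊕ Fin m)) = Rp τ (Finsupp.single 1 1) := by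
    rw [Rp_s]; simp [τ]
  rw [h6, ← Module.End.mul_apply, h2.eq, Module.End.mul_apply] at h5
  have h7 := congrArg (Rp τ⁻¹) h5
  rw [← Module.End.mul_apply, ← Rp_mul, inv_mul_cancel, Rp_one, Module.End.one_apply, map_zero] at h7
  rw [h3, h7, map_zero]

variable {d : WBC R A n m} {k : ℕ} {Z : A}

lemma par_low {α : A →ₐ[R] A} (hα : IsPar d α) (hZ : Z ∈ Alow d k) : α Z ∈ Alow d k := by
  have sub : ∀ x ∈ lowSet d k, x ∈ Alow d k := fun x hx => Algebra.subset_adjoin hx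
  refine low_ind d k (P := fun Z => α Z ∈ Alow d k) ?_ ?_ ?_ ?_ ?_ ?_ ?_ ?_ hZ
  · rw [hα.e]; exact sub _ (Or.inl rfl)
  · intro u hu; rw [hα.σ]; exact sub _ (Or.inr (Or.inl ⟨u, hu, rfl⟩))
  · intro u hu; rw [hα.σb]; exact sub _ (Or.inr (Or.inr (Or.inl ⟨u, hu, rfl⟩)))
  · rw [hα.c]; exact neg_mem (sub _ (Or.inr (Or.inr (Or.inr (Or.inl rfl)))))
  · rw [hα.cb]; exact neg_mem (sub _ (Or.inr (Or.inr (Or.inr (Or.inr rfl)))))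
  · intro r; rw [AlgHom.commutes]; exact Subalgebra.algebraMap_mem _ r
  · intro x y hx hy; rw [map_add]; exact add_mem hx hy
  · intro x y hx hy; rw [map_mul]; exact mul_mem hx hy

lemma low_c {α : A →ₐ[R] A} (hα : IsPar d α) (hk : 1 ≤ k) {i : Fin n} (hi : k ≤ i.val)
    (hZ : Z ∈ Alow d k) : d.c i * Z = α Z * d.c i := by
  have h0 : i ≠ 0 := by rintro rfl; simp at hi; omega
  refine low_ind d k (P := fun Z => d.c i * Z = α Z * d.c i) ?_ ?_ ?_ ?_ ?_ ?_ ?_ ?_ hZ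
  · rw [hα.e]; exact d.c_e_comm i (by omega)
  · intro u hu; rw [hα.σ, σ_c, hu i hi]
  · intro u hu; rw [hα.σb]; exact (d.comm_σbc u i).symm
  · rw [hα.c, neg_mul]; exact d.c_anti _ _ h0
  · rw [hα.cb, neg_mul]; exact d.anti_ccb _ _
  · intro r; rw [AlgHom.commutes]; exact (Algebra.commutes r _).symm
  · intro x y hx hy; rw [map_add, mul_add, add_mul, hx, hy]
  · intro x y hx hy; rw [map_mul, ← mul_assoc, hx, mul_assoc, hy, mul_assoc]

lemma low_cb {α : A →ₐ[R] A} (hα : IsPar d α) (hk : 1 ≤ k) {i : Fin m} (hi : k ≤ i.val)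
    (hZ : Z ∈ Alow d k) : d.cb i * Z = α Z * d.cb i := by
  have h0 : i ≠ 0 := by rintro rfl; simp at hi; omega
  refine low_ind d k (P := fun Z => d.cb i * Z = α Z * d.cb i) ?_ ?_ ?_ ?_ ?_ ?_ ?_ ?_ hZ
  · rw [hα.e]; exact d.cb_e_comm i (by omega)
  · intro u hu; rw [hα.σ]; exact (d.comm_σcb u i).symm
  · intro u hu; rw [hα.σb, σb_cb, hu i hi]
  · rw [hα.c, neg_mul, d.anti_ccb, neg_neg]
  · rw [hα.cb, neg_mul]; exact d.cb_anti _ _ h0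
  · intro r; rw [AlgHom.commutes]; exact (Algebra.commutes r _).symm
  · intro x y hx hy; rw [map_add, mul_add, add_mul, hx, hy]
  · intro x y hx hy; rw [map_mul, ← mul_assoc, hx, mul_assoc, hy, mul_assoc]

/-- Permutations with disjoint supports. -/
lemma perm_comm {N : ℕ} {u w : Equiv.Perm (Fin N)} (hu : ∀ i : Fin N, k ≤ i.val → u i = i)
    (hw : ∀ i : Fin N, i.val < k → w i = i) : u * w = w * u := by
  have : Equiv.Perm.Disjoint u w := by
    intro i
    rcases lt_or_ge i.val k with h | h
    · exact Or.inr (hw i h)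
    · exact Or.inl (hu i h)
  exact this.commute.eq

lemma low_σ (hk : 1 ≤ k) (hZ : Z ∈ Alow d k) {w : Equiv.Perm (Fin n)}
    (hw : ∀ i : Fin n, i.val < k → w i = i) : Commute Z (d.σ w) := by
  refine low_comm d k ?_ ?_ ?_ ?_ ?_ hZ
  · exact ((e_comm_σ d w (hw 0 (by simp; omega)))).symm
  · intro u hu
    change _ * _ = _ * _
    rw [← map_mul, ← map_mul, perm_comm hu hw]
  · intro u hu; exact (d.comm_σσb w u).symm
  · have := σ_c d w 0
    rw [hw 0 (by simp; omega)] at this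
    exact this.symm
  · exact (d.comm_σcb w 0).symm

lemma low_σb (hk : 1 ≤ k) (hZ : Z ∈ Alow d k) {w : Equiv.Perm (Fin m)}
    (hw : ∀ i : Fin m, i.val < k → w i = i) : Commute Z (d.σb w) := by
  refine low_comm d k ?_ ?_ ?_ ?_ ?_ hZ
  · exact ((e_comm_σb d w (hw 0 (by simp; omega)))).symm
  · intro u hu; exact (d.comm_σσb u w)
  · intro u hu
    change _ * _ = _ * _
    rw [← map_mul, ← map_mul, perm_comm hu hw]
  · exact (d.comm_σbc w 0).symm
  · have := σb_cb d w 0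
    rw [hw 0 (by simp; omega)] at this
    exact this.symm

lemma low_E (hk : 1 ≤ k) (hZ : Z ∈ Alow d k) {p : Fin n} {q : Fin m} (hp : k ≤ p.val)
    (hq : k ≤ q.val) : Commute Z (En d p q) := by
  have hp0 : (0 : Fin n) ≠ p := by rintro rfl; simp at hp; omega
  have hq0 : (0 : Fin m) ≠ q := by rintro rfl; simp at hq; omega
  refine low_comm d k ?_ ?_ ?_ ?_ ?_ hZ
  · have := En_comm d (i := 0) (j := 0) (i' := p) (j' := q) hp0 hq0
    rw [En_zero] at this; exact this
  · intro u hu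
    have := σ_En d u p q
    rw [hu p hp] at this; exact this
  · intro u hu
    have := σb_En d u p q
    rw [hu q hq] at this; exact this
  · exact c_En_comm d _ _ _ hp0
  · exact cb_En_comm d _ _ _ hq0

lemma low_Y (hk : 1 ≤ k) (hZ : Z ∈ Alow d k) {p : Fin n} (hp : p.val = k) :
    Commute Z ((gen d).Y p (below n k) (below m k)) := by
  have hp0 : (0 : Fin n) ≠ p := by rintro rfl; simp at hp; omega
  have hpI : p ∉ below n k := by simp [hp]
  have st : ∀ {N : ℕ} {u : Equiv.Perm (Fin N)}, (∀ i : Fin N, k ≤ i.val → u i = i) →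
      ∀ i ∈ below N k, u i ∈ below N k := by
    intro N u hu i hi
    by_contra h
    rw [mem_below, not_lt] at h
    have := u.injective (hu _ h)
    rw [this] at h
    rw [mem_below] at hi; omega
  refine low_comm d k ?_ ?_ ?_ ?_ ?_ hZ
  · have := (gen d).comm_E_Y_in (a := 0) (b := 0) (q := p) (I := below n k) (J := below m k) hpI
      (by simp; omega) (by simp; omega)
    change Commute (En d 0 0) _ at this
    rwa [En_zero] at this
  · intro u hu; exact (gen d).comm_σ_Y _ (hu p hp.ge) (st hu)
  · intro u hu; exact (gen d).comm_σb_Y _ _ (st hu)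
  · exact (gen d).comm_c_Y _ hp0 hpI
  · exact (gen d).comm_cb_Y _ _ _ _

lemma low_Yb (hk : 1 ≤ k) (hZ : Z ∈ Alow d k) {q : Fin m} (hq : q.val = k) :
    Commute Z ((gen d).flip.Y q (below m k) (below n k)) := by
  have hp0 : (0 : Fin m) ≠ q := by rintro rfl; simp at hq; omega
  have hpI : q ∉ below m k := by simp [hq]
  have st : ∀ {N : ℕ} {u : Equiv.Perm (Fin N)}, (∀ i : Fin N, k ≤ i.val → u i = i) →
      ∀ i ∈ below N k, u i ∈ below N k := by
    intro N u hu i hi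
    by_contra h
    rw [mem_below, not_lt] at h
    have := u.injective (hu _ h)
    rw [this] at h
    rw [mem_below] at hi; omega
  refine low_comm d k ?_ ?_ ?_ ?_ ?_ hZ
  · have := (gen d).flip.comm_E_Y_in (a := 0) (b := 0) (q := q) (I := below m k) (J := below n k) hpI
      (by simp; omega) (by simp; omega)
    change Commute (En d 0 0) _ at this
    rwa [En_zero] at this
  · intro u hu; exact (gen d).flip.comm_σb_Y _ _ (st hu)
  · intro u hu; exact (gen d).flip.comm_σ_Y _ (hu q hq.ge) (st hu)
  · exact (gen d).flip.comm_cb_Y _ _ _ _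
  · exact (gen d).flip.comm_c_Y _ hp0 hpI

end low
end SB8

namespace SB8

section shift

/-- The shift `Σ_r → Σ_{r+k}`. -/
def sh (r k : ℕ) : Equiv.Perm (Fin r) →* Equiv.Perm (Fin (r + k)) :=
  Equiv.Perm.viaEmbeddingHom (Fin.addNatEmb k)

lemma sh_app {r k : ℕ} (w : Equiv.Perm (Fin r)) (i : Fin r) : sh r k w (i.addNat k) = (w i).addNat k :=
  Equiv.Perm.viaEmbedding_apply w (Fin.addNatEmb k) i

lemma sh_low {r k : ℕ} (w : Equiv.Perm (Fin r)) (i : Fin (r + k)) (hi : i.val < k) : sh r k w i = i := by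
  apply Equiv.Perm.viaEmbedding_apply_of_notMem w (Fin.addNatEmb k)
  rintro ⟨j, rfl⟩
  simp at hi

lemma addNat_ne {r : ℕ} (k : ℕ) {i j : Fin r} (h : i ≠ j) : i.addNat k ≠ j.addNat k :=
  fun h' => h ((Fin.addNatEmb k).injective h')

lemma sh_swap {r k : ℕ} (i j : Fin r) : sh r k (Equiv.swap i j) = Equiv.swap (i.addNat k) (j.addNat k) := by
  ext1 x
  rcases lt_or_ge x.val k with h | h
  · rw [sh_low _ _ h, Equiv.swap_apply_of_ne_of_ne]
    · rintro rfl; simp at h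
    · rintro rfl; simp at h
  · obtain ⟨y, rfl⟩ : ∃ y : Fin r, x = y.addNat k :=
      ⟨⟨x.val - k, by omega⟩, Fin.ext (by simp; omega)⟩
    rw [sh_app]
    by_cases h1 : y = i
    · subst h1; simp
    by_cases h2 : y = j
    · subst h2; simp
    rw [Equiv.swap_apply_of_ne_of_ne h1 h2,
      Equiv.swap_apply_of_ne_of_ne (addNat_ne k h1) (addNat_ne k h2)]

variable {R A : Type} [CommRing R] [Ring A] [Algebra R A]

section braid
variable {n m : ℕ} [NeZero n] [NeZero m] (d : WBC R A n m)
lemma braidA {i i' : Fin n} {j j' : Fin m} (hi : i ≠ i') (hj : j ≠ j') :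
    En d i j * d.σ (Equiv.swap i i') * d.σb (Equiv.swap j j') * En d i j * d.σ (Equiv.swap i i') =
    En d i j * d.σ (Equiv.swap i i') * d.σb (Equiv.swap j j') * En d i j * d.σb (Equiv.swap j j') := by
  rw [← (En_pair d hi hj).1]
  conv_rhs => rw [← En_cap d hi hj]
  rw [mul_assoc _ (_ * _) (d.σb _), mul_assoc (d.σ _), tb_sq, mul_one]

lemma braidB {i i' : Fin n} {j j' : Fin m} (hi : i ≠ i') (hj : j ≠ j') :
    d.σ (Equiv.swap i i') * En d i j * d.σ (Equiv.swap i i') * d.σb (Equiv.swap j j') * En d i j =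
    d.σb (Equiv.swap j j') * En d i j * d.σ (Equiv.swap i i') * d.σb (Equiv.swap j j') * En d i j := by
  have h1 := (En_pair d hi hj).1
  have h2 := En_cap d hi hj
  have h3 : d.σ (Equiv.swap i i') * d.σb (Equiv.swap j j') * (En d i j * En d i' j') =
      En d i j * En d i' j' := by
    rw [mul_assoc, ← mul_assoc (d.σb _), σb_En, mul_assoc, σb_En, ← mul_assoc, σ_En]
    simp only [Equiv.swap_apply_left, Equiv.swap_apply_right]
    rw [mul_assoc, ← mul_assoc (d.σ _), σ_En]
    simp only [Equiv.swap_apply_left, Equiv.swap_apply_right]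
    rw [mul_assoc, ← mul_assoc, ← En_comm d hi hj, h2]
  have h4 : d.σ (Equiv.swap i i') * (En d i j * En d i' j') =
      d.σb (Equiv.swap j j') * (En d i j * En d i' j') := by
    conv_lhs => rw [← h3]
    rw [← mul_assoc, ← mul_assoc (d.σ _) (d.σ _), t_sq, one_mul]
  rw [h1] at h4
  simpa only [mul_assoc] using h4
end braid

variable {r t k : ℕ} [NeZero r] [NeZero t]

lemma sw01 (h : 1 < r) : sw r 0 1 = Equiv.swap 0 ⟨1, h⟩ := by
  rw [sw_eq r (by omega) h, fin0]

lemma ne01 (h : 1 < r) : (0 : Fin r) ≠ ⟨1, h⟩ := by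
  intro h; have := congrArg Fin.val h; simp at this

/-- The shifted data. -/
def shW (d : WBC R A (r + k) (t + k)) : WBC R A r t where
  σ := d.σ.comp (sh r k)
  σb := d.σb.comp (sh t k)
  c i := d.c (i.addNat k)
  cb i := d.cb (i.addNat k)
  e := En d ((0 : Fin r).addNat k) ((0 : Fin t).addNat k)
  c_sq _ := d.c_sq _
  c_anti _ _ h := d.c_anti _ _ (addNat_ne k h)
  c_conj w i := by
    have := d.c_conj (sh r k w) (i.addNat k)
    rw [sh_app] at this
    simpa using this
  cb_sq _ := d.cb_sq _
  cb_anti _ _ h := d.cb_anti _ _ (addNat_ne k h)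
  cb_conj w i := by
    have := d.cb_conj (sh t k w) (i.addNat k)
    rw [sh_app] at this
    simpa using this
  comm_σσb _ _ := d.comm_σσb _ _
  comm_σcb _ _ := d.comm_σcb _ _
  comm_σbc _ _ := d.comm_σbc _ _
  anti_ccb _ _ := d.anti_ccb _ _
  e_c1 h h' := by rw [fin0, fin0]; exact En_c d _ _
  c1_e h h' := by rw [fin0, fin0]; exact c_En d _ _
  e_sq := En_sq d _ _
  e_s_e h := by
    rw [sw01 h, MonoidHom.comp_apply, sh_swap]
    exact En_t_En d _ _ _ (addNat_ne k (ne01 h))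
  e_sb_e h := by
    rw [sw01 h, MonoidHom.comp_apply, sh_swap]
    exact En_tb_En d _ _ _ (addNat_ne k (ne01 h))
  s_e_comm i h1 h2 := by
    have := σ_En d (sh r k (sw r i (i + 1))) ((0 : Fin r).addNat k) ((0 : Fin t).addNat k)
    rw [sh_app, sw_fix (0 : Fin r) (by simp; omega) (by simp)] at this
    exact this
  sb_e_comm i h1 h2 := by
    have := σb_En d (sh t k (sw t i (i + 1))) ((0 : Fin r).addNat k) ((0 : Fin t).addNat k)
    rw [sh_app, sw_fix (0 : Fin t) (by simp; omega) (by simp)] at this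
    exact this
  braid1 h h' := by
    rw [sw01 h, sw01 h', MonoidHom.comp_apply, MonoidHom.comp_apply, sh_swap, sh_swap]
    exact braidA d (addNat_ne k (ne01 h)) (addNat_ne k (ne01 h'))
  braid2 h h' := by
    rw [sw01 h, sw01 h', MonoidHom.comp_apply, MonoidHom.comp_apply, sh_swap, sh_swap]
    exact braidB d (addNat_ne k (ne01 h)) (addNat_ne k (ne01 h'))
  c_e_comm i hi := c_En_comm d _ _ _ (addNat_ne k (by rintro rfl; simp at hi))
  cb_e_comm i hi := cb_En_comm d _ _ _ (addNat_ne k (by rintro rfl; simp at hi))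
  e_c_e h := by rw [fin0]; exact En_c_En d _ _
  e_cb_e h := by rw [fin0]; exact En_cb_En d _ _

end shift

section links
variable {R A : Type} [CommRing R] [Ring A] [Algebra R A]
variable {n m : ℕ} [NeZero n] [NeZero m] (d : WBC R A n m)

lemma E_link (i : Fin n) (j : Fin m) (a b : ℕ) (ha : a = i.val + 1) (hb : b = j.val + 1) :
    d.E a b = En d i j := by
  subst ha hb
  have h := En_eq d (Equiv.swap 0 i) (Equiv.swap 0 j)
  rw [Equiv.swap_apply_left, Equiv.swap_apply_left] at h
  rw [h]
  have s1 : sw n 0 i.val = Equiv.swap 0 i := by rw [sw_eq n (NeZero.pos n) i.2, fin0]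
  have s2 : sw m 0 j.val = Equiv.swap 0 j := by rw [sw_eq m (NeZero.pos m) j.2, fin0]
  simp only [WBC.E, WBC.tr, WBC.trb, Nat.sub_self, Nat.add_sub_cancel, s1, s2, tau, Equiv.swap_inv]
  rw [← d.comm_σσb]
  simp only [mul_assoc]

lemma sum_link {N k : ℕ} (hk : k ≤ N) (f : ℕ → A) :
    ∑ j ∈ Finset.Ico 1 (k + 1), f j = ∑ i ∈ below N k, f (i.val + 1) := by
  symm
  apply Finset.sum_bij (fun (i : Fin N) _ => i.val + 1)
  · intro i hi; simp at hi ⊢; omega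
  · intro i _ j _ h; exact Fin.ext (by omega)
  · intro b hb; simp at hb; exact ⟨⟨b - 1, by omega⟩, by simp; omega, by simp; omega⟩
  · intros; rfl

lemma y_link {k : ℕ} (p : Fin n) (hp : p.val = k) (hkm : k ≤ m) :
    d.y (k + 1) = (gen d).Y p (below n k) (below m k) := by
  have hkn : k ≤ n := by have := p.2; omega
  rw [WBC.y, WBC.L, WBC.LL, sum_link hkm, sum_link hkn, Gen.Y]
  congr 1
  · apply Finset.sum_congr rfl
    intro j _
    rw [WBC.Eb, E_link d p j _ _ (by omega) rfl, cn_eq d p _ (by omega), Gen.F, Gen.sy, one_mul]; rfl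
  · simp only [Gen.T, Gen.sy, one_mul, Finset.sum_add_distrib, cn_eq d p _ (show k + 1 = p.val + 1 by omega),
      Finset.mul_sum, Finset.sum_mul]
    have : ∀ i : Fin n, d.tr (i.val + 1) (k + 1) = (gen d).σ (Equiv.swap p i) := by
      intro i
      rw [WBC.tr, Nat.add_sub_cancel, Nat.add_sub_cancel, ← hp, sw_eq n i.2 p.2, Equiv.swap_comm]; rfl
    simp only [this]; rfl

lemma yb_link {k : ℕ} (q : Fin m) (hq : q.val = k) (hkn : k ≤ n) :
    d.yb (k + 1) = (gen d).flip.Y q (below m k) (below n k) := by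
  have hkm : k ≤ m := by have := q.2; omega
  rw [WBC.yb, WBC.Lb, WBC.LLb, sum_link hkn, sum_link hkm, Gen.Y]
  congr 1
  · apply Finset.sum_congr rfl
    intro j _
    rw [WBC.Eb, E_link d j q _ _ rfl (by omega), cn_eq d j _ rfl, Gen.F, Gen.sy, c_En,
      mul_assoc, En_c, ← mul_assoc, sub_eq_add_neg, neg_one_mul]; rfl
  · simp only [Gen.T, Gen.sy, neg_one_mul, Finset.sum_add_distrib, Finset.sum_neg_distrib, ← sub_eq_add_neg,
      cbn_eq d q _ (show k + 1 = q.val + 1 by omega), Finset.mul_sum, Finset.sum_mul]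
    have : ∀ i : Fin m, d.trb (i.val + 1) (k + 1) = (gen d).flip.σ (Equiv.swap q i) := by
      intro i
      rw [WBC.trb, Nat.add_sub_cancel, Nat.add_sub_cancel, ← hq, sw_eq m i.2 q.2, Equiv.swap_comm]; rfl
    simp only [this]
    rw [Finset.sum_sub_distrib]; rfl

variable {d} in
lemma par_Y {α : A →ₐ[R] A} (hα : IsPar d α) (p I J) : α ((gen d).Y p I J) = (gen d).Y p I J := by
  simp only [Gen.Y, Gen.F, Gen.T, Gen.sy, map_sub, map_sum, map_add, map_mul, map_one]
  have h1 : ∀ j, α ((gen d).E p j) = (gen d).E p j := fun j => hα.En p j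
  have h2 : ∀ u, α ((gen d).σ u) = (gen d).σ u := fun j => hα.σ j
  have h3 : ∀ i, α ((gen d).c i) = -(gen d).c i := fun j => hα.c j
  simp [h1, h2, h3]

variable {d} in
lemma par_Yb {α : A →ₐ[R] A} (hα : IsPar d α) (p I J) :
    α ((gen d).flip.Y p I J) = (gen d).flip.Y p I J := by
  simp only [Gen.Y, Gen.F, Gen.T, Gen.sy, map_sub, map_sum, map_add, map_mul, map_one, map_neg]
  have h1 : ∀ j, α ((gen d).flip.E p j) = (gen d).flip.E p j := fun j => hα.En j p
  have h2 : ∀ u, α ((gen d).flip.σ u) = (gen d).flip.σ u := fun j => hα.σb j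
  have h3 : ∀ i, α ((gen d).flip.c i) = -(gen d).flip.c i := fun j => hα.cb j
  simp [h1, h2, h3]
end links

section ysucc
variable {A : Type} [Ring A] {α β : Type} [DecidableEq α] [DecidableEq β] {ε : A}

lemma Gen.conj_Y (g : Gen A α β ε) {p p' : α} {I : Finset α} (J : Finset β) (hp : p ∉ I) (hp' : p' ∉ I) :
    g.σ (Equiv.swap p p') * g.Y p I J * g.σ (Equiv.swap p p') = g.Y p' I J := by
  rw [g.w_Y, Equiv.swap_apply_left, mul_assoc, ← map_mul, Equiv.swap_mul_self, map_one, mul_one,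
    Gen.map_eq]
  intro i hi
  rwa [Equiv.swap_apply_of_ne_of_ne]
  · rintro rfl; exact hp hi
  · rintro rfl; exact hp' hi

lemma Gen.Ysucc (g : Gen A α β ε) {p p' : α} {I : Finset α} (J : Finset β) (hp : p ∉ I) (hp' : p' ∉ I)
    (hne : p ≠ p') :
    g.σ (Equiv.swap p p') * g.Y p I J * g.σ (Equiv.swap p p') -
      (1 - ε * (g.c p * g.c p')) * g.σ (Equiv.swap p p') = g.Y p' (insert p I) J := by
  rw [g.conj_Y J hp hp', Gen.Y, Gen.Y, Finset.sum_insert hp, Gen.T, Gen.sy, Equiv.swap_comm p' p,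
    mul_assoc (g.c p'), g.σ_c, Equiv.swap_apply_right, ← mul_assoc (g.c p'), g.c_anti p' p hne.symm]
  noncomm_ring
end ysucc
end SB8

namespace SB8

section omega
variable {R A : Type} [CommRing R] [Ring A] [Algebra R A] {n m : ℕ} [NeZero n] [NeZero m]

/-- The image of `x_1`. -/
abbrev XX (d : WBC R A n m) (k : ℕ) (p : Fin n) : A := (gen d).Y p (below n k) (below m k)
/-- The image of `x̄_1`. -/
abbrev XB (d : WBC R A n m) (k : ℕ) (q : Fin m) : A := (gen d).flip.Y q (below m k) (below n k)

lemma two_cancel (h2 : IsUnit (2 : R)) (z : A) (h : z = -z) : z = 0 := by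
  obtain ⟨u, hu⟩ := h2
  have h3 : z + z = 0 := by
    nth_rewrite 1 [h]
    exact neg_add_cancel z
  have h4 : (2 : R) • z = 0 := by rw [two_smul, h3]
  have h5 : z = (↑u⁻¹ * ↑u : R) • z := by simp
  rw [h5, mul_smul, hu, h4, smul_zero]

lemma mixed_aux (d : WBC R A n m) (k : ℕ) {p : Fin n} {q : Fin m} (hp : p.val = k) (hq : q.val = k) :
    XX d k p * (En d p q + XB d k q - d.c p * En d p q * d.c p) =
      (En d p q - d.c p * En d p q * d.c p + XB d k q) * XX d k p := by
  have hqJ : q ∉ below m k := by simp [hq]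
  have hpI : p ∉ below n k := by simp [hp]
  have h := (gen d).comm_Y_Yb (p := p) (I := below n k) hqJ
  have h1 : (gen d).flip.Y q (below m k) (insert p (below n k)) =
      En d p q - d.c p * En d p q * d.c p + XB d k q := by
    rw [Gen.Y, Finset.sum_insert hpI, XB, Gen.Y, Gen.F, Gen.sy, neg_one_mul, add_sub_assoc]
    congr 1
    rw [c_En, mul_assoc (d.cb q), En_c, ← mul_assoc, sub_eq_add_neg]; rfl
  rw [h1] at h
  rw [show En d p q + XB d k q - d.c p * En d p q * d.c p =
    En d p q - d.c p * En d p q * d.c p + XB d k q by abel]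
  exact h

lemma core (h2 : IsUnit (2 : R)) (d : WBC R A n m) (k : ℕ) {p : Fin n} {q : Fin m}
    (hp : p.val = k) (hq : q.val = k) : Core (En d p q) (XX d k p) (XB d k q) (d.c p) (d.cb q) where
  two := two_cancel h2
  ee := En_sq d p q
  ec := En_c d p q
  ce := c_En d p q
  ece := En_c_En d p q
  cc := d.c_sq p
  cbcb := d.cb_sq q
  ccb := d.anti_ccb p q
  xc := by
    have := (gen d).c_Y p (below n k) (below m k)
    exact (neg_eq_iff_eq_neg.mpr this).symm
  xcb := ((gen d).comm_cb_Y q p (below n k) (below m k)).symm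
  xbc := ((gen d).flip.comm_cb_Y p q (below m k) (below n k)).symm
  xbcb := by
    have := (gen d).flip.c_Y q (below m k) (below n k)
    exact (neg_eq_iff_eq_neg.mpr this).symm
  ex := (gen d).E_Ysum (by simp [hp]) (by simp [hq])
  xe := (gen d).Ysum_E (by simp [hp]) (by simp [hq])
  mixed := mixed_aux d k hp hq

variable {d : WBC R A n m} (hu : d.IsUniversal) {k : ℕ} (hk : 1 ≤ k) {p : Fin n} {q : Fin m}
    (hp : p.val = k) (hq : q.val = k)

lemma low_unique' (hu : d.IsUniversal) (hk : 1 ≤ k) (hp : p.val = k) (hq : q.val = k)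
    {Z W : A} (hZ : Z ∈ Alow d k) (hW : W ∈ Alow d k) (h : Z * En d p q = W * En d p q) : Z = W := by
  rw [← sub_eq_zero]
  apply low_unique hu hk hp hq ((Alow d k).sub_mem hZ hW)
  rw [sub_mul, h, sub_self]

/-- Elements of the lower subalgebra given by `e z e = Z e` with `z` central for it. -/
lemma low_central (hu : d.IsUniversal) (hk : 1 ≤ k) (hp : p.val = k) (hq : q.val = k)
    {Z W z : A} (hZ : Z ∈ Alow d k) (hW : W ∈ Alow d k) (hz : Commute Z z)
    (h : En d p q * z * En d p q = W * En d p q) : W * Z = Z * W := by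
  have hE := low_E hk hZ hp.ge hq.ge
  apply low_unique' hu hk hp hq ((Alow d k).mul_mem hW hZ) ((Alow d k).mul_mem hZ hW)
  have h1 : Commute Z (En d p q * z * En d p q) := (hE.mul_right hz).mul_right hE
  rw [mul_assoc, hE.eq, ← mul_assoc, ← h, ← h1.eq, h, mul_assoc]

lemma low_parity (hu : d.IsUniversal) (hk : 1 ≤ k) (hp : p.val = k) (hq : q.val = k)
    {α : A →ₐ[R] A} (hα : IsPar d α) {W z : A} (hW : W ∈ Alow d k) (hz : α z = z)
    (h : En d p q * z * En d p q = W * En d p q) : α W = W := by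
  apply low_unique' hu hk hp hq (par_low hα hW) hW
  have := congrArg α h
  simp only [map_mul, hα.En, hz] at this
  rw [← this, h]

lemma card_below (N k : ℕ) (h : k ≤ N) : (below N k).card = k := by
  have h2 := sum_link (A := ℤ) h (fun _ => (1 : ℤ))
  simp at h2
  exact_mod_cast h2.symm
end omega

section main
variable {R A : Type} [CommRing R] [Ring A] [Algebra R A] {r t k : ℕ} [NeZero r] [NeZero t]

/-- The first index after the shift. -/
abbrev pp (r k : ℕ) [NeZero r] : Fin (r + k) := (0 : Fin r).addNat k

lemma pp_val (r k : ℕ) [NeZero r] : (pp r k).val = k := by simp [pp]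

lemma sh_below (w : Equiv.Perm (Fin r)) (i) (hi : i ∈ below (r + k) k) : sh r k w i ∈ below (r + k) k := by
  rw [mem_below] at hi
  rw [sh_low _ _ hi]; simpa using hi

lemma addNat_below (i : Fin r) : i.addNat k ∉ below (r + k) k := by simp

lemma sh_sw {i : ℕ} (h : 1 ≤ i) (h' : i < r) :
    sh r k (sw r (i - 1) i) = sw (r + k) (k + i - 1) (k + i) := by
  rw [sw_eq r (by omega) h', sw_eq (r + k) (by omega) (by omega), sh_swap]
  congr 1
  · exact Fin.ext (by simp; omega)
  · exact Fin.ext (by simp; omega)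

/-- The data of the affine algebra in the target. -/
def mkA (h2 : IsUnit (2 : R)) {d : WBC R A (r + k) (t + k)} (hu : d.IsUniversal) (hk : 1 ≤ k)
    {Ω Ωb : ℕ → A} (m1 : ∀ a, Ω a ∈ Alow d k) (m2 : ∀ a, Ωb a ∈ Alow d k)
    (h1 : ∀ a, En d (pp r k) (pp t k) * XX d k (pp r k) ^ a * En d (pp r k) (pp t k) =
      Ω a * En d (pp r k) (pp t k))
    (h3 : ∀ a, En d (pp r k) (pp t k) * XB d k (pp t k) ^ a * En d (pp r k) (pp t k) =
      Ωb a * En d (pp r k) (pp t k)) : AWBC R A r t 0 where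
  toWBC := shW d
  x1 := XX d k (pp r k)
  xb1 := XB d k (pp t k)
  om := Ω
  omb := Ωb
  om_one := by
    rw [map_zero]
    apply low_unique hu hk (pp_val r k) (pp_val t k) (m1 1)
    rw [← h1, pow_one]
    exact (gen d).E_Y_E (by simp) (by simp) (by rw [card_below _ _ (by omega), card_below _ _ (by omega)])
  om_even a := by
    apply low_unique hu hk (pp_val r k) (pp_val t k) (m1 _)
    rw [← h1, (core h2 d k (pp_val r k) (pp_val t k)).even]
  omb_zero := by
    apply low_unique hu hk (pp_val r k) (pp_val t k) (m2 0)
    rw [← h3, pow_zero, mul_one, En_sq]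
  om_comm a := by
    have hα := (exists_par hu).choose_spec
    have hf := low_parity hu hk (pp_val r k) (pp_val t k) hα (m1 a) (by rw [map_pow, par_Y hα]) (h1 a)
    refine ⟨fun w => ?_, fun w => ?_, fun i => ?_, fun j => ?_, ?_, ?_, ?_, fun l => ?_, fun l => ?_⟩
    · exact low_σ hk (m1 a) (fun i hi => sh_low w i hi)
    · exact low_σb hk (m1 a) (fun i hi => sh_low w i hi)
    · have := low_c hα hk (i := i.addNat k) (by simp) (m1 a)
      rw [hf] at this; exact this.symm
    · have := low_cb hα hk (i := j.addNat k) (by simp) (m1 a)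
      rw [hf] at this; exact this.symm
    · exact low_E hk (m1 a) (pp_val r k).ge (pp_val t k).ge
    · exact low_Y hk (m1 a) (pp_val r k)
    · exact low_Yb hk (m1 a) (pp_val t k)
    · exact low_central hu hk (pp_val r k) (pp_val t k) (m1 l) (m1 a)
        ((low_Y hk (m1 l) (pp_val r k)).pow_right a) (h1 a)
    · exact low_central hu hk (pp_val r k) (pp_val t k) (m2 l) (m1 a)
        ((low_Y hk (m2 l) (pp_val r k)).pow_right a) (h1 a)
  omb_comm a := by
    have hα := (exists_par hu).choose_spec
    have hf := low_parity hu hk (pp_val r k) (pp_val t k) hα (m2 a) (by rw [map_pow, par_Yb hα]) (h3 a)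
    refine ⟨fun w => ?_, fun w => ?_, fun i => ?_, fun j => ?_, ?_, ?_, ?_, fun l => ?_⟩
    · exact low_σ hk (m2 a) (fun i hi => sh_low w i hi)
    · exact low_σb hk (m2 a) (fun i hi => sh_low w i hi)
    · have := low_c hα hk (i := i.addNat k) (by simp) (m2 a)
      rw [hf] at this; exact this.symm
    · have := low_cb hα hk (i := j.addNat k) (by simp) (m2 a)
      rw [hf] at this; exact this.symm
    · exact low_E hk (m2 a) (pp_val r k).ge (pp_val t k).ge
    · exact low_Y hk (m2 a) (pp_val r k)
    · exact low_Yb hk (m2 a) (pp_val t k)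
    · exact low_central hu hk (pp_val r k) (pp_val t k) (m2 l) (m2 a)
        ((low_Yb hk (m2 l) (pp_val t k)).pow_right a) (h3 a)
  x_comm h := by
    have e1 := (gen d).Ysucc (I := below (r + k) k) (below (t + k) k) (addNat_below 0)
      (addNat_below ⟨1, h⟩) (addNat_ne k (ne01 h))
    rw [one_mul] at e1
    rw [sw01 h, fin0]
    change _ * (d.σ (sh r k _) * _ * d.σ (sh r k _) - _ * d.σ (sh r k _)) =
      (d.σ (sh r k _) * _ * d.σ (sh r k _) - _ * d.σ (sh r k _)) * _
    rw [sh_swap]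
    change XX d k (pp r k) * ((gen d).σ _ * _ * (gen d).σ _ - (1 - (gen d).c _ * (gen d).c _) * (gen d).σ _) =
      ((gen d).σ _ * _ * (gen d).σ _ - (1 - (gen d).c _ * (gen d).c _) * (gen d).σ _) * XX d k (pp r k)
    rw [e1]
    exact ((gen d).comm_Y_Y (addNat_below _) (addNat_ne k (ne01 h))).symm
  x1_c1 h := by
    rw [fin0]; exact (core h2 d k (pp_val r k) (pp_val t k)).xc
  x1_c i hi := ((gen d).comm_c_Y _ (addNat_ne k (by rintro rfl; simp at hi)) (addNat_below 0)).symm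
  s_x1 i hi hi' := (gen d).comm_σ_Y _
    (by rw [sh_app, sw_fix (0 : Fin r) (by simp; omega) (by simp)]) (sh_below _)
  xb_comm h := by
    have e1 := (gen d).flip.Ysucc (I := below (t + k) k) (below (r + k) k) (addNat_below 0)
      (addNat_below ⟨1, h⟩) (addNat_ne k (ne01 h))
    rw [neg_one_mul, sub_neg_eq_add] at e1
    rw [sw01 h, fin0]
    change _ * (d.σb (sh t k _) * _ * d.σb (sh t k _) - _ * d.σb (sh t k _)) =
      (d.σb (sh t k _) * _ * d.σb (sh t k _) - _ * d.σb (sh t k _)) * _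
    rw [sh_swap]
    change XB d k (pp t k) * ((gen d).flip.σ _ * _ * (gen d).flip.σ _ -
        (1 + (gen d).flip.c _ * (gen d).flip.c _) * (gen d).flip.σ _) =
      ((gen d).flip.σ _ * _ * (gen d).flip.σ _ -
        (1 + (gen d).flip.c _ * (gen d).flip.c _) * (gen d).flip.σ _) * XB d k (pp t k)
    rw [e1]
    exact ((gen d).flip.comm_Y_Y (addNat_below _) (addNat_ne k (ne01 h))).symm
  xb1_cb1 h := by
    rw [fin0]; exact (core h2 d k (pp_val r k) (pp_val t k)).xbcb
  xb1_cb i hi := ((gen d).flip.comm_c_Y _ (addNat_ne k (by rintro rfl; simp at hi)) (addNat_below 0)).symm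
  sb_xb1 i hi hi' := (gen d).flip.comm_σ_Y _
    (by rw [sh_app, sw_fix (0 : Fin t) (by simp; omega) (by simp)]) (sh_below _)
  e_xsum := (core h2 d k (pp_val r k) (pp_val t k)).ex
  xsum_e := (core h2 d k (pp_val r k) (pp_val t k)).xe
  e_sxs h := by
    have e1 := (gen d).conj_Y (I := below (r + k) k) (below (t + k) k) (addNat_below 0)
      (addNat_below ⟨1, h⟩)
    rw [sw01 h]
    change _ * (d.σ (sh r k _) * _ * d.σ (sh r k _)) = (d.σ (sh r k _) * _ * d.σ (sh r k _)) * _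
    rw [sh_swap]
    change (gen d).E _ _ * ((gen d).σ _ * _ * (gen d).σ _) = ((gen d).σ _ * _ * (gen d).σ _) * (gen d).E _ _
    rw [e1]
    exact (gen d).comm_E_Y_out (addNat_ne k (ne01 h)) (addNat_below _) (addNat_below _)
  x_mixed h := by
    rw [fin0]; exact mixed_aux d k (pp_val r k) (pp_val t k)
  e_sbxbsb h := by
    have e1 := (gen d).flip.conj_Y (I := below (t + k) k) (below (r + k) k) (addNat_below 0)
      (addNat_below ⟨1, h⟩)
    rw [sw01 h]
    change _ * (d.σb (sh t k _) * _ * d.σb (sh t k _)) = (d.σb (sh t k _) * _ * d.σb (sh t k _)) * _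
    rw [sh_swap]
    change (gen d).flip.E _ _ * ((gen d).flip.σ _ * _ * (gen d).flip.σ _) =
      ((gen d).flip.σ _ * _ * (gen d).flip.σ _) * (gen d).flip.E _ _
    rw [e1]
    exact (gen d).flip.comm_E_Y_out (addNat_ne k (ne01 h)) (addNat_below _) (addNat_below _)
  e_xodd a := h1 _
  e_xeven a _ := (core h2 d k (pp_val r k) (pp_val t k)).even a
  e_xb a _ := h3 a
  x1_cb_comm j := ((gen d).comm_cb_Y _ _ _ _).symm
  xb1_c_comm i := ((gen d).flip.comm_cb_Y _ _ _ _).symm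
  x1_σb w := (gen d).comm_σb_Y _ _ (sh_below _)
  xb1_σ w := (gen d).flip.comm_σb_Y _ _ (sh_below _)

end main
end SB8

/-- Theorem 3.7: if `ω_1 = 0`, for any `k ≥ 1` there is a superalgebra
homomorphism `Φ_k : BC^aff_{r,t} → BC_{r+k,t+k}` with `s_i ↦ s_{k+i}`, `s̄_j ↦ s̄_{k+j}`,
`e_1 ↦ e_{k+1}`, `x_1 ↦ y_{k+1}`, `x̄_1 ↦ ȳ_{k+1}`, `c_l ↦ c_{k+l}`, `c̄_m ↦ c̄_{k+m}`,
`ω_a ↦ ω_{a,k+1}`, `ω̄_a ↦ ω̄_{a,k+1}`.  The targets `Ω a = ω_{a,k+1}`,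
`Ωb a = ω̄_{a,k+1}` are characterized by the property of Corollary 2.10. -/
theorem statement8 (R A B : Type) [CommRing R] [IsDomain R] [Ring A] [Algebra R A]
    [Ring B] [Algebra R B]
    (h2 : IsUnit (2 : R)) (r t k : ℕ) (hr : 1 ≤ r) (ht : 1 ≤ t) (hk : 1 ≤ k)
    (ω1 : R) (hω1 : ω1 = 0)
    (d : AWBC R A r t ω1) (hu : d.IsUniversal36)
    (d' : WBC R B (r + k) (t + k)) (hu' : d'.IsUniversal)
    (Ω Ωb : ℕ → B)
    (hΩ : ∀ a : ℕ, Ω a ∈ Algebra.adjoin R (d'.lowerGens k) ∧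
      d'.E (k + 1) (k + 1) * d'.y (k + 1) ^ a * d'.E (k + 1) (k + 1)
        = Ω a * d'.E (k + 1) (k + 1))
    (hΩb : ∀ a : ℕ, Ωb a ∈ Algebra.adjoin R (d'.lowerGens k) ∧
      d'.E (k + 1) (k + 1) * d'.yb (k + 1) ^ a * d'.E (k + 1) (k + 1)
        = Ωb a * d'.E (k + 1) (k + 1)) :
    ∃ φ : A →ₐ[R] B,
      (∀ i : ℕ, 1 ≤ i → i + 1 ≤ r → φ (d.toWBC.s i) = d'.s (k + i)) ∧
      (∀ j : ℕ, 1 ≤ j → j + 1 ≤ t → φ (d.toWBC.sb j) = d'.sb (k + j)) ∧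
      φ d.e = d'.E (k + 1) (k + 1) ∧
      φ d.x1 = d'.y (k + 1) ∧
      φ d.xb1 = d'.yb (k + 1) ∧
      (∀ l : ℕ, 1 ≤ l → l ≤ r → φ (d.toWBC.cn l) = d'.cn (k + l)) ∧
      (∀ m : ℕ, 1 ≤ m → m ≤ t → φ (d.toWBC.cbn m) = d'.cbn (k + m)) ∧
      (∀ a : ℕ, φ (d.om a) = Ω a) ∧
      (∀ a : ℕ, 1 ≤ a → φ (d.omb a) = Ωb a) := by
  subst hω1
  have : NeZero r := ⟨by omega⟩
  have : NeZero t := ⟨by omega⟩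
  have pr := SB8.pp_val r k
  have pt := SB8.pp_val t k
  have hE := SB8.E_link d' (SB8.pp r k) (SB8.pp t k) (k + 1) (k + 1) (by rw [pr]) (by rw [pt])
  have hY := SB8.y_link d' (SB8.pp r k) pr (by omega)
  have hYb := SB8.yb_link d' (SB8.pp t k) pt (by omega)
  have m1 : ∀ a, Ω a ∈ SB8.Alow d' k := fun a => SB8.lowerGens_sub d' k (hΩ a).1
  have m2 : ∀ a, Ωb a ∈ SB8.Alow d' k := fun a => SB8.lowerGens_sub d' k (hΩb a).1
  have h1 := fun a => (hΩ a).2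
  have h3 := fun a => (hΩb a).2
  rw [hE, hY] at h1
  rw [hE, hYb] at h3
  have hc := SB8.core h2 d' k pr pt
  obtain ⟨φ, hφ, -⟩ := hu.2 B (SB8.mkA h2 hu' hk m1 m2 h1 h3) ⟨fun a => by
      apply SB8.low_unique hu' hk pr pt (m2 _)
      rw [← h3, hc.evenb], fun a => by
      apply SB8.low_unique' hu' hk pr pt (m2 _)
      · exact Subalgebra.sum_mem _ fun j _ => (SB8.Alow d' k).mul_mem
          (SB8.acoef_mem _ _ m1 _ _) (m1 _)
      · rw [← h3, hc.odd_final h1]; rfl⟩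
  refine ⟨φ, ?_, ?_, ?_, ?_, ?_, ?_, ?_, fun a => hφ.map_om a, fun a _ => hφ.map_omb a⟩
  · intro i h h'
    rw [WBC.s, hφ.map_σ, WBC.s, ← SB8.sh_sw (by omega) (by omega)]; rfl
  · intro i h h'
    rw [WBC.sb, hφ.map_σb, WBC.sb, ← SB8.sh_sw (by omega) (by omega)]; rfl
  · rw [hφ.map_e, hE]; rfl
  · rw [hφ.map_x1, hY]; rfl
  · rw [hφ.map_xb1, hYb]; rfl
  · intro l h h'
    rw [SB8.cn_eq d.toWBC ⟨l - 1, by omega⟩ l (by simp; omega), hφ.map_c,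
      SB8.cn_eq d' (Fin.addNat ⟨l - 1, by omega⟩ k) (k + l) (by simp; omega)]; rfl
  · intro l h h'
    rw [SB8.cbn_eq d.toWBC ⟨l - 1, by omega⟩ l (by simp; omega), hφ.map_cb,
      SB8.cbn_eq d' (Fin.addNat ⟨l - 1, by omega⟩ k) (k + l) (by simp; omega)]; rfl
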